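/- arXiv:1506.01817 — 3 statements merged into one kernel-verified Lean document; each statement's English description precedes it below -/
import Mathlib

section
/- Let k be a number field with ring of integers 𝔬, let n ≥ 1, and let f ∈ 𝔬[X₀,…,X_n] be a non-constant homogeneous polynomial which is squarefree as a polynomial over k (i.e. not divisible by the square of any non-constant polynomial in k[X₀,…,X_n]). Then there exist a constant C > 0 and M > 0, depending only on f, k and n, such that for every prime ideal 𝔭 of 𝔬 with N𝔭 > M: #{y ∈ (𝔬/𝔭²)^{n+1} : f(y) = 0 in 𝔬/𝔭²} ≤ C·(N𝔭)^{2n}. -/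
open NumberField IsDedekindDomain

section counting
open Polynomial Finset
open scoped Classical

variable {B F : Type*} [CommRing B] [Field F] [Fintype B] [Fintype F]

theorem aux_fiber (π : B →+* F) (hπ : Function.Surjective π) (q : ℕ)
    (hF : Fintype.card F = q) (hB : Fintype.card B = q ^ 2) (s : F) :
    #{b : B | π b = s} ≤ q := by
  have hq : 0 < q := hF ▸ Fintype.card_pos
  have h1 : ∀ s : F, #{b : B | π b = s} = #{b : B | π b = 0} := by
    intro s
    obtain ⟨b, rfl⟩ := hπ s
    refine Finset.card_bij' (fun x _ => x - b) (fun x _ => x + b) ?_ ?_ ?_ ?_ <;> simp [sub_eq_zero]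
  have h2 : Fintype.card B = ∑ s : F, #{b : B | π b = s} := by
    rw [← Finset.card_univ]
    exact Finset.card_eq_sum_card_fiberwise (fun _ _ => by simp)
  rw [Finset.sum_congr rfl (fun s _ => h1 s), Finset.sum_const, Finset.card_univ, hF, hB,
    smul_eq_mul, pow_two] at h2
  rw [h1 s, ← Nat.eq_of_mul_eq_mul_left hq h2]

theorem aux_roots_F (d : ℕ) (P : F[X]) (hP : P ≠ 0) (hd : P.natDegree ≤ d) :
    #{t : F | P.eval t = 0} ≤ d := by
  refine le_trans ?_ ((P.card_roots').trans hd)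
  refine le_trans (Finset.card_le_card ?_) (Multiset.toFinset_card_le _)
  intro t ht
  simp only [Finset.mem_filter, Finset.mem_univ, true_and] at ht
  simp [hP, ht]

theorem aux_roots_bad (π : B →+* F) (hπ : Function.Surjective π) (q : ℕ)
    (hF : Fintype.card F = q) (hB : Fintype.card B = q ^ 2) (d : ℕ) (P : B[X])
    (hP : P.map π ≠ 0) (hd : (P.map π).natDegree ≤ d) :
    #{t : B | P.eval t = 0} ≤ d * q := by
  have := Finset.card_le_mul_card_image_of_maps_to
    (s := ({t : B | P.eval t = 0} : Finset B)) (t := ({t : F | (P.map π).eval t = 0} : Finset F))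
    (f := π) (by
      intro t ht
      simp only [Finset.mem_filter, Finset.mem_univ, true_and] at ht ⊢
      rw [eval_map_apply, ht, map_zero]) q (by
      intro s _
      refine le_trans (Finset.card_le_card ?_) (aux_fiber π hπ q hF hB s)
      intro t; simp)
  refine this.trans ?_
  rw [mul_comm]
  exact Nat.mul_le_mul_right _ (aux_roots_F d _ hP hd)

theorem aux_roots_good (π : B →+* F) (hπ : Function.Surjective π)
    (hker : ∀ x y, π x = 0 → π y = 0 → x * y = 0) (d : ℕ) (P u v : B[X]) (r : B)
    (hP : P.map π ≠ 0) (hd : (P.map π).natDegree ≤ d)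
    (huv : u * P + v * derivative P = C r) (hr : π r ≠ 0) :
    #{t : B | P.eval t = 0} ≤ d := by
  refine le_trans ?_ (aux_roots_F d _ hP hd)
  refine Finset.card_le_card_of_injOn π ?_ ?_
  · intro t ht
    simp only [Finset.coe_filter, Finset.mem_univ, true_and, Set.mem_ofPred_eq] at ht ⊢
    rw [eval_map_apply, ht, map_zero]
  · intro t ht t' ht' h
    simp only [Finset.coe_filter, Finset.mem_univ, true_and, Set.mem_ofPred_eq] at ht ht'
    have he : π (t' - t) = 0 := by simp [h]
    have h2 : (t' - t) ^ 2 = 0 := by rw [pow_two]; exact hker _ _ he he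
    have h3 : P.eval t' = P.eval t + (derivative P).eval t * (t' - t) := by
      obtain ⟨k, hk⟩ := P.binomExpansion t (t' - t)
      simp only [add_sub_cancel, h2, mul_zero, add_zero] at hk
      exact hk
    rw [ht, ht', zero_add] at h3
    have h4 : r * (t' - t) = 0 := by
      have := congrArg (Polynomial.eval t) huv
      simp only [eval_add, eval_mul, eval_C, ht, mul_zero, zero_add] at this
      rw [← this, mul_assoc, ← h3, mul_zero]
    obtain ⟨r', hr'⟩ := hπ (π r)⁻¹
    have h5 : π (1 - r' * r) = 0 := by simp [hr', hr]
    have h6 := hker _ _ h5 he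
    have : t' - t = 0 := by linear_combination h6 + r' * h4
    exact (sub_eq_zero.mp this).symm

theorem aux_sz {n : ℕ} (q : ℕ) (hF : Fintype.card F = q) (p : MvPolynomial (Fin n) F) (hp : p ≠ 0) :
    #{s : Fin n → F | MvPolynomial.eval s p = 0} * q ≤ p.totalDegree * q ^ n := by
  have hq : 0 < q := hF ▸ Fintype.card_pos
  have h := MvPolynomial.schwartz_zippel_totalDegree hp (Finset.univ : Finset F)
  rw [Finset.card_univ, hF, div_le_div_iff₀ (by positivity) (by positivity)] at h
  simp only [Fintype.piFinset_univ] at h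
  exact_mod_cast h

theorem aux_count {O : Type*} [CommRing O] (β : O →+* B) (π : B →+* F)
    (hπ : Function.Surjective π)
    (hker : ∀ x y, π x = 0 → π y = 0 → x * y = 0) (q n : ℕ)
    (hF : Fintype.card F = q) (hB : Fintype.card B = q ^ 2) (d D : ℕ)
    (G u v : (MvPolynomial (Fin n) O)[X]) (R : MvPolynomial (Fin n) O) (c : O)
    (hd : G.natDegree ≤ d) (hc : G.coeff d = MvPolynomial.C c) (hc0 : π (β c) ≠ 0)
    (huv : u * G + v * derivative G = C R)
    (hR : MvPolynomial.map (π.comp β) R ≠ 0) (hD : R.totalDegree ≤ D) :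
    #{p : (Fin n → B) × B | (G.map (MvPolynomial.eval₂Hom β p.1)).eval p.2 = 0}
      ≤ (d + d * D) * q ^ (2 * n) := by
  have hP : ∀ x : Fin n → B, (G.map (MvPolynomial.eval₂Hom β x)).map π ≠ 0 := by
    intro x h
    have := congrArg (fun p => p.coeff d) h
    simp [hc, hc0] at this
  have hPd : ∀ x : Fin n → B, ((G.map (MvPolynomial.eval₂Hom β x)).map π).natDegree ≤ d :=
    fun x => (natDegree_map_le).trans (natDegree_map_le.trans hd)
  have hgood : ∀ x : Fin n → B, #{t : B | (G.map (MvPolynomial.eval₂Hom β x)).eval t = 0} ≤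
      d + if π (MvPolynomial.eval₂Hom β x R) = 0 then d * q else 0 := by
    intro x
    split_ifs with h
    · exact (aux_roots_bad π hπ q hF hB d _ (hP x) (hPd x)).trans (Nat.le_add_left _ _)
    · refine aux_roots_good π hπ hker d _ (u.map (MvPolynomial.eval₂Hom β x))
        (v.map (MvPolynomial.eval₂Hom β x)) (MvPolynomial.eval₂Hom β x R) (hP x) (hPd x) ?_ h
      have := congrArg (Polynomial.map (MvPolynomial.eval₂Hom β x)) huv
      rwa [Polynomial.map_add, Polynomial.map_mul, Polynomial.map_mul, Polynomial.map_C,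
        ← Polynomial.derivative_map] at this
  have hZ : #{x : Fin n → B | π (MvPolynomial.eval₂Hom β x R) = 0} ≤
      q ^ n * #{s : Fin n → F | MvPolynomial.eval s (MvPolynomial.map (π.comp β) R) = 0} := by
    refine Finset.card_le_mul_card_image_of_maps_to (f := fun x => π ∘ x) ?_ _ ?_
    · intro x hx
      simp only [Finset.mem_filter, Finset.mem_univ, true_and] at hx ⊢
      rw [← hx, MvPolynomial.eval_map, MvPolynomial.coe_eval₂Hom,
        MvPolynomial.hom_eval₂]
      rfl
    · intro s _
      calc _ ≤ #(Fintype.piFinset fun i => ({b : B | π b = s i} : Finset B)) := by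
            refine Finset.card_le_card ?_
            intro x hx
            simp only [Finset.mem_filter, Finset.mem_univ, true_and] at hx
            simp [← hx.2]
        _ = ∏ i, #{b : B | π b = s i} := Fintype.card_piFinset _
        _ ≤ ∏ i : Fin n, q := Finset.prod_le_prod' fun i _ => aux_fiber π hπ q hF hB _
        _ = q ^ n := by simp
  have hsz := aux_sz q hF _ hR
  have htd : (MvPolynomial.map (π.comp β) R).totalDegree ≤ D :=
    (Finset.sup_mono (MvPolynomial.support_map_subset _ _)).trans hD
  calc _ = ∑ x : Fin n → B, #{t : B | (G.map (MvPolynomial.eval₂Hom β x)).eval t = 0} := by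
        rw [← Finset.card_sigma]
        refine Finset.card_bij' (fun p _ => ⟨p.1, p.2⟩) (fun p _ => (p.1, p.2)) ?_ ?_ ?_ ?_ <;> simp
    _ ≤ ∑ x : Fin n → B, (d + if π (MvPolynomial.eval₂Hom β x R) = 0 then d * q else 0) :=
        Finset.sum_le_sum fun x _ => hgood x
    _ = q ^ (2 * n) * d + #{x : Fin n → B | π (MvPolynomial.eval₂Hom β x R) = 0} * (d * q) := by
        rw [Finset.sum_add_distrib, Finset.sum_const, Finset.sum_ite, Finset.sum_const,
          Finset.sum_const]
        simp [hB, pow_mul]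
    _ ≤ q ^ (2 * n) * d + (q ^ n * #{s : Fin n → F |
          MvPolynomial.eval s (MvPolynomial.map (π.comp β) R) = 0}) * (d * q) := by gcongr
    _ = q ^ (2 * n) * d + q ^ n * d * (#{s : Fin n → F |
          MvPolynomial.eval s (MvPolynomial.map (π.comp β) R) = 0} * q) := by ring
    _ ≤ q ^ (2 * n) * d + q ^ n * d * (D * q ^ n) := by
        have := hsz.trans (Nat.mul_le_mul_right (q ^ n) htd)
        gcongr
    _ = _ := by ring
end counting

section coords
open Polynomial

/-- The change of coordinates. -/
noncomputable def auxPhi {R : Type*} [CommRing R] {n : ℕ} (a : Fin n → R) :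
    MvPolynomial (Fin (n + 1)) R →+* (MvPolynomial (Fin n) R)[X] :=
  MvPolynomial.eval₂Hom (Polynomial.C.comp MvPolynomial.C)
    (Fin.cons X (fun i => C (MvPolynomial.X i) + C (MvPolynomial.C (a i)) * X))

/-- Its inverse. -/
noncomputable def auxPsi {R : Type*} [CommRing R] {n : ℕ} (a : Fin n → R) :
    (MvPolynomial (Fin n) R)[X] →+* MvPolynomial (Fin (n + 1)) R :=
  Polynomial.eval₂RingHom (MvPolynomial.eval₂Hom MvPolynomial.C
    (fun i => MvPolynomial.X i.succ - MvPolynomial.C (a i) * MvPolynomial.X 0)) (MvPolynomial.X 0)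

theorem auxPsi_auxPhi {R : Type*} [CommRing R] {n : ℕ} (a : Fin n → R)
    (f : MvPolynomial (Fin (n + 1)) R) : auxPsi a (auxPhi a f) = f := by
  have : (auxPsi a).comp (auxPhi a) = RingHom.id _ := by
    refine MvPolynomial.ringHom_ext ?_ ?_
    · intro r; simp [auxPhi, auxPsi]
    · intro i
      refine Fin.cases ?_ (fun i => ?_) i <;> simp [auxPhi, auxPsi]
  exact congrArg (fun φ => φ f) this

theorem auxPhi_auxPsi {R : Type*} [CommRing R] {n : ℕ} (a : Fin n → R)
    (f : (MvPolynomial (Fin n) R)[X]) : auxPhi a (auxPsi a f) = f := by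
  have : (auxPhi a).comp (auxPsi a) = RingHom.id _ := by
    refine Polynomial.ringHom_ext' (MvPolynomial.ringHom_ext ?_ ?_) ?_
    · intro r; simp [auxPhi, auxPsi]
    · intro i; simp [auxPhi, auxPsi]
    · simp [auxPhi, auxPsi]
  exact congrArg (fun φ => φ f) this

theorem auxPhi_map {R S : Type*} [CommRing R] [CommRing S] (φ : R →+* S) {n : ℕ} (a : Fin n → R)
    (f : MvPolynomial (Fin (n + 1)) R) :
    auxPhi (fun i => φ (a i)) (MvPolynomial.map φ f) =
      (auxPhi a f).map (MvPolynomial.map φ) := by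
  have : (auxPhi (fun i => φ (a i))).comp (MvPolynomial.map φ) =
      (Polynomial.mapRingHom (MvPolynomial.map φ)).comp (auxPhi a) := by
    refine MvPolynomial.ringHom_ext ?_ ?_
    · intro r; simp [auxPhi]
    · intro i
      refine Fin.cases ?_ (fun i => ?_) i <;> simp [auxPhi]
  exact congrArg (fun φ => φ f) this

theorem auxPhi_eval {R S : Type*} [CommRing R] [CommRing S] (φ : R →+* S) {n : ℕ} (a : Fin n → R)
    (f : MvPolynomial (Fin (n + 1)) R) (y : Fin (n + 1) → S) :
    ((auxPhi a f).map (MvPolynomial.eval₂Hom φ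
      (fun i : Fin n => y i.succ - φ (a i) * y 0))).eval (y 0) =
      MvPolynomial.eval y (MvPolynomial.map φ f) := by
  have : ((Polynomial.evalRingHom (y 0)).comp (Polynomial.mapRingHom (MvPolynomial.eval₂Hom φ
      (fun i : Fin n => y i.succ - φ (a i) * y 0)))).comp (auxPhi a) =
      (MvPolynomial.eval y).comp (MvPolynomial.map φ) := by
    refine MvPolynomial.ringHom_ext ?_ ?_
    · intro r; simp [auxPhi]
    · intro i
      refine Fin.cases ?_ (fun i => ?_) i <;> simp [auxPhi]
  exact congrArg (fun φ => φ f) this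

theorem aux_lin {R : Type*} [CommRing R] {n : ℕ} (a : Fin n → R) (i : Fin (n + 1)) :
    (Fin.cons X (fun i => C (MvPolynomial.X i) + C (MvPolynomial.C (a i)) * X) :
      Fin (n + 1) → (MvPolynomial (Fin n) R)[X]) i =
    C ((Fin.cons 0 (fun i => MvPolynomial.X i) : Fin (n+1) → MvPolynomial (Fin n) R) i)
     + C (MvPolynomial.C ((Fin.cons 1 a : Fin (n+1) → R) i)) * X := by
  refine Fin.cases ?_ (fun i => ?_) i <;> simp

theorem aux_term {A ι : Type*} [CommRing A] [Fintype ι] (b e : ι → A) (m : ι → ℕ) :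
    (∏ i, (C (b i) + C (e i) * X) ^ m i : A[X]).natDegree ≤ ∑ i, m i ∧
    (∏ i, (C (b i) + C (e i) * X) ^ m i : A[X]).coeff (∑ i, m i) = ∏ i, e i ^ m i := by
  have h1 : ∀ i, (C (b i) + C (e i) * X : A[X]).natDegree ≤ 1 := by
    intro i
    rw [add_comm]
    exact natDegree_linear_le
  have h2 : ∀ i, ((C (b i) + C (e i) * X : A[X]) ^ m i).natDegree ≤ m i := by
    intro i
    simpa using natDegree_pow_le_of_le (m i) (h1 i)
  have h3 : ∀ i, ((C (b i) + C (e i) * X : A[X]) ^ m i).coeff (m i) = e i ^ m i := by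
    intro i
    have := coeff_pow_of_natDegree_le (m := m i) (h1 i)
    simpa using this
  classical
  suffices H : ∀ s : Finset ι, (∏ i ∈ s, (C (b i) + C (e i) * X) ^ m i : A[X]).natDegree ≤
      ∑ i ∈ s, m i ∧
    (∏ i ∈ s, (C (b i) + C (e i) * X) ^ m i : A[X]).coeff (∑ i ∈ s, m i) = ∏ i ∈ s, e i ^ m i from
    H Finset.univ
  intro s
  induction s using Finset.induction_on with
  | empty => simp
  | insert i s hi ih =>
    rw [Finset.prod_insert hi, Finset.sum_insert hi, Finset.prod_insert hi]
    refine ⟨natDegree_mul_le_of_le (h2 i) ih.1, ?_⟩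
    rw [coeff_mul_add_eq_of_natDegree_le (h2 i) ih.1, h3, ih.2]

theorem auxPhi_lead {R : Type*} [CommRing R] {n : ℕ} (a : Fin n → R)
    (f : MvPolynomial (Fin (n + 1)) R) (d : ℕ) (hf : f.IsHomogeneous d) :
    (auxPhi a f).natDegree ≤ d ∧
    (auxPhi a f).coeff d = MvPolynomial.C (MvPolynomial.eval (Fin.cons 1 a) f) := by
  have hdeg : ∀ m ∈ f.support, ∑ i, m i = d := by
    intro m hm
    have := hf (MvPolynomial.mem_support_iff.mp hm)
    rw [Finsupp.weight_apply, Finsupp.sum_fintype _ _ (by simp)] at this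
    simpa using this
  have key : auxPhi a f = ∑ m ∈ f.support, C (MvPolynomial.C (f.coeff m)) *
      ∏ i, (C ((Fin.cons 0 (fun i => MvPolynomial.X i) : Fin (n+1) → MvPolynomial (Fin n) R) i)
     + C (MvPolynomial.C ((Fin.cons 1 a : Fin (n+1) → R) i)) * X) ^ m i := by
    simp only [← aux_lin]
    simp only [auxPhi, MvPolynomial.coe_eval₂Hom]
    rw [MvPolynomial.eval₂_eq']
    rfl
  rw [key]
  constructor
  · refine natDegree_sum_le_of_forall_le _ _ fun m hm => ?_
    refine (natDegree_C_mul_le _ _).trans ?_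
    rw [← hdeg m hm]
    exact (aux_term _ _ _).1
  · rw [finsetSum_coeff, MvPolynomial.eval_eq', map_sum]
    refine Finset.sum_congr rfl fun m hm => ?_
    rw [coeff_C_mul, ← hdeg m hm, (aux_term _ _ _).2]
    simp

theorem aux_exists {R : Type*} [CommRing R] [IsDomain R] [Infinite R] {n : ℕ}
    (f : MvPolynomial (Fin (n + 1)) R) (d : ℕ) (hf : f.IsHomogeneous d) (hf0 : f ≠ 0) :
    ∃ a : Fin n → R, MvPolynomial.eval (Fin.cons 1 a) f ≠ 0 := by
  by_contra! h
  have hP : (MvPolynomial.finSuccEquiv R n f).eval 1 = 0 := by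
    refine MvPolynomial.funext fun x => ?_
    have := h x
    rw [MvPolynomial.eval_eq_eval_mv_eval'] at this
    rw [map_zero, ← this, ← Polynomial.eval_map_apply, map_one]
  obtain ⟨m0, hm0⟩ := MvPolynomial.ne_zero_iff.mp hf0
  have h1 := congrArg (MvPolynomial.coeff m0.tail) hP
  rw [Polynomial.eval_eq_sum, Polynomial.sum, MvPolynomial.coeff_sum,
    Finset.sum_eq_single (m0 0)] at h1
  · simp [MvPolynomial.finSuccEquiv_coeff_coeff, Finsupp.cons_tail, hm0] at h1
  · intro i _ hi
    simp only [one_pow, mul_one, MvPolynomial.finSuccEquiv_coeff_coeff]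
    by_contra h2
    have e1 := hf h2
    have e2 := hf hm0
    rw [Finsupp.weight_apply, Finsupp.sum_fintype _ _ (by simp), Fin.sum_univ_succ] at e1 e2
    simp [Finsupp.tail_apply] at e1 e2
    omega
  · intro h2
    rw [Polynomial.notMem_support_iff.mp h2]
    simp
end coords

section resultant
open Polynomial

theorem aux_squarefree {A K : Type*} [CommRing A] [IsDomain A] [IsIntegrallyClosed A] [Field K]
    [Algebra A K] [IsFractionRing A K] (G : A[X]) (hG : IsUnit G.leadingCoeff)
    (h : ∀ g : A[X], g.Monic → g.natDegree ≠ 0 → ¬ g ^ 2 ∣ G) :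
    Squarefree (G.map (algebraMap A K)) := by
  obtain ⟨w, hw⟩ := hG
  have hinj := IsFractionRing.injective A K
  set G1 : A[X] := C (↑w⁻¹ : A) * G with hG1
  have hG1m : G1.Monic := by
    rw [Monic, hG1, leadingCoeff_mul, leadingCoeff_C, ← hw, Units.inv_mul]
  have hGG : G = C (w : A) * G1 := by
    rw [hG1, ← mul_assoc, ← C_mul, Units.mul_inv, C_1, one_mul]
  have hmap : G1.map (algebraMap A K) = C (algebraMap A K (↑w⁻¹ : A)) * G.map (algebraMap A K) := by
    simp [hG1]
  intro x hx
  have hx1 : x * x ∣ G1.map (algebraMap A K) := hmap ▸ hx.mul_left _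
  have hx0 : x ≠ 0 := by
    rintro rfl
    rw [mul_zero, zero_dvd_iff] at hx1
    exact (hG1m.map (algebraMap A K)).ne_zero hx1
  obtain ⟨g, hg⟩ := IsIntegrallyClosed.eq_map_mul_C_of_dvd K hG1m ((dvd_mul_right x x).trans hx1)
  have hl : x.leadingCoeff ≠ 0 := leadingCoeff_ne_zero.mpr hx0
  have hgm : g.Monic := by
    have := congrArg leadingCoeff hg
    rw [leadingCoeff_mul, leadingCoeff_C, leadingCoeff_map_of_injective hinj] at this
    have := mul_right_cancel₀ hl (this.trans (one_mul _).symm)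
    exact hinj (this.trans (map_one _).symm)
  have hgx : g.map (algebraMap A K) ∣ x := ⟨_, hg.symm⟩
  have hg2 : (g ^ 2).map (algebraMap A K) ∣ G1.map (algebraMap A K) := by
    rw [Polynomial.map_pow, pow_two]
    exact (mul_dvd_mul hgx hgx).trans hx1
  have hg3 := hG1m.dvd_of_fraction_map_dvd_fraction_map (hgm.pow 2) hg2
  have hg4 : g.natDegree = 0 := by
    by_contra h0
    exact h g hgm h0 (hGG ▸ hg3.mul_left _)
  have : g = 1 := eq_one_of_monic_natDegree_zero hgm hg4
  rw [← hg, this]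
  simpa using hl

theorem aux_resultant {A K : Type*} [CommRing A] [Field K] [CharZero K] (j : A →+* K)
    (hj : Function.Injective j) (G : A[X]) (hd : G.natDegree ≠ 0)
    (h : Squarefree (G.map j)) :
    ∃ (R : A) (u v : A[X]), R ≠ 0 ∧ u * G + v * derivative G = C R := by
  have hcop : IsCoprime (G.map j) (derivative (G.map j)) :=
    PerfectField.separable_iff_squarefree.mpr h
  have h1 := resultant_ne_zero _ _ hcop
  rw [derivative_map, natDegree_map_eq_of_injective hj, natDegree_map_eq_of_injective hj,
    resultant_map_map] at h1
  obtain ⟨p, q, -, -, hpq⟩ := exists_mul_add_mul_eq_C_resultant G (derivative G) le_rfl le_rfl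
    (Or.inl hd)
  refine ⟨G.resultant (derivative G), p, q, fun h0 => h1 (by rw [h0, map_zero]), ?_⟩
  rw [← hpq]; ring
end resultant

theorem aux_notMem {k : Type*} [Field k] [NumberField k] (c : 𝓞 k) (hc : c ≠ 0)
    (v : HeightOneSpectrum (𝓞 k))
    (h : Ideal.absNorm (Ideal.span {c}) < Ideal.absNorm v.asIdeal) : c ∉ v.asIdeal := by
  intro hm
  have h1 : Ideal.span {c} ≤ v.asIdeal := (Ideal.span_singleton_le_iff_mem _).mpr hm
  have h2 := Ideal.absNorm_dvd_absNorm_of_le h1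
  have h3 : Ideal.absNorm (Ideal.span {c}) ≠ 0 := by
    rw [Ne, Ideal.absNorm_eq_zero_iff]
    simpa using hc
  exact absurd (Nat.le_of_dvd (Nat.pos_of_ne_zero h3) h2) (not_le.mpr h)

theorem aux_RR {k : Type*} [Field k] [NumberField k] (n : ℕ)
    (f : MvPolynomial (Fin (n + 1)) (𝓞 k))
    (df : ℕ) (hdf : 0 < df) (hfhom : f.IsHomogeneous df)
    (hsf : ∀ g : MvPolynomial (Fin (n + 1)) k, g.totalDegree ≠ 0 →
      ¬ g ^ 2 ∣ MvPolynomial.map (algebraMap (𝓞 k) k) f)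
    (a : Fin n → 𝓞 k) (ha : MvPolynomial.eval (Fin.cons 1 a) f ≠ 0) :
    ∃ (R : MvPolynomial (Fin n) (𝓞 k)) (u v : Polynomial (MvPolynomial (Fin n) (𝓞 k))),
      R ≠ 0 ∧ u * auxPhi a f + v * Polynomial.derivative (auxPhi a f) = Polynomial.C R := by
  obtain ⟨h1, h2⟩ := auxPhi_lead a f df hfhom
  have hinj : Function.Injective (algebraMap (𝓞 k) k) := FaithfulSMul.algebraMap_injective _ _
  have hinj1 : Function.Injective
      (MvPolynomial.map (algebraMap (𝓞 k) k) : MvPolynomial (Fin n) (𝓞 k) →+* _) :=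
    MvPolynomial.map_injective _ hinj
  have hne : (auxPhi a f).coeff df ≠ 0 := by
    rw [h2]; simpa using ha
  have hdeg : (auxPhi a f).natDegree = df := le_antisymm h1 (Polynomial.le_natDegree_of_ne_zero hne)
  let A := MvPolynomial (Fin n) k
  let K := FractionRing A
  have : CharZero K := charZero_of_injective_algebraMap (R := A) (IsFractionRing.injective A K)
  refine aux_resultant ((algebraMap A K).comp (MvPolynomial.map (algebraMap (𝓞 k) k)))
    ((IsFractionRing.injective A K).comp hinj1) _ (by omega) ?_
  rw [← Polynomial.map_map]
  apply aux_squarefree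
  · rw [Polynomial.leadingCoeff_map_of_injective hinj1, Polynomial.leadingCoeff, hdeg, h2,
      MvPolynomial.map_C]
    refine IsUnit.map _ (IsUnit.mk0 _ ?_)
    rwa [Ne, map_eq_zero_iff _ hinj]
  · intro g hgm hg0 hdvd
    rw [← auxPhi_map] at hdvd
    have h3 := map_dvd (auxPsi fun i => algebraMap (𝓞 k) k (a i)) hdvd
    rw [auxPsi_auxPhi, map_pow] at h3
    refine hsf _ ?_ h3
    intro h4
    rw [MvPolynomial.totalDegree_eq_zero_iff_eq_C] at h4
    have h5 := auxPhi_auxPsi (fun i => algebraMap (𝓞 k) k (a i)) g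
    rw [h4] at h5
    apply hg0
    rw [← h5]
    simp [auxPhi]


/-- Counting zeros modulo `𝔭²`: if `f ∈ 𝔬[X₀,…,X_n]` is a non-constant homogeneous polynomial
which is squarefree as a polynomial over `k`, then there are `C > 0` and `M > 0` such that for
every prime ideal `𝔭` with `N𝔭 > M`,
`#{y ∈ (𝔬/𝔭²)^{n+1} : f(y) = 0} ≤ C·(N𝔭)^{2n}`. -/
theorem count_zeros_mod_prime_squared (k : Type*) [Field k] [NumberField k]
    (n : ℕ) (hn : 1 ≤ n)
    (f : MvPolynomial (Fin (n + 1)) (𝓞 k)) (hf0 : f ≠ 0)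
    (df : ℕ) (hdf : 0 < df) (hfhom : f.IsHomogeneous df)
    (hsf : ∀ g : MvPolynomial (Fin (n + 1)) k, g.totalDegree ≠ 0 →
      ¬ g ^ 2 ∣ MvPolynomial.map (algebraMap (𝓞 k) k) f) :
    ∃ C : ℝ, 0 < C ∧ ∃ M : ℕ, ∀ v : HeightOneSpectrum (𝓞 k),
      M < Ideal.absNorm v.asIdeal →
      (Nat.card {y : Fin (n + 1) → 𝓞 k ⧸ (v.asIdeal ^ 2) |
          MvPolynomial.eval y (MvPolynomial.map (Ideal.Quotient.mk (v.asIdeal ^ 2)) f) = 0} : ℝ)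
        ≤ C * (Ideal.absNorm v.asIdeal : ℝ) ^ (2 * n) := by
  classical
  have : Infinite (𝓞 k) := inferInstance
  obtain ⟨a, ha⟩ := aux_exists f df hfhom hf0
  obtain ⟨R, u, w, hR, huv⟩ := aux_RR n f df hdf hfhom hsf a ha
  obtain ⟨h1, h2⟩ := auxPhi_lead a f df hfhom
  obtain ⟨m, hm⟩ := MvPolynomial.ne_zero_iff.mp hR
  refine ⟨((df + df * R.totalDegree : ℕ) : ℝ), by positivity,
    max (Ideal.absNorm (Ideal.span {MvPolynomial.eval (Fin.cons 1 a) f}))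
      (Ideal.absNorm (Ideal.span {MvPolynomial.coeff m R})), ?_⟩
  intro v hv
  have hc := aux_notMem _ ha v ((le_max_left _ _).trans_lt hv)
  have hr := aux_notMem _ hm v ((le_max_right _ _).trans_lt hv)
  have hvm : v.asIdeal.IsMaximal := v.isMaximal
  have hv2 : v.asIdeal ^ 2 ≠ ⊥ := pow_ne_zero 2 v.ne_bot
  let _ : Field (𝓞 k ⧸ v.asIdeal) := Ideal.Quotient.field _
  have : Finite (𝓞 k ⧸ v.asIdeal) := Ideal.finiteQuotientOfFreeOfNeBot _ v.ne_bot
  have : Finite (𝓞 k ⧸ v.asIdeal ^ 2) := Ideal.finiteQuotientOfFreeOfNeBot _ hv2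
  let _ := Fintype.ofFinite (𝓞 k ⧸ v.asIdeal)
  let _ := Fintype.ofFinite (𝓞 k ⧸ v.asIdeal ^ 2)
  have hF : Fintype.card (𝓞 k ⧸ v.asIdeal) = Ideal.absNorm v.asIdeal := by
    rw [← Nat.card_eq_fintype_card]; rfl
  have hB : Fintype.card (𝓞 k ⧸ v.asIdeal ^ 2) = Ideal.absNorm v.asIdeal ^ 2 := by
    rw [← Nat.card_eq_fintype_card, ← map_pow]; rfl
  have hle : v.asIdeal ^ 2 ≤ v.asIdeal := Ideal.pow_le_self two_ne_zero
  let π : (𝓞 k ⧸ v.asIdeal ^ 2) →+* (𝓞 k ⧸ v.asIdeal) := Ideal.Quotient.factor hle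
  have hπβ : ∀ x, π (Ideal.Quotient.mk (v.asIdeal ^ 2) x) = Ideal.Quotient.mk v.asIdeal x :=
    fun x => rfl
  have hπ : Function.Surjective π := Ideal.Quotient.factor_surjective hle
  have hker : ∀ x y, π x = 0 → π y = 0 → x * y = 0 := by
    intro x y
    obtain ⟨x, rfl⟩ := Ideal.Quotient.mk_surjective x
    obtain ⟨y, rfl⟩ := Ideal.Quotient.mk_surjective y
    rw [hπβ, hπβ, Ideal.Quotient.eq_zero_iff_mem, Ideal.Quotient.eq_zero_iff_mem, ← map_mul,
      Ideal.Quotient.eq_zero_iff_mem, pow_two]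
    exact Ideal.mul_mem_mul
  have key := aux_count (Ideal.Quotient.mk (v.asIdeal ^ 2)) π hπ hker _ n hF hB df R.totalDegree
    (auxPhi a f) u w R _ h1 h2 (by rwa [hπβ, Ne, Ideal.Quotient.eq_zero_iff_mem]) huv (by
      intro h0
      have := congrArg (MvPolynomial.coeff m) h0
      rw [MvPolynomial.coeff_map, RingHom.comp_apply, hπβ, MvPolynomial.coeff_zero,
        Ideal.Quotient.eq_zero_iff_mem] at this
      exact hr this) le_rfl
  rw [← Nat.cast_pow, ← Nat.cast_mul, Nat.cast_le]
  refine le_trans ?_ key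
  rw [← Fintype.card_coe, ← Nat.card_eq_fintype_card]
  refine Nat.card_le_card_of_injective (fun y => ⟨((fun i : Fin n => y.1 i.succ -
    Ideal.Quotient.mk (v.asIdeal ^ 2) (a i) * y.1 0), y.1 0), ?_⟩) ?_
  · simp only [Finset.mem_filter, Finset.mem_univ, true_and]
    rw [auxPhi_eval]
    exact y.2
  · rintro ⟨y, hy⟩ ⟨z, hz⟩ h
    simp only [Subtype.mk.injEq, Prod.mk.injEq] at h ⊢
    obtain ⟨h3, h4⟩ := h
    funext i
    refine Fin.cases h4 (fun i => ?_) i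
    have := congrFun h3 i
    simp only [h4] at this
    exact sub_left_injective this
end

section
/- For P ∈ ℙ³(ℚ) with primitive integer representative (a₀,a₁,a₂,a₃) ∈ ℤ⁴ (gcd 1), set H(P) = max_i |a_i|, and say P is everywhere locally soluble if the equation a₀x₀³ + a₁x₁³ + a₂x₂³ + a₃x₃³ = 0 has a nonzero real solution and a nonzero solution in ℚ_p⁴ for every prime p. Then the limit σ = lim_{B→∞} #{P ∈ ℙ³(ℚ) : H(P) ≤ B and P is everywhere locally soluble} / #{P ∈ ℙ³(ℚ) : H(P) ≤ B} exists and equals the convergent product ∏_p σ_p over all primes p, where σ_p = μ_p({a ∈ ℤ_p⁴ : S_a(ℚ_p) ≠ ∅}); moreover σ_p = 1 for every prime p ≡ 2 (mod 3), so that σ = σ_3 · ∏_{p ≡ 1 (mod 3)} σ_p. -/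
open MeasureTheory Filter Topology

instance (p : Nat.Primes) : Fact (p : ℕ).Prime := ⟨p.2⟩

noncomputable instance (p : ℕ) [Fact p.Prime] : MeasurableSpace ℤ_[p] := borel _
instance (p : ℕ) [Fact p.Prime] : BorelSpace ℤ_[p] := ⟨rfl⟩

/-- `P ∈ ℙ³(ℚ)` has height at most `B`: some primitive integer representative
`(a₀,a₁,a₂,a₃)` (with gcd `1`) satisfies `max_i |a_i| ≤ B`. -/
def heightLE (P : Projectivization ℚ (Fin 4 → ℚ)) (B : ℝ) : Prop :=
  ∃ a : Fin 4 → ℤ, Finset.univ.gcd a = 1 ∧ (∀ i, (|a i| : ℝ) ≤ B) ∧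
    ∃ h : (fun i => (a i : ℚ)) ≠ 0, Projectivization.mk ℚ (fun i => (a i : ℚ)) h = P

/-- `P ∈ ℙ³(ℚ)` is everywhere locally soluble: for a primitive integer representative
`(a₀,a₁,a₂,a₃)`, the equation `a₀x₀³ + a₁x₁³ + a₂x₂³ + a₃x₃³ = 0` has a nonzero real
solution and a nonzero solution in `ℚ_p⁴` for every prime `p`. -/
def everywhereLocSol (P : Projectivization ℚ (Fin 4 → ℚ)) : Prop :=
  ∃ a : Fin 4 → ℤ, Finset.univ.gcd a = 1 ∧
    (∃ h : (fun i => (a i : ℚ)) ≠ 0, Projectivization.mk ℚ (fun i => (a i : ℚ)) h = P) ∧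
    (∃ x : Fin 4 → ℝ, x ≠ 0 ∧ ∑ i, (a i : ℝ) * x i ^ 3 = 0) ∧
    (∀ p : Nat.Primes, ∃ x : Fin 4 → ℚ_[(p : ℕ)], x ≠ 0 ∧ ∑ i, (a i : ℚ_[(p : ℕ)]) * x i ^ 3 = 0)

/-- In a finite field, if `g` is not a cube then every nonzero element lies in one of the three
cosets of the cubes. -/
lemma cube_trichotomy {F : Type*} [Field F] [Finite F] (g : F) (hg0 : g ≠ 0)
    (hg : ∀ y : F, y ^ 3 ≠ g) (x : F) (hx : x ≠ 0) :
    (∃ y, y ≠ 0 ∧ x = y ^ 3) ∨ (∃ y, y ≠ 0 ∧ x = g * y ^ 3) ∨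
      (∃ y, y ≠ 0 ∧ x = g ^ 2 * y ^ 3) := by
  obtain ⟨ζ, hζ⟩ := IsCyclic.exists_generator (α := Fˣ)
  obtain ⟨m, hm⟩ := Subgroup.mem_zpowers_iff.1 (hζ (Units.mk0 g hg0))
  obtain ⟨n, hn⟩ := Subgroup.mem_zpowers_iff.1 (hζ (Units.mk0 x hx))
  have hm' : g = (ζ : F) ^ m := by
    have := congrArg (Units.val) hm
    simpa using this.symm
  have hn' : x = (ζ : F) ^ n := by
    have := congrArg (Units.val) hn
    simpa using this.symm
  have hz : (ζ : F) ≠ 0 := ζ.ne_zero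
  have hm3 : m % 3 ≠ 0 := by
    intro h
    apply hg ((ζ : F) ^ (m / 3))
    rw [hm', ← zpow_natCast, ← zpow_mul]
    congr 1
    push_cast
    omega
  have key : n % 3 = 0 ∨ (n - m) % 3 = 0 ∨ (n - 2 * m) % 3 = 0 := by
    have h1 : m % 3 = 1 ∨ m % 3 = 2 := by omega
    have h2 : n % 3 = 0 ∨ n % 3 = 1 ∨ n % 3 = 2 := by omega
    rcases h1 with h1 | h1 <;> rcases h2 with h2 | h2 | h2 <;> omega
  rcases key with h | h | h
  · refine Or.inl ⟨(ζ : F) ^ (n / 3), zpow_ne_zero _ hz, ?_⟩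
    rw [hn', ← zpow_natCast, ← zpow_mul]
    congr 1
    push_cast
    omega
  · refine Or.inr (Or.inl ⟨(ζ : F) ^ ((n - m) / 3), zpow_ne_zero _ hz, ?_⟩)
    rw [hn', hm', ← zpow_natCast, ← zpow_mul, ← zpow_add₀ hz]
    congr 1
    push_cast
    omega
  · refine Or.inr (Or.inr ⟨(ζ : F) ^ ((n - 2 * m) / 3), zpow_ne_zero _ hz, ?_⟩)
    rw [hn', hm', ← zpow_natCast, ← zpow_natCast, ← zpow_mul, ← zpow_mul, ← zpow_add₀ hz]
    congr 1
    push_cast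
    omega

/-- The cyclotomic number `(1,2)` of order three is positive. -/
lemma exists_cyclotomic {F : Type*} [Field F] [Finite F] (g : F) (hg0 : g ≠ 0)
    (hg : ∀ y : F, y ^ 3 ≠ g) : ∃ u v : F, 1 + g * u ^ 3 = g ^ 2 * v ^ 3 ∧ v ≠ 0 := by
  by_contra hcon
  push Not at hcon
  have hg2 : ∀ y : F, y ^ 3 ≠ g ^ 2 := by
    intro y hy
    have hy0 : y ≠ 0 := by
      rintro rfl
      exact hg0 (by simpa using hy.symm)
    apply hg (g / y)
    rw [div_pow, hy]
    field_simp
  let K := {x : F // ∃ y, y ≠ 0 ∧ x = y ^ 3}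
  have hne : ∀ u : F, 1 + g * u ^ 3 ≠ 0 := by
    intro u hu
    have hu0 : u ≠ 0 := by
      rintro rfl
      simp at hu
    apply hg (-u⁻¹)
    have : g * u ^ 3 = -1 := by linear_combination hu
    field_simp
    linear_combination -this
  -- classes
  have hcls : ∀ k : K, (∃ y, y ≠ 0 ∧ 1 + g * k.1 = y ^ 3) ∨
      (∃ y, y ≠ 0 ∧ 1 + g * k.1 = g * y ^ 3) := by
    rintro ⟨k, u, hu, rfl⟩
    rcases cube_trichotomy g hg0 hg _ (hne u) with h | h | ⟨v, hv, h⟩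
    · exact Or.inl h
    · exact Or.inr h
    · exact absurd (hcon u v h) hv
  have hdisj : ∀ k : K, (∃ y, y ≠ 0 ∧ 1 + g * k.1 = y ^ 3) →
      ¬ (∃ y, y ≠ 0 ∧ 1 + g * k.1 = g * y ^ 3) := by
    rintro k ⟨y, hy, h⟩ ⟨z, hz, h'⟩
    apply hg (y / z)
    rw [div_pow, ← h, h']
    field_simp
  have hk0 : ∀ k : K, k.1 ≠ 0 := by
    rintro ⟨k, u, hu, rfl⟩
    exact pow_ne_zero _ hu
  classical
  let φ : K → K := fun k =>
    if h : ∃ y, y ≠ 0 ∧ 1 + g * k.1 = y ^ 3 then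
      ⟨-(1 + g * k.1), by
        obtain ⟨y, hy, h⟩ := h
        exact ⟨-y, neg_ne_zero.2 hy, by rw [h]; ring⟩⟩
    else ⟨-(1 + g * k.1) / (g * k.1), by
        obtain ⟨y, hy, h⟩ := (hcls k).resolve_left h
        obtain ⟨z, hz, h'⟩ := k.2
        refine ⟨-(y / z), neg_ne_zero.2 (div_ne_zero hy hz), ?_⟩
        rw [h, h', neg_pow, div_pow]
        field_simp⟩
  have hinj : Function.Injective φ := by
    intro k l hkl
    have h1 := congrArg Subtype.val hkl
    have hk := hk0 k
    have hl := hk0 l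
    by_cases a : ∃ y, y ≠ 0 ∧ 1 + g * k.1 = y ^ 3 <;>
    by_cases b : ∃ y, y ≠ 0 ∧ 1 + g * l.1 = y ^ 3
    · simp only [φ, a, b, dite_true] at h1
      apply Subtype.ext
      apply mul_left_cancel₀ hg0
      linear_combination -h1
    · exfalso
      simp only [φ, a, b, dite_true, dite_false] at h1
      have : g ^ 2 * k.1 * l.1 = 1 := by
        field_simp at h1
        linear_combination -h1
      obtain ⟨y, hy, h⟩ := k.2
      obtain ⟨z, hz, h'⟩ := l.2
      apply hg2 (1 / (y * z))
      rw [h, h'] at this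
      field_simp
      linear_combination -this
    · exfalso
      simp only [φ, a, b, dite_true, dite_false] at h1
      have : g ^ 2 * k.1 * l.1 = 1 := by
        field_simp at h1
        linear_combination h1
      obtain ⟨y, hy, h⟩ := k.2
      obtain ⟨z, hz, h'⟩ := l.2
      apply hg2 (1 / (y * z))
      rw [h, h'] at this
      field_simp
      linear_combination -this
    · simp only [φ, a, b, dite_false] at h1
      apply Subtype.ext
      apply mul_left_cancel₀ hg0
      field_simp at h1
      linear_combination g * h1
  have hsurj := Finite.injective_iff_surjective.1 hinj
  obtain ⟨k, hk⟩ := hsurj ⟨-1, -1, by simp, by ring⟩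
  have h1 := congrArg Subtype.val hk
  have hk := hk0 k
  by_cases a : ∃ y, y ≠ 0 ∧ 1 + g * k.1 = y ^ 3
  · simp only [φ, a, dite_true] at h1
    have : g * k.1 = 0 := by linear_combination -h1
    exact mul_ne_zero hg0 hk this
  · simp only [φ, a, dite_false] at h1
    field_simp at h1
    have : (1 : F) = 0 := by linear_combination -h1
    exact one_ne_zero this

/-- Diagonal ternary cubic forms over a finite field are isotropic. -/
lemma ternary_cubic {F : Type*} [Field F] [Finite F] (a b c : F) (ha : a ≠ 0) (hb : b ≠ 0)
    (hc : c ≠ 0) : ∃ x : Fin 3 → F, x ≠ 0 ∧ a * x 0 ^ 3 + b * x 1 ^ 3 + c * x 2 ^ 3 = 0 := by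
  by_cases h1 : ∃ y, y ^ 3 = b / a
  · obtain ⟨y, hy⟩ := h1
    refine ⟨![-y, 1, 0], fun h => by simpa using congrFun h 1, ?_⟩
    have : a * y ^ 3 = b := by rw [hy]; field_simp
    simp
    linear_combination -this
  by_cases h2 : ∃ y, y ^ 3 = c / a
  · obtain ⟨y, hy⟩ := h2
    refine ⟨![-y, 0, 1], fun h => by simpa using congrFun h 2, ?_⟩
    have : a * y ^ 3 = c := by rw [hy]; field_simp
    simp
    linear_combination -this
  by_cases h3 : ∃ y, y ^ 3 = c / b
  · obtain ⟨y, hy⟩ := h3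
    refine ⟨![0, -y, 1], fun h => by simpa using congrFun h 2, ?_⟩
    have : b * y ^ 3 = c := by rw [hy]; field_simp
    simp
    linear_combination -this
  push Not at h1 h2 h3
  have hg0 : b / a ≠ 0 := div_ne_zero hb ha
  rcases cube_trichotomy (b / a) hg0 h1 (c / a) (div_ne_zero hc ha) with
    ⟨y, -, hy⟩ | ⟨y, -, hy⟩ | ⟨w, hw, hw'⟩
  · exact absurd hy.symm (h2 y)
  · exfalso
    apply h3 y
    field_simp at hy ⊢
    exact hy.symm
  · obtain ⟨u, v, huv, -⟩ := exists_cyclotomic (b / a) hg0 h1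
    refine ⟨![1, u, -(v / w)], fun h => by simpa using congrFun h 0, ?_⟩
    simp
    have hc' : c = a * ((b / a) ^ 2 * w ^ 3) := by rw [← hw']; field_simp
    have : a + b * u ^ 3 = a * (1 + b / a * u ^ 3) := by field_simp
    rw [this, huv, hc', neg_pow, div_pow]
    field_simp
    ring

/-- Solubility over `ℚ_p` of the diagonal cubic surface. -/
def Sol (p : ℕ) [Fact p.Prime] (a : Fin 4 → ℤ_[p]) : Prop :=
  ∃ x : Fin 4 → ℚ_[p], x ≠ 0 ∧ ∑ i, (a i : ℚ_[p]) * x i ^ 3 = 0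

section padic
variable {p : ℕ} [hp : Fact p.Prime]

lemma hensel_cube (c x : ℤ_[p]) (h : ‖x ^ 3 - c‖ < ‖3 * x ^ 2‖ ^ 2) : ∃ z : ℤ_[p], z ^ 3 = c := by
  have := hensels_lemma (p := p) (F := (Polynomial.X ^ 3 - Polynomial.C c : Polynomial ℤ_[p]))
    (a := x) (by
      have h2 : (2 + 1 : ℤ_[p]) = 3 := by norm_num
      simpa [h2] using h)
  obtain ⟨z, hz, -⟩ := this
  exact ⟨z, by simpa [sub_eq_zero] using hz⟩

lemma norm_three (h : p ≠ 3) : ‖(3 : ℤ_[p])‖ = 1 := by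
  have h1 := PadicInt.norm_le_one (3 : ℤ_[p])
  refine le_antisymm h1 (not_lt.1 fun h2 => ?_)
  have h3 := (PadicInt.norm_int_lt_one_iff_dvd (p := p) 3).1 (by exact_mod_cast h2)
  have : p ∣ 3 := by exact_mod_cast h3
  exact h ((Nat.prime_dvd_prime_iff_eq hp.1 Nat.prime_three).1 this)

lemma norm_three_ge : (p : ℝ) ^ (-1 : ℤ) ≤ ‖(3 : ℤ_[p])‖ := by
  by_cases h : p = 3
  · subst h
    have := PadicInt.norm_p (p := 3)
    simp only [Nat.cast_ofNat] at this
    rw [this]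
    simp
  · rw [norm_three h]
    have : (1 : ℝ) ≤ p := by exact_mod_cast hp.1.one_le
    rw [zpow_neg_one]
    exact inv_le_one_of_one_le₀ this

lemma toZMod_eq_iff (x y : ℤ_[p]) : PadicInt.toZMod x = PadicInt.toZMod y ↔ ‖x - y‖ < 1 := by
  rw [← sub_eq_zero, ← map_sub, ← RingHom.mem_ker, PadicInt.ker_toZMod,
    PadicInt.maximalIdeal_eq_span_p, Ideal.mem_span_singleton, PadicInt.norm_lt_one_iff_dvd]

lemma toZMod_zero_iff (x : ℤ_[p]) : PadicInt.toZMod x = 0 ↔ (p : ℤ_[p]) ∣ x := by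
  rw [← map_zero PadicInt.toZMod, toZMod_eq_iff, sub_zero, PadicInt.norm_lt_one_iff_dvd]

lemma cube_of_mod (h3 : p ≠ 3) (c : ℤ_[p]) (y : ZMod p) (hy : y ≠ 0)
    (h : PadicInt.toZMod c = y ^ 3) : ∃ z : ℤ_[p], z ^ 3 = c := by
  obtain ⟨x, rfl⟩ := ZMod.ringHom_surjective (PadicInt.toZMod (p := p)) y
  apply hensel_cube c x
  rw [← map_pow, eq_comm, toZMod_eq_iff] at h
  have hx : ‖x‖ = 1 := by
    rw [ne_eq, toZMod_zero_iff, ← PadicInt.norm_lt_one_iff_dvd, not_lt] at hy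
    exact le_antisymm (PadicInt.norm_le_one x) hy
  simpa [norm_three h3, hx] using h

/-- Multiplying coefficients by nonzero cubes does not change solubility. -/
lemma sol_of_cubes (a b c : Fin 4 → ℤ_[p]) (hc : ∀ i, c i ≠ 0) (h : ∀ i, b i = a i * c i ^ 3) :
    Sol p b → Sol p a := by
  rintro ⟨x, hx, hs⟩
  refine ⟨fun i => c i * x i, fun h0 => hx ?_, ?_⟩
  · funext i
    have := congrFun h0 i
    have hci : (c i : ℚ_[p]) ≠ 0 := by
      simpa using hc i
    simpa [hci] using this
  · rw [← hs]
    refine Finset.sum_congr rfl fun i _ => ?_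
    rw [h i]
    push_cast
    ring

lemma cube_close (a b : ℤ_[p]) (k : ℕ) (h : ¬ (p : ℤ_[p]) ^ k ∣ a)
    (hab : (p : ℤ_[p]) ^ (k + 3) ∣ b - a) : ∃ c : ℤ_[p], c ≠ 0 ∧ b = a * c ^ 3 := by
  have ha : a ≠ 0 := by
    rintro rfl
    exact h (dvd_zero _)
  have hv := PadicInt.unitCoeff_spec ha
  set u := PadicInt.unitCoeff ha
  set m := a.valuation
  have hm : m < k := by
    by_contra hmk
    apply h
    rw [hv]
    exact Dvd.dvd.mul_left (pow_dvd_pow _ (not_lt.1 hmk)) _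
  obtain ⟨s, hs⟩ := hab
  obtain ⟨e, rfl⟩ := Nat.exists_eq_add_of_lt hm
  let t : ℤ_[p] := ((u⁻¹ : ℤ_[p]ˣ) : ℤ_[p]) * p ^ (e + 1) * s
  have huu : (u : ℤ_[p]) * ((u⁻¹ : ℤ_[p]ˣ) : ℤ_[p]) = 1 := by simp
  have hb : b = a * (1 + p ^ 3 * t) := by
    have : b = a + p ^ (m + e + 1 + 3) * s := by rw [← hs]; ring
    rw [this]
    simp only [t]
    have h2 : a * (p ^ 3 * (((u⁻¹ : ℤ_[p]ˣ) : ℤ_[p]) * p ^ (e + 1) * s)) =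
       p ^ (m + e + 1 + 3) * s := by
      conv_lhs => rw [hv]
      calc _ = ((u : ℤ_[p]) * ((u⁻¹ : ℤ_[p]ˣ) : ℤ_[p])) * (p ^ (m + e + 1 + 3) * s) := by ring
        _ = _ := by rw [huu, one_mul]
    rw [mul_add, h2, mul_one]
  have hp1 : (1 : ℝ) < p := by exact_mod_cast hp.1.one_lt
  obtain ⟨c, hc⟩ := hensel_cube (1 + (p : ℤ_[p]) ^ 3 * t) 1 (by
    have h1 : ‖(1 : ℤ_[p]) ^ 3 - (1 + (p : ℤ_[p]) ^ 3 * t)‖ ≤ (p : ℝ) ^ (-(3 : ℕ) : ℤ) := by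
      rw [PadicInt.norm_le_pow_iff_mem_span_pow, Ideal.mem_span_singleton]
      exact ⟨-t, by ring⟩
    refine h1.trans_lt ?_
    have h2 := norm_three_ge (p := p)
    have h3 : (0 : ℝ) < (p : ℝ) ^ (-1 : ℤ) := by positivity
    calc (p : ℝ) ^ (-(3 : ℕ) : ℤ) < (p : ℝ) ^ (-2 : ℤ) := by
          apply zpow_lt_zpow_right₀ hp1; norm_num
      _ = ((p : ℝ) ^ (-1 : ℤ)) ^ 2 := by rw [← zpow_natCast, ← zpow_mul]; norm_num
      _ ≤ ‖(3 : ℤ_[p])‖ ^ 2 := by gcongr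
      _ = _ := by simp)
  refine ⟨c, ?_, by rw [hc, hb]⟩
  rintro rfl
  have hh : ‖(p : ℤ_[p]) ^ 3 * t‖ = 1 := by
    have : (p : ℤ_[p]) ^ 3 * t = -1 := by linear_combination -hc
    rw [this]; simp
  have h1 : ‖(p : ℤ_[p]) ^ 3 * t‖ < 1 := by
    rw [PadicInt.norm_lt_one_iff_dvd]
    exact ⟨p ^ 2 * t, by ring⟩
  linarith

/-- Local constancy of solubility away from the coordinate hyperplanes. -/
lemma sol_congr (a b : Fin 4 → ℤ_[p]) (k : ℕ) (h : ∀ i, ¬ (p : ℤ_[p]) ^ k ∣ a i)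
    (hab : ∀ i, (p : ℤ_[p]) ^ (k + 3) ∣ b i - a i) (hb : Sol p b) : Sol p a := by
  choose c hc hc' using fun i => cube_close (a i) (b i) k (h i) (hab i)
  exact sol_of_cubes a b c hc hc' hb

lemma sol_of_zero (a : Fin 4 → ℤ_[p]) (i : Fin 4) (h : a i = 0) : Sol p a := by
  refine ⟨Pi.single i 1, by simp, ?_⟩
  refine Finset.sum_eq_zero fun j _ => ?_
  by_cases hj : j = i
  · subst hj; simp [h]
  · simp [hj]

lemma sol_of_two (a : Fin 4 → ℤ_[p]) (i j : Fin 4) (hij : i ≠ j) (z : ℚ_[p])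
    (h : (a i : ℚ_[p]) * z ^ 3 + a j = 0) : Sol p a := by
  refine ⟨Pi.single i z + Pi.single j 1, fun h0 => ?_, ?_⟩
  · have := congrFun h0 j
    simp [hij.symm] at this
  · rw [← Finset.sum_subset (Finset.subset_univ {i, j})]
    · rw [Finset.sum_pair hij]
      simp [hij, hij.symm, h]
    · intro l _ hl
      simp only [Finset.mem_insert, Finset.mem_singleton, not_or] at hl
      simp [hl.1, hl.2]

lemma cube_two_mod_three (h : p % 3 = 2) (c : ℤ_[p]ˣ) : ∃ z : ℤ_[p], z ^ 3 = c := by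
  have h0 : PadicInt.toZMod (c : ℤ_[p]) ≠ 0 := (c.isUnit.map PadicInt.toZMod).ne_zero
  refine cube_of_mod (by omega) c ((PadicInt.toZMod (c : ℤ_[p])) ^ (2 * (p / 3) + 1))
    (pow_ne_zero _ h0) ?_
  rw [← pow_mul]
  have : (2 * (p / 3) + 1) * 3 = (p - 1) + (p - 1) + 1 := by omega
  rw [this, pow_succ, pow_add, ZMod.pow_card_sub_one_eq_one h0]
  simp

/-- Everything is soluble if `p ≡ 2 (mod 3)`. -/
lemma sol_two_mod_three (h : p % 3 = 2) (a : Fin 4 → ℤ_[p]) : Sol p a := by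
  by_cases h0 : ∃ i, a i = 0
  · obtain ⟨i, hi⟩ := h0
    exact sol_of_zero a i hi
  push Not at h0
  obtain ⟨i, j, hij, hv⟩ := Fintype.exists_ne_map_eq_of_card_lt
    (fun i => (⟨(a i).valuation % 3, Nat.mod_lt _ (by norm_num)⟩ : Fin 3)) (by simp)
  simp only [Fin.mk.injEq] at hv
  have main : ∀ i j : Fin 4, i ≠ j → (a i).valuation % 3 = (a j).valuation % 3 →
      (a i).valuation ≤ (a j).valuation → Sol p a := by
    intro i j hij hv hle
    obtain ⟨t, ht⟩ : ∃ t, (a j).valuation = (a i).valuation + 3 * t :=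
      ⟨((a j).valuation - (a i).valuation) / 3, by omega⟩
    have hi := PadicInt.unitCoeff_spec (h0 i)
    have hj := PadicInt.unitCoeff_spec (h0 j)
    set u := PadicInt.unitCoeff (h0 i)
    set v := PadicInt.unitCoeff (h0 j)
    obtain ⟨m, hm⟩ : ∃ m, m = (a i).valuation := ⟨_, rfl⟩
    rw [← hm] at hi ht
    obtain ⟨w, hw⟩ := cube_two_mod_three h (u⁻¹ * v)
    refine sol_of_two a i j hij ((-(w * p ^ t) : ℤ_[p]) : ℚ_[p]) ?_
    have : a i * (-(w * p ^ t)) ^ 3 + a j = 0 := by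
      have huu : (u : ℤ_[p]) * ((u⁻¹ : ℤ_[p]ˣ) : ℤ_[p]) = 1 := by simp
      have : a i * (-(w * p ^ t)) ^ 3 = -(a i * w ^ 3 * p ^ (3 * t)) := by ring
      rw [this, hw, hj, ht]
      conv_lhs => rw [hi]
      push_cast
      linear_combination (-v * p ^ (m + 3 * t) : ℤ_[p]) * huu
    exact_mod_cast congrArg (fun x : ℤ_[p] => (x : ℚ_[p])) this
  rcases le_total (a i).valuation (a j).valuation with hle | hle
  · exact main i j hij hv hle
  · exact main j i hij.symm hv.symm hle

lemma sol_of_units (h3 : p ≠ 3) (a : Fin 4 → ℤ_[p]) (i : Fin 4)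
    (h : ∀ j, j ≠ i → ¬ (p : ℤ_[p]) ∣ a j) : Sol p a := by
  have hne : ∀ l : Fin 3, PadicInt.toZMod (a (i.succAbove l)) ≠ 0 := fun l => by
    rw [ne_eq, toZMod_zero_iff]
    exact h _ (Fin.succAbove_ne i l)
  obtain ⟨y, hy, hs⟩ := ternary_cubic _ _ _ (hne 0) (hne 1) (hne 2)
  have hsum : ∑ l : Fin 3, PadicInt.toZMod (a (i.succAbove l)) * y l ^ 3 = 0 := by
    rw [Fin.sum_univ_three]; exact hs
  obtain ⟨m, hm⟩ : ∃ m, y m ≠ 0 := by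
    by_contra hcon
    push Not at hcon
    exact hy (funext hcon)
  choose Y hY using fun l => ZMod.ringHom_surjective (PadicInt.toZMod (p := p)) (y l)
  have hu : IsUnit (a (i.succAbove m)) := by
    have := hne m
    rw [ne_eq, toZMod_zero_iff, ← PadicInt.norm_lt_one_iff_dvd, ← PadicInt.not_isUnit_iff,
      not_not] at this
    exact this
  obtain ⟨u, hu⟩ := hu
  have huu : (u : ℤ_[p]) * ((u⁻¹ : ℤ_[p]ˣ) : ℤ_[p]) = 1 := by simp
  have hsplit := Finset.add_sum_erase Finset.univ
    (fun l => PadicInt.toZMod (a (i.succAbove l)) * y l ^ 3) (Finset.mem_univ m)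
  rw [hsum] at hsplit
  obtain ⟨z, hz⟩ := cube_of_mod h3
    (-((u⁻¹ : ℤ_[p]ˣ) : ℤ_[p]) * ∑ l ∈ Finset.univ.erase m, a (i.succAbove l) * Y l ^ 3) (y m) hm (by
      rw [map_mul, map_sum]
      simp only [map_mul, map_pow, hY, map_neg]
      have e1 := congrArg (PadicInt.toZMod (p := p)) huu
      rw [map_mul, map_one, hu] at e1
      linear_combination (-PadicInt.toZMod ((u⁻¹ : ℤ_[p]ˣ) : ℤ_[p])) * hsplit + y m ^ 3 * e1)
  have hz0 : z ≠ 0 := by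
    rintro rfl
    apply hm
    have e0 : -((u⁻¹ : ℤ_[p]ˣ) : ℤ_[p]) *
      ∑ l ∈ Finset.univ.erase m, a (i.succAbove l) * Y l ^ 3 = 0 := by rw [← hz]; ring
    have e2 : ∑ l ∈ Finset.univ.erase m, a (i.succAbove l) * Y l ^ 3 = 0 := by
      linear_combination (-(u : ℤ_[p])) * e0 - (∑ l ∈ Finset.univ.erase m, a (i.succAbove l) * Y l ^ 3) * huu
    have e3 := congrArg (PadicInt.toZMod (p := p)) e2
    rw [map_sum] at e3
    simp only [map_mul, map_pow, hY, map_zero] at e3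
    rw [e3, add_zero] at hsplit
    exact pow_eq_zero_iff (n := 3) (by norm_num) |>.1 ((mul_eq_zero.1 hsplit).resolve_left (hne m))
  let Z : Fin 3 → ℤ_[p] := Function.update Y m z
  have hZ : ∑ l, a (i.succAbove l) * Z l ^ 3 = 0 := by
    rw [← Finset.add_sum_erase _ _ (Finset.mem_univ m)]
    have e1 : ∑ l ∈ Finset.univ.erase m, a (i.succAbove l) * Z l ^ 3 =
        ∑ l ∈ Finset.univ.erase m, a (i.succAbove l) * Y l ^ 3 := by
      refine Finset.sum_congr rfl fun l hl => ?_
      simp [Z, Finset.ne_of_mem_erase hl]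
    rw [e1]
    simp only [Z, Function.update_self]
    rw [hz, ← hu]
    linear_combination (-(∑ l ∈ Finset.univ.erase m, a (i.succAbove l) * Y l ^ 3)) * huu
  refine ⟨fun j => ((i.insertNth 0 Z : Fin 4 → ℤ_[p]) j : ℚ_[p]), fun h0 => hz0 ?_, ?_⟩
  · have := congrFun h0 (i.succAbove m)
    simpa [Z] using this
  · rw [Fin.sum_univ_succAbove _ i]
    simp only [Fin.insertNth_apply_same, Fin.insertNth_apply_succAbove]
    have := congrArg (fun x : ℤ_[p] => (x : ℚ_[p])) hZ
    push_cast at this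
    simpa using this

/-- An insoluble surface has at least two coefficients divisible by `p` if `p ≠ 3`. -/
lemma two_dvd_of_not_sol (h3 : p ≠ 3) (a : Fin 4 → ℤ_[p]) (h : ¬ Sol p a) :
    ∃ i j, i ≠ j ∧ (p : ℤ_[p]) ∣ a i ∧ (p : ℤ_[p]) ∣ a j := by
  have h1 : ∀ i, ∃ j, j ≠ i ∧ (p : ℤ_[p]) ∣ a j := by
    intro i
    by_contra hcon
    push Not at hcon
    exact h (sol_of_units h3 a i hcon)
  obtain ⟨i, -, hi⟩ := h1 0
  obtain ⟨j, hj, hj'⟩ := h1 i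
  exact ⟨i, j, hj.symm, hi, hj'⟩

end padic

section haar
variable {p : ℕ} [hp : Fact p.Prime]

/-- Coordinatewise reduction modulo `p ^ k`. -/
noncomputable def red (p : ℕ) [Fact p.Prime] (k : ℕ) (a : Fin 4 → ℤ_[p]) : Fin 4 → ZMod (p ^ k) :=
  fun i => PadicInt.toZModPow k (a i)

lemma toZModPow_eq_iff (k : ℕ) (x y : ℤ_[p]) :
    PadicInt.toZModPow k x = PadicInt.toZModPow k y ↔ (p : ℤ_[p]) ^ k ∣ x - y := by
  rw [← sub_eq_zero, ← map_sub, ← RingHom.mem_ker, PadicInt.ker_toZModPow,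
    Ideal.mem_span_singleton]

lemma toZModPow_zero_iff (k : ℕ) (x : ℤ_[p]) :
    PadicInt.toZModPow k x = 0 ↔ (p : ℤ_[p]) ^ k ∣ x := by
  rw [← map_zero (PadicInt.toZModPow k), toZModPow_eq_iff, sub_zero]

lemma red_surj (k : ℕ) : Function.Surjective (red p k) := by
  intro r
  choose a ha using fun i => ZMod.ringHom_surjective (PadicInt.toZModPow (p := p) k) (r i)
  exact ⟨a, funext ha⟩

lemma measurable_fiber (k : ℕ) (r : Fin 4 → ZMod (p ^ k)) : MeasurableSet {a | red p k a = r} := by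
  have : {a | red p k a = r} = Set.pi Set.univ (fun i => {x | PadicInt.toZModPow k x = r i}) := by
    ext a
    simp [red, funext_iff]
  rw [this]
  refine MeasurableSet.univ_pi fun i => ?_
  obtain ⟨y, hy⟩ := ZMod.ringHom_surjective (PadicInt.toZModPow (p := p) k) (r i)
  have : {x | PadicInt.toZModPow k x = r i} = Metric.closedBall y ((p : ℝ) ^ (-k : ℤ)) := by
    ext x
    rw [Set.mem_ofPred_eq, ← hy, toZModPow_eq_iff, mem_closedBall_iff_norm,
      PadicInt.norm_le_pow_iff_mem_span_pow, Ideal.mem_span_singleton]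
  rw [this]
  exact Metric.isClosed_closedBall.measurableSet

variable (μ : Measure (Fin 4 → ℤ_[p])) [μ.IsAddLeftInvariant] [IsProbabilityMeasure μ]

lemma haar_cyl (k : ℕ) (A : Finset (Fin 4 → ZMod (p ^ k))) :
    μ.real {a | red p k a ∈ A} = A.card / ((p : ℝ) ^ k) ^ 4 := by
  have hfib : ∀ r, μ.real {a | red p k a = r} = μ.real {a | red p k a = 0} := by
    intro r
    obtain ⟨s, hs⟩ := red_surj k (p := p) r
    have : {a | red p k a = r} = (fun a => -s + a) ⁻¹' {a | red p k a = 0} := by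
      ext a
      simp only [Set.mem_ofPred_eq, Set.mem_preimage]
      rw [← hs, funext_iff, funext_iff]
      refine forall_congr' fun i => ?_
      simp only [red, Pi.add_apply, Pi.neg_apply, map_add, map_neg, Pi.zero_apply]
      rw [neg_add_eq_zero, eq_comm]
    rw [this, measureReal_def, measureReal_def, measure_preimage_add]
  have hsum : ∀ A : Finset (Fin 4 → ZMod (p ^ k)),
      μ.real {a | red p k a ∈ A} = A.card * μ.real {a | red p k a = 0} := by
    intro A
    have : {a | red p k a ∈ A} = ⋃ r ∈ A, {a | red p k a = r} := by
      ext a; simp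
    rw [this, measureReal_biUnion_finset]
    · simp [hfib]
    · intro r _ s _ hrs
      refine Set.disjoint_left.2 fun a ha hb => hrs ?_
      exact ha.symm.trans hb
    · intro r _
      exact measurable_fiber k r
  have h1 := hsum Finset.univ
  simp only [Finset.mem_univ, Set.ofPred_true, probReal_univ, Finset.card_univ, Fintype.card_fun,
    Fintype.card_fin, ZMod.card] at h1
  rw [hsum]
  have hp0 : (p : ℝ) ≠ 0 := by exact_mod_cast hp.1.ne_zero
  field_simp
  push_cast at h1
  rw [mul_assoc, mul_comm (μ.real _), ← h1, mul_one]

lemma card_zero_on {q : ℕ} [NeZero q] (S : Finset (Fin 4)) :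
    (Finset.univ.filter (fun r : Fin 4 → ZMod q => ∀ i ∈ S, r i = 0)).card = q ^ (4 - S.card) := by
  have : (Finset.univ.filter (fun r : Fin 4 → ZMod q => ∀ i ∈ S, r i = 0)) =
      Fintype.piFinset (fun i => if i ∈ S then {0} else Finset.univ) := by
    ext r
    simp only [Finset.mem_filter, Finset.mem_univ, true_and, Fintype.mem_piFinset]
    refine forall_congr' fun i => ?_
    by_cases h : i ∈ S <;> simp [h]
  rw [this, Fintype.card_piFinset]
  have : ∀ i, ((if i ∈ S then {0} else Finset.univ : Finset (ZMod q))).card =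
      if i ∈ S then 1 else q := by
    intro i
    by_cases h : i ∈ S <;> simp [h, ZMod.card]
  simp only [this]
  rw [Finset.prod_ite]
  simp only [Finset.prod_const, one_pow, one_mul]
  congr 1
  have h2 : Finset.univ.filter (fun x => x ∉ S) = Sᶜ := by ext; simp
  rw [h2, Finset.card_compl, Fintype.card_fin]

lemma haar_dvd (k : ℕ) (S : Finset (Fin 4)) :
    μ.real {a | ∀ i ∈ S, (p : ℤ_[p]) ^ k ∣ a i} = 1 / ((p : ℝ) ^ k) ^ S.card := by
  have := haar_cyl μ k (Finset.univ.filter (fun r : Fin 4 → ZMod (p ^ k) => ∀ i ∈ S, r i = 0))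
  rw [card_zero_on] at this
  simp only [Finset.mem_filter, Finset.mem_univ, true_and, red, toZModPow_zero_iff] at this
  rw [this]
  have hp0 : (p : ℝ) ≠ 0 := by exact_mod_cast hp.1.ne_zero
  have hS : S.card ≤ 4 := by simpa using Finset.card_le_univ S
  rw [div_eq_div_iff (by positivity) (by positivity), one_mul]
  push_cast
  rw [← pow_add]
  congr 1
  omega

open Classical in
/-- Residue classes consisting of soluble vectors. -/
noncomputable def lo (p : ℕ) [Fact p.Prime] (k : ℕ) : Finset (Fin 4 → ZMod (p ^ k)) :=
  Finset.univ.filter (fun r => ∀ a, red p k a = r → Sol p a)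

open Classical in
/-- Residue classes containing a soluble vector. -/
noncomputable def hi (p : ℕ) [Fact p.Prime] (k : ℕ) : Finset (Fin 4 → ZMod (p ^ k)) :=
  Finset.univ.filter (fun r => ∃ a, red p k a = r ∧ Sol p a)

lemma lo_sub (k : ℕ) (a : Fin 4 → ℤ_[p]) (h : red p k a ∈ lo p k) : Sol p a := by
  simp only [lo, Finset.mem_filter, Finset.mem_univ, true_and] at h
  exact h a rfl

lemma sub_hi (k : ℕ) (a : Fin 4 → ℤ_[p]) (h : Sol p a) : red p k a ∈ hi p k := by
  simp only [hi, Finset.mem_filter, Finset.mem_univ, true_and]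
  exact ⟨a, rfl, h⟩

lemma hi_sub (k : ℕ) (a : Fin 4 → ℤ_[p]) (h : red p (k + 3) a ∈ hi p (k + 3)) :
    red p (k + 3) a ∈ lo p (k + 3) ∨ ∃ i, (p : ℤ_[p]) ^ k ∣ a i := by
  by_contra hcon
  push Not at hcon
  obtain ⟨h1, h2⟩ := hcon
  apply h1
  simp only [hi, lo, Finset.mem_filter, Finset.mem_univ, true_and] at h ⊢
  obtain ⟨b, hb, hsb⟩ := h
  intro c hc
  have hba : ∀ i, (p : ℤ_[p]) ^ (k + 3) ∣ b i - a i := fun i =>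
    (toZModPow_eq_iff _ _ _).1 (congrFun hb i)
  have hac : ∀ i, (p : ℤ_[p]) ^ (k + 3) ∣ a i - c i := fun i =>
    (toZModPow_eq_iff _ _ _).1 (congrFun hc i).symm
  have hsa : Sol p a := sol_congr a b k h2 hba hsb
  refine sol_congr c a k (fun i hi => h2 i ?_) hac hsa
  have : a i = (a i - c i) + c i := by ring
  rw [this]
  exact dvd_add ((pow_dvd_pow _ (by omega)).trans (hac i)) hi

lemma lo_le (k : ℕ) : ((lo p k).card : ℝ) / ((p : ℝ) ^ k) ^ 4 ≤ μ.real {a | Sol p a} := by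
  rw [← haar_cyl μ]
  exact measureReal_mono (fun a ha => lo_sub k a ha)

lemma le_hi (k : ℕ) : μ.real {a | Sol p a} ≤ ((hi p k).card : ℝ) / ((p : ℝ) ^ k) ^ 4 := by
  rw [← haar_cyl μ]
  exact measureReal_mono (fun a ha => sub_hi k a ha)

lemma hi_le (μ : Measure (Fin 4 → ℤ_[p])) [μ.IsAddLeftInvariant] [IsProbabilityMeasure μ] (k : ℕ) : ((hi p (k + 3)).card : ℝ) / ((p : ℝ) ^ (k + 3)) ^ 4 ≤
    ((lo p (k + 3)).card : ℝ) / ((p : ℝ) ^ (k + 3)) ^ 4 + 4 * (1 / (p : ℝ) ^ k) := by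
  rw [← haar_cyl μ, ← haar_cyl μ]
  calc _ ≤ μ.real ({a | red p (k + 3) a ∈ lo p (k + 3)} ∪
        ⋃ i ∈ (Finset.univ : Finset (Fin 4)), {a | ∀ j ∈ ({i} : Finset (Fin 4)), (p : ℤ_[p]) ^ k ∣ a j}) := by
        refine measureReal_mono (fun a ha => ?_) (measure_ne_top _ _)
        rcases hi_sub k a ha with h | ⟨i, h⟩
        · exact Or.inl h
        · right
          simp only [Set.mem_iUnion]
          exact ⟨i, Finset.mem_univ _, by simpa using h⟩
    _ ≤ _ := by
        refine (measureReal_union_le _ _).trans ?_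
        gcongr
        refine (measureReal_biUnion_finset_le _ _).trans ?_
        simp only [haar_dvd]
        simp

lemma tendsto_lo : Tendsto (fun k => ((lo p (k + 3)).card : ℝ) / ((p : ℝ) ^ (k + 3)) ^ 4) atTop
    (𝓝 (μ.real {a | Sol p a})) ∧
    Tendsto (fun k => ((hi p (k + 3)).card : ℝ) / ((p : ℝ) ^ (k + 3)) ^ 4) atTop
    (𝓝 (μ.real {a | Sol p a})) := by
  have hp1 : (1 : ℝ) < p := by exact_mod_cast hp.1.one_lt
  have h0 : Tendsto (fun k : ℕ => 4 * (1 / (p : ℝ) ^ k)) atTop (𝓝 0) := by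
    have := (tendsto_pow_atTop_nhds_zero_of_lt_one (r := (p : ℝ)⁻¹) (by positivity)
      (inv_lt_one_of_one_lt₀ hp1)).const_mul 4
    simpa using this
  constructor
  · refine tendsto_of_tendsto_of_tendsto_of_le_of_le (g := fun k => μ.real {a | Sol p a} - 4 * (1 / (p : ℝ) ^ k))
      (by simpa using h0.const_sub _) tendsto_const_nhds (fun k => ?_) (fun k => lo_le μ _)
    have h1 := le_hi μ (k + 3)
    have h2 := hi_le μ k
    simp only
    linarith
  · refine tendsto_of_tendsto_of_tendsto_of_le_of_le (h := fun k => μ.real {a | Sol p a} + 4 * (1 / (p : ℝ) ^ k))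
      tendsto_const_nhds (by simpa using h0.const_add _) (fun k => le_hi μ _) (fun k => ?_)
    have h1 := lo_le μ (k + 3)
    have h2 := hi_le μ k
    simp only
    linarith

lemma one_sub_le : 1 - μ.real {a | Sol p a} ≤ 16 * (1 / (p : ℝ) ^ 2) := by
  by_cases h3 : p = 3
  · have : 0 ≤ μ.real {a | Sol p a} := measureReal_nonneg
    have h4 : (p : ℝ) = 3 := by exact_mod_cast h3
    rw [h4]
    norm_num
    linarith
  have h1 : (1 : ℝ) ≤ μ.real {a | Sol p a} + μ.real {a | Sol p a}ᶜ := by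
    have := measureReal_union_le (μ := μ) {a | Sol p a} {a | Sol p a}ᶜ
    rwa [Set.union_compl_self, probReal_univ] at this
  have h2 : μ.real {a | Sol p a}ᶜ ≤ 16 * (1 / (p : ℝ) ^ 2) := by
    calc _ ≤ μ.real (⋃ s ∈ (Finset.univ : Finset (Fin 4)).offDiag,
          {a | ∀ j ∈ ({s.1, s.2} : Finset (Fin 4)), (p : ℤ_[p]) ^ 1 ∣ a j}) := by
          refine measureReal_mono (fun a ha => ?_) (measure_ne_top _ _)
          obtain ⟨i, j, hij, hi, hj⟩ := two_dvd_of_not_sol h3 a ha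
          simp only [Set.mem_iUnion]
          exact ⟨(i, j), by simpa using hij, by simp [hi, hj]⟩
      _ ≤ _ := by
          refine (measureReal_biUnion_finset_le _ _).trans ?_
          have : ∀ s ∈ (Finset.univ : Finset (Fin 4)).offDiag,
              μ.real {a | ∀ j ∈ ({s.1, s.2} : Finset (Fin 4)), (p : ℤ_[p]) ^ 1 ∣ a j} =
              1 / (p : ℝ) ^ 2 := by
            intro s hs
            rw [haar_dvd, Finset.card_pair (by simpa using hs), pow_one]
          rw [Finset.sum_congr rfl this, Finset.sum_const, nsmul_eq_mul]
          gcongr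
          rw [Finset.offDiag_card]
          norm_num
  linarith

end haar

/-- Integer vectors of sup norm at most `n`. -/
noncomputable def box (n : ℕ) : Finset (Fin 4 → ℤ) := Fintype.piFinset fun _ => Finset.Icc (-n : ℤ) n

open Classical in
/-- Number of vectors in the box satisfying `Q`. -/
noncomputable def cnt (Q : (Fin 4 → ℤ) → Prop) (n : ℕ) : ℕ := ((box n).filter Q).card

/-- Proportion of vectors in the box satisfying `Q`. -/
noncomputable def dens (Q : (Fin 4 → ℤ) → Prop) (n : ℕ) : ℝ := cnt Q n / (2 * n + 1 : ℝ) ^ 4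

lemma cnt_le_of_box {Q R : (Fin 4 → ℤ) → Prop} {n : ℕ} (h : ∀ a ∈ box n, Q a → R a) :
    cnt Q n ≤ cnt R n := by
  classical
  unfold cnt
  apply Finset.card_le_card
  intro a
  simp only [Finset.mem_filter]
  exact fun ⟨h1, h2⟩ => ⟨h1, h a h1 h2⟩

lemma cnt_mono {Q R : (Fin 4 → ℤ) → Prop} (h : ∀ a, Q a → R a) (n : ℕ) : cnt Q n ≤ cnt R n := by
  classical
  unfold cnt
  apply Finset.card_le_card
  intro a
  simp only [Finset.mem_filter]
  exact fun ⟨h1, h2⟩ => ⟨h1, h a h2⟩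

lemma dens_mono {Q R : (Fin 4 → ℤ) → Prop} (h : ∀ a, Q a → R a) (n : ℕ) : dens Q n ≤ dens R n := by
  unfold dens
  have : (cnt Q n : ℝ) ≤ cnt R n := by exact_mod_cast cnt_mono h n
  gcongr

lemma cnt_or (Q R : (Fin 4 → ℤ) → Prop) (n : ℕ) :
    cnt (fun a => Q a ∨ R a) n ≤ cnt Q n + cnt R n := by
  classical
  unfold cnt
  refine le_trans (Finset.card_le_card ?_) (Finset.card_union_le _ _)
  intro a
  simp only [Finset.mem_filter, Finset.mem_union]
  tauto

lemma dens_or (Q R : (Fin 4 → ℤ) → Prop) (n : ℕ) :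
    dens (fun a => Q a ∨ R a) n ≤ dens Q n + dens R n := by
  unfold dens
  rw [← add_div]
  gcongr
  exact_mod_cast cnt_or Q R n

lemma cnt_exists {ι : Type*} (s : Finset ι) (Q : ι → (Fin 4 → ℤ) → Prop) (n : ℕ) :
    cnt (fun a => ∃ d ∈ s, Q d a) n ≤ ∑ d ∈ s, cnt (Q d) n := by
  classical
  induction s using Finset.induction_on with
  | empty => simp [cnt]
  | insert d s hd ih =>
    rw [Finset.sum_insert hd]
    refine le_trans (cnt_mono (R := fun a => Q d a ∨ ∃ d ∈ s, Q d a) ?_ n)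
      ((cnt_or _ _ n).trans (Nat.add_le_add_left ih _))
    rintro a ⟨e, he, h⟩
    rcases Finset.mem_insert.1 he with rfl | he
    · exact Or.inl h
    · exact Or.inr ⟨e, he, h⟩

lemma card_residue (N : ℕ) [NeZero N] (r : ZMod N) (n : ℕ) :
    |(((Finset.Icc (-n : ℤ) n).filter (fun x : ℤ => (x : ZMod N) = r)).card : ℝ) - (2 * n + 1) / N| ≤ 1 := by
  have hN : (0 : ℤ) < N := by exact_mod_cast Nat.pos_of_ne_zero (NeZero.ne N)
  have h1 : (Finset.Icc (-n : ℤ) n).filter (fun x : ℤ => (x : ZMod N) = r) =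
      (Finset.Ico (-n : ℤ) (n + 1)).filter (fun x => x ≡ (r.val : ℤ) [ZMOD N]) := by
    ext x
    simp only [Finset.mem_filter, Finset.mem_Icc, Finset.mem_Ico]
    rw [← ZMod.intCast_eq_intCast_iff]
    simp
  rw [h1]
  have h2 := Int.Ico_filter_modEq_card (-n : ℤ) (n + 1) hN (r.val : ℤ)
  set c := ((Finset.Ico (-n : ℤ) (n + 1)).filter (fun x => x ≡ (r.val : ℤ) [ZMOD N])).card
  have hq : (0 : ℚ) < N := by exact_mod_cast hN
  set A : ℚ := (((n + 1 : ℤ) : ℚ) - ((r.val : ℤ) : ℚ)) / ((N : ℤ) : ℚ)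
  set B : ℚ := (((-n : ℤ) : ℚ) - ((r.val : ℤ) : ℚ)) / ((N : ℤ) : ℚ)
  have hAB : A - B = (2 * n + 1) / N := by
    simp only [A, B]
    push_cast
    rw [← sub_div]
    congr 1
    ring
  have hle : B ≤ A := by
    have : (0 : ℚ) ≤ (2 * n + 1) / N := by positivity
    linarith
  have h3 : (c : ℤ) = ⌈A⌉ - ⌈B⌉ := by
    rw [h2, max_eq_left]
    have := Int.ceil_mono hle
    omega
  have h4 : (c : ℚ) = ⌈A⌉ - ⌈B⌉ := by exact_mod_cast h3
  have a1 := Int.le_ceil A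
  have a2 := Int.ceil_lt_add_one A
  have b1 := Int.le_ceil B
  have b2 := Int.ceil_lt_add_one B
  have : |(c : ℚ) - (2 * n + 1) / N| ≤ 1 := by
    rw [abs_le]
    constructor <;> linarith
  have h5 : ((|(c : ℚ) - (2 * n + 1) / N| : ℚ) : ℝ) ≤ ((1 : ℚ) : ℝ) := Rat.cast_le.2 this
  push_cast at h5
  exact h5

lemma tendsto_inv_box : Tendsto (fun n : ℕ => 1 / (2 * n + 1 : ℝ)) atTop (𝓝 0) := by
  refine squeeze_zero (fun n => by positivity) (fun n => ?_) (tendsto_one_div_add_atTop_nhds_zero_nat (𝕜 := ℝ))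
  gcongr
  have : (0 : ℝ) ≤ n := by positivity
  linarith

lemma tendsto_residue (N : ℕ) [NeZero N] (r : ZMod N) :
    Tendsto (fun n : ℕ => (((Finset.Icc (-n : ℤ) n).filter (fun x : ℤ => (x : ZMod N) = r)).card : ℝ)
      / (2 * n + 1)) atTop (𝓝 (1 / N)) := by
  rw [tendsto_iff_norm_sub_tendsto_zero]
  refine squeeze_zero (fun n => norm_nonneg _) (fun n => ?_) tendsto_inv_box
  have h := card_residue N r n
  have hN : (N : ℝ) ≠ 0 := by exact_mod_cast NeZero.ne N
  have hn : (0 : ℝ) < 2 * n + 1 := by positivity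
  rw [Real.norm_eq_abs, le_div_iff₀ hn]
  calc _ = |((((Finset.Icc (-n : ℤ) n).filter (fun x : ℤ => (x : ZMod N) = r)).card : ℝ) / (2 * n + 1)
          - 1 / N) * (2 * n + 1)| := by rw [abs_mul, abs_of_pos hn]
    _ = _ := by
      congr 1
      field_simp
    _ ≤ 1 := h

lemma dens_residue (N : ℕ) [NeZero N] (r : Fin 4 → ZMod N) :
    Tendsto (dens (fun a => (fun i => (a i : ZMod N)) = r)) atTop (𝓝 (1 / (N : ℝ) ^ 4)) := by
  classical
  have : dens (fun a => (fun i => (a i : ZMod N)) = r) = fun n : ℕ => ∏ i,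
      ((((Finset.Icc (-n : ℤ) n).filter (fun x : ℤ => (x : ZMod N) = r i)).card : ℝ) / (2 * n + 1)) := by
    funext n
    rw [Finset.prod_div_distrib, Finset.prod_const, Finset.card_univ, Fintype.card_fin]
    unfold dens cnt
    congr 1
    rw [← Nat.cast_prod, ← Fintype.card_piFinset]
    congr 2
    ext a
    simp only [box, Finset.mem_filter, Fintype.mem_piFinset, funext_iff]
    exact forall_and.symm
  rw [this]
  have h := tendsto_finsetProd (Finset.univ : Finset (Fin 4)) (fun i _ => tendsto_residue N (r i))
  simpa using h

lemma dens_periodic (N : ℕ) [NeZero N] (A : Finset (Fin 4 → ZMod N)) :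
    Tendsto (dens (fun a => (fun i => (a i : ZMod N)) ∈ A)) atTop (𝓝 (A.card / (N : ℝ) ^ 4)) := by
  classical
  have : dens (fun a => (fun i => (a i : ZMod N)) ∈ A) = fun n => ∑ r ∈ A,
      dens (fun a => (fun i => (a i : ZMod N)) = r) n := by
    funext n
    unfold dens cnt
    rw [← Finset.sum_div]
    congr 1
    rw [← Nat.cast_sum, Finset.card_eq_sum_card_fiberwise (t := A)
      (f := fun (a : Fin 4 → ℤ) => (fun i => (a i : ZMod N)))]
    · congr 1
      refine Finset.sum_congr rfl fun r hr => ?_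
      congr 1
      ext a
      simp only [Finset.mem_filter]
      constructor
      · exact fun h => ⟨h.1.1, h.2⟩
      · exact fun h => ⟨⟨h.1, h.2 ▸ hr⟩, h.2⟩
    · intro a ha
      simp only [Finset.coe_filter, Set.mem_ofPred_eq] at ha
      exact ha.2
  rw [this]
  have h := tendsto_finsetSum A (fun r _ => dens_residue N r)
  simpa [div_eq_mul_inv] using h

open scoped Function in
lemma dens_crt {ι : Type*} [Fintype ι] (m : ι → ℕ) [∀ i, NeZero (m i)]
    (hco : Pairwise (Nat.Coprime on m)) (A : ∀ i, Finset (Fin 4 → ZMod (m i))) :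
    Tendsto (dens (fun a => ∀ i, (fun j => (a j : ZMod (m i))) ∈ A i)) atTop
      (𝓝 (∏ i, ((A i).card / (m i : ℝ) ^ 4))) := by
  classical
  have : NeZero (∏ i, m i) := ⟨Finset.prod_ne_zero_iff.2 fun i _ => NeZero.ne _⟩
  let e : (Fin 4 → ZMod (∏ i, m i)) ≃ (∀ i, Fin 4 → ZMod (m i)) :=
    (Equiv.arrowCongr (Equiv.refl (Fin 4)) (ZMod.prodEquivPi m hco).toEquiv).trans
      (Equiv.piComm _)
  have he : ∀ (a : Fin 4 → ℤ) i, e (fun j => (a j : ZMod (∏ i, m i))) i =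
      fun j => (a j : ZMod (m i)) := by
    intro a i
    funext j
    change ZMod.prodEquivPi m hco (a j : ZMod (∏ i, m i)) i = _
    simp
  let B : Finset (Fin 4 → ZMod (∏ i, m i)) := (Fintype.piFinset A).map e.symm.toEmbedding
  have hB : ∀ a : Fin 4 → ℤ, (∀ i, (fun j => (a j : ZMod (m i))) ∈ A i) ↔
      (fun j => (a j : ZMod (∏ i, m i))) ∈ B := by
    intro a
    simp only [B, Finset.mem_map_equiv, Equiv.symm_symm, Fintype.mem_piFinset, he]
  have := dens_periodic (∏ i, m i) B
  simp only [hB]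
  convert this using 2
  rw [Finset.prod_div_distrib]
  congr 1
  · simp [B]
  · push_cast
    rw [Finset.prod_pow]

lemma card_multiples (n d : ℕ) :
    ((Finset.Icc (-n : ℤ) n).filter (fun x => x ≠ 0 ∧ (d : ℤ) ∣ x)).card ≤ 2 * (n / d) := by
  classical
  have hsub : (Finset.Icc (-n : ℤ) n).filter (fun x => x ≠ 0 ∧ (d : ℤ) ∣ x) ⊆
      ((Finset.Icc (-(n / d : ℕ) : ℤ) (n / d : ℕ)).erase 0).image (fun t => (d : ℤ) * t) := by
    intro x hx
    simp only [Finset.mem_filter, Finset.mem_Icc] at hx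
    obtain ⟨⟨h1, h2⟩, h0, t, rfl⟩ := hx
    have hd : 0 < d := by
      rcases Nat.eq_zero_or_pos d with h | h
      · subst h; simp at h0
      · exact h
    simp only [Finset.mem_image, Finset.mem_erase, Finset.mem_Icc]
    refine ⟨t, ⟨by rintro rfl; simp at h0, ?_, ?_⟩, rfl⟩
    · have : -t ≤ (n : ℤ) / d := by
        rw [Int.le_ediv_iff_mul_le (by exact_mod_cast hd)]
        linarith
      push_cast
      linarith
    · push_cast
      rw [Int.le_ediv_iff_mul_le (by exact_mod_cast hd)]
      linarith
  refine (Finset.card_le_card hsub).trans (Finset.card_image_le.trans ?_)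
  rw [Finset.card_erase_of_mem (by
    rw [Finset.mem_Icc]
    have : (0 : ℤ) ≤ ((n / d : ℕ) : ℤ) := Int.natCast_nonneg _
    constructor <;> linarith)]
  simp
  omega

lemma card_pair (n d : ℕ) (i j : Fin 4) (hij : i ≠ j) :
    (cnt (fun a => (∀ l, a l ≠ 0) ∧ (d : ℤ) ∣ a i ∧ (d : ℤ) ∣ a j) n : ℝ) ≤
      (2 * n + 1) ^ 4 * ((d : ℝ) ^ 2)⁻¹ := by
  classical
  have h1 : cnt (fun a => (∀ l, a l ≠ 0) ∧ (d : ℤ) ∣ a i ∧ (d : ℤ) ∣ a j) n ≤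
      (Fintype.piFinset (fun l : Fin 4 => if l ∈ ({i, j} : Finset (Fin 4)) then
        (Finset.Icc (-n : ℤ) n).filter (fun x => x ≠ 0 ∧ (d : ℤ) ∣ x)
        else Finset.Icc (-n : ℤ) n)).card := by
    unfold cnt
    apply Finset.card_le_card
    intro a
    simp only [box, Finset.mem_filter, Fintype.mem_piFinset]
    rintro ⟨hb, h0, hi, hj⟩ l
    by_cases hl : l ∈ ({i, j} : Finset (Fin 4))
    · rw [if_pos hl, Finset.mem_filter]
      refine ⟨hb l, h0 l, ?_⟩
      simp only [Finset.mem_insert, Finset.mem_singleton] at hl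
      rcases hl with rfl | rfl <;> assumption
    · rw [if_neg hl]
      exact hb l
  rw [Fintype.card_piFinset] at h1
  simp only [apply_ite Finset.card] at h1
  rw [Finset.prod_ite] at h1
  simp only [Finset.prod_const] at h1
  have h2 : (Finset.univ.filter (fun x => x ∈ ({i, j} : Finset (Fin 4)))).card = 2 := by
    rw [Finset.filter_mem_eq_inter, Finset.univ_inter, Finset.card_pair hij]
  have h3 : (Finset.univ.filter (fun x => x ∉ ({i, j} : Finset (Fin 4)))).card = 2 := by
    have : Finset.univ.filter (fun x => x ∉ ({i, j} : Finset (Fin 4))) = ({i, j} : Finset (Fin 4))ᶜ := by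
      ext; simp
    rw [this, Finset.card_compl, Finset.card_pair hij]
    rfl
  rw [h2, h3] at h1
  have h4 : (Finset.Icc (-n : ℤ) n).card = 2 * n + 1 := by simp; omega
  rw [h4] at h1
  have h5 := card_multiples n d
  have h6 : (((Finset.Icc (-n : ℤ) n).filter (fun x => x ≠ 0 ∧ (d : ℤ) ∣ x)).card : ℝ) ≤
      (2 * n + 1) * (d : ℝ)⁻¹ := by
    calc _ ≤ ((2 * (n / d) : ℕ) : ℝ) := by exact_mod_cast h5
      _ = 2 * ((n / d : ℕ) : ℝ) := by push_cast; ring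
      _ ≤ 2 * ((n : ℝ) / d) := by gcongr; exact Nat.cast_div_le
      _ ≤ _ := by
        rw [← mul_div_assoc, div_eq_mul_inv]
        gcongr
        linarith
  calc _ ≤ (((Finset.Icc (-n : ℤ) n).filter (fun x => x ≠ 0 ∧ (d : ℤ) ∣ x)).card : ℝ) ^ 2 *
        (2 * n + 1) ^ 2 := by exact_mod_cast h1
    _ ≤ ((2 * n + 1) * (d : ℝ)⁻¹) ^ 2 * (2 * n + 1) ^ 2 := by gcongr
    _ = _ := by rw [mul_pow, inv_pow]; ring

/-- Tail estimate for the sieve. -/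
lemma dens_tail (M : ℕ) (hM : M ≠ 0) (n : ℕ) :
    dens (fun a => (∀ l, a l ≠ 0) ∧ ∃ d : ℕ, M < d ∧ ∃ i j, i ≠ j ∧ (d : ℤ) ∣ a i ∧ (d : ℤ) ∣ a j) n
      ≤ 16 * (M : ℝ)⁻¹ := by
  classical
  have hn : (0 : ℝ) < (2 * n + 1) ^ 4 := by positivity
  unfold dens
  rw [div_le_iff₀ hn]
  have h1 : cnt (fun a => (∀ l, a l ≠ 0) ∧ ∃ d : ℕ, M < d ∧ ∃ i j, i ≠ j ∧ (d : ℤ) ∣ a i ∧ (d : ℤ) ∣ a j) n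
      ≤ ∑ d ∈ Finset.Ioc M n, ∑ s ∈ (Finset.univ : Finset (Fin 4)).offDiag,
        cnt (fun a => (∀ l, a l ≠ 0) ∧ (d : ℤ) ∣ a s.1 ∧ (d : ℤ) ∣ a s.2) n := by
    refine (cnt_le_of_box (R := fun a => ∃ d ∈ Finset.Ioc M n,
      ∃ s ∈ (Finset.univ : Finset (Fin 4)).offDiag,
        (∀ l, a l ≠ 0) ∧ (d : ℤ) ∣ a s.1 ∧ (d : ℤ) ∣ a s.2) ?_).trans
      ((cnt_exists _ _ n).trans (Finset.sum_le_sum fun d _ => cnt_exists _ _ n))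
    rintro a hb ⟨h0, d, hd, i, j, hij, hi, hj⟩
    refine ⟨d, ?_, (i, j), by simpa using hij, h0, hi, hj⟩
    rw [Finset.mem_Ioc]
    refine ⟨hd, ?_⟩
    simp only [box, Fintype.mem_piFinset, Finset.mem_Icc] at hb
    have h2 := Int.le_of_dvd (abs_pos.2 (h0 i)) ((dvd_abs _ _).2 hi)
    have h3 := abs_le.2 (hb i)
    omega
  calc _ ≤ ((∑ d ∈ Finset.Ioc M n, ∑ s ∈ (Finset.univ : Finset (Fin 4)).offDiag,
        cnt (fun a => (∀ l, a l ≠ 0) ∧ (d : ℤ) ∣ a s.1 ∧ (d : ℤ) ∣ a s.2) n : ℕ) : ℝ) := by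
        exact_mod_cast h1
    _ ≤ ∑ d ∈ Finset.Ioc M n, ∑ s ∈ (Finset.univ : Finset (Fin 4)).offDiag,
          ((2 * n + 1) ^ 4 * ((d : ℝ) ^ 2)⁻¹) := by
        push_cast
        refine Finset.sum_le_sum fun d _ => Finset.sum_le_sum fun s hs => ?_
        exact card_pair n d s.1 s.2 (by simpa using hs)
    _ = 12 * (2 * n + 1) ^ 4 * ∑ d ∈ Finset.Ioc M n, ((d : ℝ) ^ 2)⁻¹ := by
        rw [Finset.mul_sum]
        refine Finset.sum_congr rfl fun d _ => ?_
        rw [Finset.sum_const, Finset.offDiag_card]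
        simp
        ring
    _ ≤ 12 * (2 * n + 1) ^ 4 * (M : ℝ)⁻¹ := by
        gcongr
        by_cases h : M ≤ n
        · refine (sum_Ioc_inv_sq_le_sub hM h).trans ?_
          have : (0 : ℝ) ≤ (n : ℝ)⁻¹ := by positivity
          linarith
        · rw [Finset.Ioc_eq_empty (by omega)]
          simp
    _ ≤ _ := by
        have : (0 : ℝ) ≤ (2 * n + 1) ^ 4 * (M : ℝ)⁻¹ := by positivity
        linarith

/-- `p`-adic solubility for integral coefficients. -/
def SolZ (p : ℕ) [Fact p.Prime] (a : Fin 4 → ℤ) : Prop := Sol p (fun i => (a i : ℤ_[p]))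

lemma red_int (p : ℕ) [Fact p.Prime] (k : ℕ) (a : Fin 4 → ℤ) :
    red p k (fun i => (a i : ℤ_[p])) = fun i => (a i : ZMod (p ^ k)) := by
  funext i
  simp [red]

lemma SolZ_bad (p : ℕ) [Fact p.Prime] (h3 : p ≠ 3) (a : Fin 4 → ℤ) (h : ¬ SolZ p a) :
    (∀ l, a l ≠ 0) ∧ ∃ i j, i ≠ j ∧ (p : ℤ) ∣ a i ∧ (p : ℤ) ∣ a j := by
  constructor
  · intro l hl
    exact h (sol_of_zero _ l (by simp [hl]))
  · obtain ⟨i, j, hij, hi, hj⟩ := two_dvd_of_not_sol h3 _ h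
    refine ⟨i, j, hij, ?_, ?_⟩
    · rwa [← PadicInt.norm_lt_one_iff_dvd, PadicInt.norm_int_lt_one_iff_dvd] at hi
    · rwa [← PadicInt.norm_lt_one_iff_dvd, PadicInt.norm_int_lt_one_iff_dvd] at hj

section main
variable (μp : ∀ p : Nat.Primes, Measure (Fin 4 → ℤ_[(p : ℕ)]))
    [∀ p, (μp p).IsAddLeftInvariant] [∀ p, IsProbabilityMeasure (μp p)]

lemma dens_finite (T : Finset Nat.Primes) :
    Tendsto (dens (fun a => ∀ p ∈ T, SolZ (p : ℕ) a)) atTop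
      (𝓝 (∏ p ∈ T, (μp p).real {a | Sol (p : ℕ) a})) := by
  classical
  rw [← Finset.prod_coe_sort]
  have hco : ∀ k : ℕ, Pairwise (Function.onFun Nat.Coprime (fun i : T => ((i : Nat.Primes) : ℕ) ^ (k + 3))) := by
    intro k i j hij
    refine Nat.Coprime.pow _ _ ((Nat.coprime_primes i.1.2 j.1.2).2 fun h => hij ?_)
    exact Subtype.ext (Subtype.ext h)
  have hlo := fun k => dens_crt (fun i : T => ((i : Nat.Primes) : ℕ) ^ (k + 3)) (hco k)
    (fun i => lo ((i : Nat.Primes) : ℕ) (k + 3))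
  have hhi := fun k => dens_crt (fun i : T => ((i : Nat.Primes) : ℕ) ^ (k + 3)) (hco k)
    (fun i => hi ((i : Nat.Primes) : ℕ) (k + 3))
  have tlo := tendsto_finsetProd (Finset.univ : Finset T) (fun i _ => (tendsto_lo (μp i.1)).1)
  have thi := tendsto_finsetProd (Finset.univ : Finset T) (fun i _ => (tendsto_lo (μp i.1)).2)
  rw [tendsto_order]
  constructor
  · intro c hc
    obtain ⟨k, hk⟩ := ((tendsto_order.1 tlo).1 c hc).exists
    have h1 := hlo k
    push_cast at h1
    filter_upwards [(tendsto_order.1 h1).1 c hk] with n hn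
    refine hn.trans_le (dens_mono (fun a ha p hp => ?_) n)
    have := ha ⟨p, hp⟩
    rw [← red_int] at this
    exact lo_sub _ _ this
  · intro c hc
    obtain ⟨k, hk⟩ := ((tendsto_order.1 thi).2 c hc).exists
    have h1 := hhi k
    push_cast at h1
    filter_upwards [(tendsto_order.1 h1).2 c hk] with n hn
    refine (dens_mono (fun a ha i => ?_) n).trans_lt hn
    have := ha i.1 i.2
    rw [← red_int]
    exact sub_hi _ _ this

lemma summable_primes : Summable (fun p : Nat.Primes => 16 * (1 / ((p : ℕ) : ℝ) ^ 2)) := by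
  apply Summable.mul_left
  exact (Real.summable_one_div_nat_pow.2 (by norm_num : 1 < 2)).comp_injective
    (i := fun p : Nat.Primes => (p : ℕ)) Subtype.val_injective

lemma multipliable_of_bound (f : Nat.Primes → ℝ) (h1 : ∀ p, f p ≤ 1)
    (h2 : ∀ p : Nat.Primes, 1 - f p ≤ 16 * (1 / ((p : ℕ) : ℝ) ^ 2)) : Multipliable f := by
  have : Multipliable (fun p => 1 + (f p - 1)) := by
    apply multipliable_one_add_of_summable
    refine Summable.of_nonneg_of_le (fun p => norm_nonneg _) (fun p => ?_) summable_primes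
    rw [Real.norm_eq_abs, abs_sub_comm, abs_of_nonneg (by linarith [h1 p])]
    exact h2 p
  simpa using this

lemma multipliable_sigma : Multipliable (fun p => (μp p).real {a | Sol (p : ℕ) a}) :=
  multipliable_of_bound _ (fun _ => measureReal_le_one) (fun p => one_sub_le (μp p))

lemma dens_all : Tendsto (dens (fun a => ∀ p : Nat.Primes, SolZ (p : ℕ) a)) atTop
      (𝓝 (∏' p, (μp p).real {a | Sol (p : ℕ) a})) := by
  classical
  set σ := fun p => (μp p).real {a | Sol (p : ℕ) a}
  have hfin : ∀ M : ℕ, {p : Nat.Primes | (p : ℕ) ≤ M}.Finite := fun M =>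
    (Set.finite_le_nat M).preimage (Subtype.val_injective.injOn)
  let T : ℕ → Finset Nat.Primes := fun M => (hfin M).toFinset
  have hT : ∀ M p, p ∈ T M ↔ (p : ℕ) ≤ M := by intro M p; simp [T]
  have hTt : Tendsto T atTop atTop := by
    refine tendsto_atTop_finset_of_monotone ?_ ?_
    · intro M N h p hp
      rw [hT] at hp ⊢
      exact hp.trans h
    · intro p
      exact ⟨p, by rw [hT]⟩
  have hprod : Tendsto (fun M => ∏ p ∈ T M, σ p) atTop (𝓝 (∏' p, σ p)) :=
    (multipliable_sigma μp).hasProd.comp hTt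
  have hup : ∀ M n, dens (fun a => ∀ p : Nat.Primes, SolZ (p : ℕ) a) n ≤
      dens (fun a => ∀ p ∈ T M, SolZ (p : ℕ) a) n := fun M n =>
    dens_mono (fun a ha p _ => ha p) n
  have hlow : ∀ M n, 3 ≤ M → dens (fun a => ∀ p ∈ T M, SolZ (p : ℕ) a) n ≤
      dens (fun a => ∀ p : Nat.Primes, SolZ (p : ℕ) a) n + 16 * (M : ℝ)⁻¹ := by
    intro M n hM
    refine le_trans (dens_mono (fun a ha => ?_) n) ((dens_or _ _ n).trans
      (add_le_add_right (dens_tail M (by omega) n) _))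
    by_cases h : ∀ p : Nat.Primes, SolZ (p : ℕ) a
    · exact Or.inl h
    · right
      push Not at h
      obtain ⟨p, hp⟩ := h
      have hpM : M < p := by
        by_contra hle
        exact hp (ha p ((hT M p).2 (not_lt.1 hle)))
      obtain ⟨h0, h1⟩ := SolZ_bad (p : ℕ) (by omega) a hp
      exact ⟨h0, p, hpM, h1⟩
  have hM0 : Tendsto (fun M : ℕ => 16 * (M : ℝ)⁻¹) atTop (𝓝 0) := by
    simpa using (tendsto_inv_atTop_nhds_zero_nat (𝕜 := ℝ)).const_mul 16
  rw [tendsto_order]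
  constructor
  · intro c hc
    have h1 : Tendsto (fun M => ∏ p ∈ T M, σ p - 16 * (M : ℝ)⁻¹) atTop (𝓝 (∏' p, σ p)) := by
      simpa using hprod.sub hM0
    obtain ⟨M, hM, hM3⟩ := (((tendsto_order.1 h1).1 c hc).and (eventually_ge_atTop 3)).exists
    filter_upwards [(tendsto_order.1 (dens_finite μp (T M))).1 (c + 16 * (M : ℝ)⁻¹)
      (by simp only [σ] at hM; linarith)] with n hn
    have := hlow M n hM3
    linarith
  · intro c hc
    obtain ⟨M, hM⟩ := ((tendsto_order.1 hprod).2 c hc).exists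
    filter_upwards [(tendsto_order.1 (dens_finite μp (T M))).2 c hM] with n hn
    exact (hup M n).trans_lt hn

end main

lemma mem_box {n : ℕ} {a : Fin 4 → ℤ} : a ∈ box n ↔ ∀ i, |a i| ≤ n := by
  simp only [box, Fintype.mem_piFinset, Finset.mem_Icc, abs_le]

lemma box_card (n : ℕ) : (box n).card = (2 * n + 1) ^ 4 := by
  simp only [box, Fintype.card_piFinset, Int.card_Icc, Finset.prod_const, Finset.card_univ,
    Fintype.card_fin]
  congr 1
  omega

lemma moebius_sum (m : ℕ) : ∑ d ∈ m.divisors, ArithmeticFunction.moebius d = if m = 1 then 1 else 0 := by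
  rw [← ArithmeticFunction.coe_mul_zeta_apply, ArithmeticFunction.moebius_mul_coe_zeta,
    ArithmeticFunction.one_apply]

lemma gcd_eq_one_iff (a : Fin 4 → ℤ) :
    Finset.univ.gcd a = 1 ↔ (Finset.univ.gcd a).natAbs = 1 := by
  constructor
  · intro h; rw [h]; rfl
  · intro h
    have h1 : normalize (Finset.univ.gcd a) = Finset.univ.gcd a := Finset.normalize_gcd
    rw [← h1, ← Int.abs_eq_normalize, Int.abs_eq_natAbs, h]; rfl

lemma dvd_gcd_iff' (a : Fin 4 → ℤ) (d : ℕ) :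
    d ∣ (Finset.univ.gcd a).natAbs ↔ ∀ i, (d : ℤ) ∣ a i := by
  rw [← Int.natCast_dvd, Finset.dvd_gcd_iff]
  simp

lemma cnt_dvd (Q : (Fin 4 → ℤ) → Prop)
    (hQ : ∀ (d : ℕ) (a : Fin 4 → ℤ), d ≠ 0 → (Q (fun i => (d : ℤ) * a i) ↔ Q a)) (n d : ℕ)
    (hd : d ≠ 0) :
    cnt (fun a => (Q a ∧ a ≠ 0) ∧ ∀ i, (d : ℤ) ∣ a i) n = cnt (fun a => Q a ∧ a ≠ 0) (n / d) := by
  classical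
  have hdz : (d : ℤ) ≠ 0 := by exact_mod_cast hd
  have hdp : (0 : ℤ) < d := by positivity
  unfold cnt
  symm
  apply Finset.card_bij (fun a _ => fun i => (d : ℤ) * a i)
  · intro a ha
    simp only [Finset.mem_filter, mem_box] at ha ⊢
    obtain ⟨h1, h2, h3⟩ := ha
    refine ⟨?_, ⟨(hQ d a hd).2 h2, ?_⟩, fun i => dvd_mul_right _ _⟩
    · intro i
      rw [abs_mul, abs_of_pos hdp]
      calc (d : ℤ) * |a i| ≤ d * ((n / d : ℕ) : ℤ) := by gcongr; exact h1 i
        _ ≤ n := by exact_mod_cast Nat.mul_div_le n d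
    · intro h
      apply h3
      funext i
      have := congrFun h i
      simpa [hd] using this
  · intro a _ b _ h
    funext i
    have := congrFun h i
    exact mul_left_cancel₀ hdz this
  · intro b hb
    simp only [Finset.mem_filter, mem_box] at hb
    obtain ⟨h1, ⟨h2, h3⟩, h4⟩ := hb
    choose c hc using h4
    have hb : b = fun i => (d : ℤ) * c i := funext hc
    refine ⟨c, ?_, hb.symm⟩
    simp only [Finset.mem_filter, mem_box]
    refine ⟨?_, (hQ d c hd).1 (hb ▸ h2), ?_⟩
    · intro i
      have := h1 i
      rw [hc i, abs_mul, abs_of_pos hdp] at this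
      push_cast
      rw [Int.le_ediv_iff_mul_le hdp]
      linarith
    · rintro rfl
      apply h3
      rw [hb]
      funext i
      simp

lemma gcd_bound (a : Fin 4 → ℤ) (n : ℕ) (ha : a ∈ box n) (h0 : a ≠ 0) :
    (Finset.univ.gcd a).natAbs ≠ 0 ∧ (Finset.univ.gcd a).natAbs ≤ n := by
  obtain ⟨i, hi⟩ := Function.ne_iff.1 h0
  have hi' : a i ≠ 0 := hi
  have h1 : (Finset.univ.gcd a).natAbs ∣ (a i).natAbs :=
    Int.natAbs_dvd_natAbs.2 (Finset.gcd_dvd (Finset.mem_univ i))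
  have h2 : 0 < (a i).natAbs := Int.natAbs_pos.2 hi'
  have h3 := mem_box.1 ha i
  have h4 : (a i).natAbs ≤ n := by
    rw [Int.abs_eq_natAbs] at h3
    exact_mod_cast h3
  refine ⟨fun h => ?_, (Nat.le_of_dvd h2 h1).trans h4⟩
  rw [h] at h1
  have := Nat.eq_zero_of_zero_dvd h1
  omega

lemma cnt_prim (Q : (Fin 4 → ℤ) → Prop)
    (hQ : ∀ (d : ℕ) (a : Fin 4 → ℤ), d ≠ 0 → (Q (fun i => (d : ℤ) * a i) ↔ Q a)) (n : ℕ) :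
    (cnt (fun a => Finset.univ.gcd a = 1 ∧ Q a) n : ℤ) =
      ∑ d ∈ Finset.Icc 1 n, ArithmeticFunction.moebius d * cnt (fun a => Q a ∧ a ≠ 0) (n / d) := by
  classical
  have e1 : (cnt (fun a => Finset.univ.gcd a = 1 ∧ Q a) n : ℤ) =
      ∑ a ∈ (box n).filter (fun a => Q a ∧ a ≠ 0),
        if (Finset.univ.gcd a).natAbs = 1 then (1 : ℤ) else 0 := by
    rw [Finset.sum_boole, Finset.filter_filter]
    unfold cnt
    congr 2
    ext a
    simp only [Finset.mem_filter]
    refine and_congr_right fun _ => ?_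
    rw [← gcd_eq_one_iff]
    constructor
    · rintro ⟨h1, h2⟩
      refine ⟨⟨h2, ?_⟩, h1⟩
      rintro rfl
      have : Finset.univ.gcd (0 : Fin 4 → ℤ) = 0 := Finset.gcd_eq_zero_iff.2 (by simp)
      rw [this] at h1
      exact absurd h1 (by norm_num)
    · rintro ⟨⟨h2, _⟩, h1⟩
      exact ⟨h1, h2⟩
  rw [e1]
  have e2 : ∀ a ∈ (box n).filter (fun a => Q a ∧ a ≠ 0),
      (if (Finset.univ.gcd a).natAbs = 1 then (1 : ℤ) else 0) =
        ∑ d ∈ Finset.Icc 1 n, if (∀ i, (d : ℤ) ∣ a i) then ArithmeticFunction.moebius d else 0 := by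
    intro a ha
    simp only [Finset.mem_filter] at ha
    obtain ⟨h1, h2⟩ := gcd_bound a n ha.1 ha.2.2
    rw [← moebius_sum, ← Finset.sum_filter]
    apply Finset.sum_congr _ (fun _ _ => rfl)
    ext d
    simp only [Nat.mem_divisors, Finset.mem_filter, Finset.mem_Icc, ← dvd_gcd_iff']
    constructor
    · rintro ⟨h3, _⟩
      exact ⟨⟨Nat.pos_of_dvd_of_pos h3 (Nat.pos_of_ne_zero h1),
        (Nat.le_of_dvd (Nat.pos_of_ne_zero h1) h3).trans h2⟩, h3⟩
    · rintro ⟨_, h3⟩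
      exact ⟨h3, h1⟩
  rw [Finset.sum_congr rfl e2, Finset.sum_comm]
  apply Finset.sum_congr rfl
  intro d hd
  rw [Finset.mem_Icc] at hd
  rw [← cnt_dvd Q hQ n d (by omega), ← Finset.sum_filter, Finset.sum_const, Finset.filter_filter]
  unfold cnt
  rw [nsmul_eq_mul, mul_comm]
  congr!

lemma cnt_zero (Q : (Fin 4 → ℤ) → Prop) : cnt (fun a => Q a ∧ a ≠ 0) 0 = 0 := by
  classical
  unfold cnt
  rw [Finset.card_eq_zero, Finset.eq_empty_iff_forall_notMem]
  intro a ha'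
  simp only [Finset.mem_filter] at ha'
  obtain ⟨ha, _, h⟩ := ha'
  apply h
  funext i
  have := mem_box.1 ha i
  simpa using this

lemma cnt_le_box (Q : (Fin 4 → ℤ) → Prop) (n : ℕ) : cnt Q n ≤ (2 * n + 1) ^ 4 := by
  classical
  rw [← box_card]
  exact Finset.card_filter_le _ _

lemma cnt_le_pow (Q : (Fin 4 → ℤ) → Prop) (m : ℕ) : cnt (fun a => Q a ∧ a ≠ 0) m ≤ 81 * m ^ 4 := by
  rcases Nat.eq_zero_or_pos m with rfl | hm
  · rw [cnt_zero]; omega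
  · refine (cnt_le_box _ m).trans ?_
    calc (2 * m + 1) ^ 4 ≤ (3 * m) ^ 4 := by gcongr; omega
      _ = 81 * m ^ 4 := by ring

lemma dens_ne_zero (Q : (Fin 4 → ℤ) → Prop) (L : ℝ) (h : Tendsto (dens Q) atTop (𝓝 L)) :
    Tendsto (dens (fun a => Q a ∧ a ≠ 0)) atTop (𝓝 L) := by
  have h0 : Tendsto (fun n : ℕ => (1 / (2 * n + 1 : ℝ)) ^ 4) atTop (𝓝 0) := by
    simpa using tendsto_inv_box.pow 4
  have h1 : Tendsto (fun n : ℕ => dens Q n - (1 / (2 * n + 1 : ℝ)) ^ 4) atTop (𝓝 L) := by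
    simpa using h.sub h0
  refine tendsto_of_tendsto_of_tendsto_of_le_of_le h1 h (fun n => ?_)
    (fun n => dens_mono (fun a ha => ha.1) n)
  have hc : cnt Q n ≤ cnt (fun a => Q a ∧ a ≠ 0) n + 1 := by
    refine (cnt_mono (R := fun a => (Q a ∧ a ≠ 0) ∨ a = 0) ?_ n).trans
      ((cnt_or _ _ n).trans (Nat.add_le_add_left ?_ _))
    · intro a ha
      by_cases h : a = 0
      · exact Or.inr h
      · exact Or.inl ⟨ha, h⟩
    · classical
      unfold cnt
      rw [Finset.card_le_one]
      intro a ha b hb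
      simp only [Finset.mem_filter] at ha hb
      rw [ha.2, hb.2]
  have hc' : (cnt Q n : ℝ) ≤ cnt (fun a => Q a ∧ a ≠ 0) n + 1 := by exact_mod_cast hc
  simp only [dens]
  rw [div_pow, one_pow, ← sub_div]
  gcongr
  linarith

lemma tendsto_ratio (d : ℕ) (hd : d ≠ 0) :
    Tendsto (fun n : ℕ => (2 * ((n / d : ℕ) : ℝ) + 1) / n) atTop (𝓝 (2 / d)) := by
  have hd' : (0 : ℝ) < d := by positivity
  have hi : Tendsto (fun n : ℕ => 1 / (n : ℝ)) atTop (𝓝 0) := tendsto_one_div_atTop_nhds_zero_nat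
  have h1 : Tendsto (fun n : ℕ => 2 / (d : ℝ) - 1 / (n : ℝ)) atTop (𝓝 (2 / d)) := by
    simpa using tendsto_const_nhds.sub hi
  have h2 : Tendsto (fun n : ℕ => 2 / (d : ℝ) + 1 / (n : ℝ)) atTop (𝓝 (2 / d)) := by
    simpa using tendsto_const_nhds.add hi
  refine tendsto_of_tendsto_of_tendsto_of_le_of_le' h1 h2 ?_ ?_
  all_goals
    filter_upwards [eventually_gt_atTop 0] with n hn
    have hn' : (0 : ℝ) < n := by exact_mod_cast hn
    have e1 : ((n / d : ℕ) : ℝ) * d ≤ n := by exact_mod_cast Nat.div_mul_le_self n d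
    have e2 : (n : ℝ) < (((n / d : ℕ) : ℝ) + 1) * d := by
      exact_mod_cast Nat.lt_mul_of_div_lt (Nat.lt_succ_self (n / d)) (Nat.pos_of_ne_zero hd)
    have e3 : ((n / d : ℕ) : ℝ) ≤ n / d := by rwa [le_div_iff₀ hd']
    have e4 : (n : ℝ) / d < ((n / d : ℕ) : ℝ) + 1 := by rwa [div_lt_iff₀ hd']
  · rw [le_div_iff₀ hn', sub_mul, one_div_mul_cancel hn'.ne', div_mul_eq_mul_div, mul_div_assoc]
    linarith
  · rw [div_le_iff₀ hn', add_mul, one_div_mul_cancel hn'.ne', div_mul_eq_mul_div, mul_div_assoc]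
    linarith

/-- The constant `∑ μ(d)/d⁴`. -/
noncomputable def moebConst : ℝ := ∑' d : ℕ, (ArithmeticFunction.moebius d : ℝ) * (1 / (d : ℝ) ^ 4)

lemma abs_moeb (d : ℕ) : |(ArithmeticFunction.moebius d : ℝ)| ≤ 1 := by
  exact_mod_cast ArithmeticFunction.abs_moebius_le_one (n := d)

lemma summable_four : Summable (fun d : ℕ => 1 / (d : ℝ) ^ 4) :=
  Real.summable_one_div_nat_pow.2 (by norm_num)

lemma moebConst_pos : 0 < moebConst := by
  have hs : Summable (fun d : ℕ => (ArithmeticFunction.moebius d : ℝ) * (1 / (d : ℝ) ^ 4)) := by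
    refine Summable.of_norm_bounded summable_four (fun d => ?_)
    rw [Real.norm_eq_abs, abs_mul, abs_of_nonneg (by positivity : (0 : ℝ) ≤ 1 / (d : ℝ) ^ 4)]
    exact mul_le_of_le_one_left (by positivity) (abs_moeb d)
  have h4 : ∑' d : ℕ, 1 / (d : ℝ) ^ 4 = Real.pi ^ 4 / 90 := hasSum_zeta_four.tsum_eq
  have h := hs.add summable_four
  have h5 : (2 : ℝ) ≤ ∑' d : ℕ, ((ArithmeticFunction.moebius d : ℝ) * (1 / (d : ℝ) ^ 4) + 1 / (d : ℝ) ^ 4) := by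
    refine le_trans ?_ (h.le_tsum 1 (fun d _ => ?_))
    · norm_num
    · have := (abs_le.1 (abs_moeb d)).1
      have h6 : (0 : ℝ) ≤ 1 / (d : ℝ) ^ 4 := by positivity
      nlinarith
  rw [hs.tsum_add summable_four, h4] at h5
  have hpi : Real.pi ^ 4 < 3.15 ^ 4 := by
    have := Real.pi_lt_d2
    have := Real.pi_pos
    gcongr
  have : moebConst + Real.pi ^ 4 / 90 ≥ 2 := h5
  norm_num at hpi
  linarith

lemma tendsto_prim (Q : (Fin 4 → ℤ) → Prop)
    (hQ : ∀ (d : ℕ) (a : Fin 4 → ℤ), d ≠ 0 → (Q (fun i => (d : ℤ) * a i) ↔ Q a)) (L : ℝ)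
    (h : Tendsto (dens Q) atTop (𝓝 L)) :
    Tendsto (fun n : ℕ => (cnt (fun a => Finset.univ.gcd a = 1 ∧ Q a) n : ℝ) / (n : ℝ) ^ 4) atTop
      (𝓝 (16 * L * moebConst)) := by
  set N : ℕ → ℕ := cnt (fun a => Q a ∧ a ≠ 0) with hN
  let f : ℕ → ℕ → ℝ := fun n d => (ArithmeticFunction.moebius d : ℝ) * ((N (n / d) : ℝ) / (n : ℝ) ^ 4)
  have hlim : ∑' d : ℕ, (ArithmeticFunction.moebius d : ℝ) * (L * (2 / (d : ℝ)) ^ 4) =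
      16 * L * moebConst := by
    unfold moebConst
    rw [← tsum_mul_left]
    congr 1
    funext d
    ring
  have heq : (fun n : ℕ => (cnt (fun a => Finset.univ.gcd a = 1 ∧ Q a) n : ℝ) / (n : ℝ) ^ 4) =
      fun n => ∑' d, f n d := by
    funext n
    rw [tsum_eq_sum (s := Finset.Icc 1 n)]
    · have := cnt_prim Q hQ n
      have h' : (cnt (fun a => Finset.univ.gcd a = 1 ∧ Q a) n : ℝ) =
        ∑ d ∈ Finset.Icc 1 n, (ArithmeticFunction.moebius d : ℝ) * N (n / d) := by
        exact_mod_cast this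
      rw [h', Finset.sum_div]
      refine Finset.sum_congr rfl fun d _ => ?_
      simp only [f]
      ring
    · intro d hd
      simp only [f]
      have : n / d = 0 := by
        rw [Finset.mem_Icc] at hd
        rcases Nat.eq_zero_or_pos d with rfl | hd0
        · simp
        · exact Nat.div_eq_of_lt (by omega)
      rw [this, hN, cnt_zero]
      simp
  rw [heq, ← hlim]
  refine tendsto_tsum_of_dominated_convergence (bound := fun d : ℕ => 81 * (1 / (d : ℝ) ^ 4))
    (summable_four.mul_left 81) ?_ ?_
  · intro d
    rcases Nat.eq_zero_or_pos d with rfl | hd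
    · simp [f]
    apply Tendsto.const_mul
    have h1 := (dens_ne_zero Q L h).comp (Nat.tendsto_div_const_atTop hd.ne')
    have h2 := (tendsto_ratio d hd.ne').pow 4
    refine (h1.mul h2).congr fun n => ?_
    simp only [Function.comp, dens, ← hN, div_pow]
    have : (2 * ((n / d : ℕ) : ℝ) + 1) ^ 4 ≠ 0 := by positivity
    rw [div_mul_div_cancel₀ this]
  · refine Eventually.of_forall fun n d => ?_
    simp only [f]
    rw [Real.norm_eq_abs, abs_mul]
    have h1 : (0 : ℝ) ≤ (N (n / d) : ℝ) / (n : ℝ) ^ 4 := by positivity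
    rw [abs_of_nonneg h1]
    refine (mul_le_of_le_one_left h1 (abs_moeb d)).trans ?_
    have h2 : (N (n / d) : ℝ) ≤ 81 * ((n / d : ℕ) : ℝ) ^ 4 := by exact_mod_cast cnt_le_pow Q (n / d)
    rcases Nat.eq_zero_or_pos n with rfl | hn
    · simp
    have hn' : (0 : ℝ) < n := by exact_mod_cast hn
    have h3 : ((n / d : ℕ) : ℝ) ≤ n / d := Nat.cast_div_le
    rw [div_le_iff₀ (by positivity)]
    calc (N (n / d) : ℝ) ≤ 81 * ((n / d : ℕ) : ℝ) ^ 4 := h2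
      _ ≤ 81 * ((n : ℝ) / d) ^ 4 := by gcongr
      _ = _ := by ring

lemma dens_true : Tendsto (dens (fun _ => True)) atTop (𝓝 1) := by
  refine tendsto_const_nhds.congr fun n => ?_
  unfold dens cnt
  rw [Finset.filter_true, box_card]
  push_cast
  rw [div_self (by positivity)]

lemma tendsto_quot (Q : (Fin 4 → ℤ) → Prop)
    (hQ : ∀ (d : ℕ) (a : Fin 4 → ℤ), d ≠ 0 → (Q (fun i => (d : ℤ) * a i) ↔ Q a)) (L : ℝ)
    (h : Tendsto (dens Q) atTop (𝓝 L)) :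
    Tendsto (fun n : ℕ => (cnt (fun a => Finset.univ.gcd a = 1 ∧ Q a) n : ℝ) /
      (cnt (fun a => Finset.univ.gcd a = 1 ∧ True) n : ℝ)) atTop (𝓝 L) := by
  have h1 := tendsto_prim Q hQ L h
  have h2 := tendsto_prim (fun _ => True) (fun _ _ _ => Iff.rfl) 1 dens_true
  have hp := moebConst_pos
  have h3 := h1.div h2 (by positivity)
  have e : 16 * L * moebConst / (16 * 1 * moebConst) = L := by field_simp
  rw [e] at h3
  refine h3.congr' ?_
  filter_upwards [eventually_gt_atTop 0] with n hn
  have hn' : (n : ℝ) ^ 4 ≠ 0 := by positivity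
  simp only [Pi.div_apply]
  rw [div_div_div_cancel_right₀ hn']

lemma prim_ne_zero (a : Fin 4 → ℤ) (h : Finset.univ.gcd a = 1) : (fun i => (a i : ℚ)) ≠ 0 := by
  intro h0
  have : Finset.univ.gcd a = 0 := by
    rw [Finset.gcd_eq_zero_iff]
    intro i _
    have := congrFun h0 i
    simpa using this
  rw [this] at h
  exact absurd h (by norm_num)

lemma prim_eq_or_neg (a b : Fin 4 → ℤ) (ha : Finset.univ.gcd a = 1) (hb : Finset.univ.gcd b = 1)
    (ha0 : (fun i => (a i : ℚ)) ≠ 0) (hb0 : (fun i => (b i : ℚ)) ≠ 0)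
    (h : Projectivization.mk ℚ (fun i => (a i : ℚ)) ha0 = Projectivization.mk ℚ _ hb0) :
    a = b ∨ a = -b := by
  rw [Projectivization.mk_eq_mk_iff'] at h
  obtain ⟨c, hc⟩ := h
  have hd : (c.den : ℤ) ≠ 0 := by exact_mod_cast c.den_nz
  have hi : ∀ i, c.num * b i = c.den * a i := by
    intro i
    have h1 := congrFun hc i
    simp only [Pi.smul_apply, smul_eq_mul] at h1
    have h2 : (c.num : ℚ) * b i = c.den * a i := by
      rw [← h1, ← mul_assoc, mul_comm (c.den : ℚ) c, Rat.mul_den_eq_num]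
    exact_mod_cast h2
  have hg : Finset.univ.gcd (fun i => c.num * b i) = Finset.univ.gcd (fun i => (c.den : ℤ) * a i) := by
    congr 1
    funext i
    exact hi i
  rw [Finset.gcd_mul_left, Finset.gcd_mul_left, ha, hb, mul_one, mul_one, ← Int.abs_eq_normalize,
    ← Int.abs_eq_normalize, abs_eq_abs] at hg
  rcases hg with hg | hg
  · left
    funext i
    have := hi i
    rw [hg] at this
    exact (mul_left_cancel₀ hd this).symm
  · right
    funext i
    have := hi i
    rw [hg] at this
    apply mul_left_cancel₀ hd
    simp only [Pi.neg_apply]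
    linarith

lemma vec_gcd_neg (a : Fin 4 → ℤ) : Finset.univ.gcd (-a) = Finset.univ.gcd a := by
  have : (-a) = fun i => (-1 : ℤ) * a i := by funext i; simp
  rw [this, Finset.gcd_mul_left, ← Int.abs_eq_normalize, abs_neg, abs_one, one_mul]

lemma mk_neg (a : Fin 4 → ℤ) (h : (fun i => (a i : ℚ)) ≠ 0) (h' : (fun i => (((-a) i : ℤ) : ℚ)) ≠ 0) :
    Projectivization.mk ℚ (fun i => (((-a) i : ℤ) : ℚ)) h' = Projectivization.mk ℚ _ h := by
  rw [Projectivization.mk_eq_mk_iff']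
  exact ⟨-1, by funext i; simp⟩

/-- Points of height at most `B` with a primitive representative satisfying `Q`. -/
def ptSet (Q : (Fin 4 → ℤ) → Prop) (B : ℝ) : Set (Projectivization ℚ (Fin 4 → ℚ)) :=
  {P | ∃ a : Fin 4 → ℤ, Finset.univ.gcd a = 1 ∧ (∀ i, (|a i| : ℝ) ≤ B) ∧ Q a ∧
    ∃ h : (fun i => (a i : ℚ)) ≠ 0, Projectivization.mk ℚ (fun i => (a i : ℚ)) h = P}

lemma box_iff (a : Fin 4 → ℤ) (B : ℝ) (hB : 0 ≤ B) :
    a ∈ box ⌊B⌋₊ ↔ ∀ i, (|a i| : ℝ) ≤ B := by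
  rw [mem_box]
  refine forall_congr' fun i => ?_
  rw [Int.abs_eq_natAbs, Nat.cast_le, Nat.le_floor_iff hB, Nat.cast_natAbs, Int.cast_abs]

lemma card_ptSet (Q : (Fin 4 → ℤ) → Prop) (hQ : ∀ a, Q (-a) ↔ Q a) (B : ℝ) (hB : 0 ≤ B) :
    Nat.card (ptSet Q B) * 2 = cnt (fun a => Finset.univ.gcd a = 1 ∧ Q a) ⌊B⌋₊ := by
  classical
  let s := (box ⌊B⌋₊).filter (fun a => Finset.univ.gcd a = 1 ∧ Q a)
  have hs : ∀ a, a ∈ s ↔ (∀ i, (|a i| : ℝ) ≤ B) ∧ Finset.univ.gcd a = 1 ∧ Q a := by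
    intro a
    simp only [s, Finset.mem_filter, box_iff a B hB]
  have hns : ∀ a ∈ s, -a ∈ s := by
    intro a ha
    rw [hs] at ha ⊢
    rw [vec_gcd_neg, hQ]
    refine ⟨fun i => ?_, ha.2⟩
    simpa using ha.1 i
  let P₀ : Projectivization ℚ (Fin 4 → ℚ) := Projectivization.mk ℚ (fun _ => 1) (by
    intro h; simpa using congrFun h 0)
  let φ : (Fin 4 → ℤ) → Projectivization ℚ (Fin 4 → ℚ) := fun a =>
    if h : (fun i => (a i : ℚ)) ≠ 0 then Projectivization.mk ℚ _ h else P₀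
  have hφ : ∀ a (h : (fun i => (a i : ℚ)) ≠ 0), φ a = Projectivization.mk ℚ _ h := by
    intro a h
    simp only [φ]
    rw [dif_pos h]
  have himg : ptSet Q B = ((s.image φ : Finset _) : Set _) := by
    ext P
    simp only [ptSet, Set.mem_ofPred_eq, Finset.coe_image, Set.mem_image, Finset.mem_coe]
    constructor
    · rintro ⟨a, h1, h2, h3, h4, h5⟩
      exact ⟨a, (hs a).2 ⟨h2, h1, h3⟩, by rw [hφ a h4, h5]⟩
    · rintro ⟨a, h1, h2⟩
      obtain ⟨h3, h4, h5⟩ := (hs a).1 h1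
      exact ⟨a, h4, h3, h5, prim_ne_zero a h4, by rw [← h2, hφ]⟩
  have hcard : cnt (fun a => Finset.univ.gcd a = 1 ∧ Q a) ⌊B⌋₊ = s.card := by
    unfold cnt
    simp only [s]
    congr!
  rw [hcard, himg, Nat.card_coe_set_eq, Set.ncard_coe_finset, Finset.card_eq_sum_card_image φ s]
  rw [Finset.sum_const_nat (m := 2)]
  intro P hP
  obtain ⟨a, ha, rfl⟩ := Finset.mem_image.1 hP
  obtain ⟨h3, h4, h5⟩ := (hs a).1 ha
  have ha0 := prim_ne_zero a h4
  have hna0 := prim_ne_zero (-a) (by rwa [vec_gcd_neg])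
  have hfib : s.filter (fun b => φ b = φ a) = {a, -a} := by
    ext b
    simp only [Finset.mem_filter, Finset.mem_insert, Finset.mem_singleton]
    constructor
    · rintro ⟨hb, hbφ⟩
      have hb1 := ((hs b).1 hb).2.1
      rw [hφ a ha0, hφ b (prim_ne_zero b hb1)] at hbφ
      exact prim_eq_or_neg b a hb1 h4 _ _ hbφ
    · rintro (rfl | rfl)
      · exact ⟨ha, rfl⟩
      · refine ⟨hns a ha, ?_⟩
        rw [hφ a ha0, hφ (-a) hna0]
        exact mk_neg a ha0 hna0
  rw [hfib, Finset.card_pair]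
  intro h
  apply ha0
  funext i
  have := congrFun h i
  simp only [Pi.neg_apply] at this
  have h0 : a i = 0 := by omega
  simp [h0]

lemma real_sol (a : Fin 4 → ℤ) : ∃ x : Fin 4 → ℝ, x ≠ 0 ∧ ∑ i, (a i : ℝ) * x i ^ 3 = 0 := by
  by_cases h : a 0 = 0
  · refine ⟨![1, 0, 0, 0], ?_, ?_⟩
    · intro h; simpa using congrFun h 0
    · simp [Fin.sum_univ_four, h]
  · obtain ⟨y, hy⟩ : ∃ y : ℝ, y ^ 3 = -(a 1 : ℝ) / a 0 := by
      obtain ⟨z, hz⟩ : ∃ z : ℝ, z ^ 3 = |-(a 1 : ℝ) / a 0| :=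
        ⟨|-(a 1 : ℝ) / a 0| ^ ((3 : ℝ)⁻¹), by
          have := Real.rpow_inv_natCast_pow (abs_nonneg (-(a 1 : ℝ) / a 0)) (n := 3) (by norm_num)
          simpa using this⟩
      rcases abs_choice (-(a 1 : ℝ) / a 0) with h | h
      · exact ⟨z, by rw [hz, h]⟩
      · exact ⟨-z, by rw [Odd.neg_pow (by decide), hz, h, neg_neg]⟩
    have h0 : (a 0 : ℝ) ≠ 0 := by exact_mod_cast h
    refine ⟨![y, 1, 0, 0], ?_, ?_⟩
    · intro h; simpa using congrFun h 1
    · simp [Fin.sum_univ_four, hy]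
      field_simp
      ring

/-- Everywhere local solubility for an integer vector. -/
def Els (a : Fin 4 → ℤ) : Prop := ∀ p : Nat.Primes, SolZ (p : ℕ) a

lemma solZ_iff (p : ℕ) [Fact p.Prime] (a : Fin 4 → ℤ) :
    SolZ p a ↔ ∃ x : Fin 4 → ℚ_[p], x ≠ 0 ∧ ∑ i, (a i : ℚ_[p]) * x i ^ 3 = 0 := by
  unfold SolZ Sol
  simp only [PadicInt.coe_intCast]

lemma els_mul (d : ℤ) (a : Fin 4 → ℤ) (hd : d ≠ 0) : Els (fun i => d * a i) ↔ Els a := by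
  unfold Els
  refine forall_congr' fun p => ?_
  rw [solZ_iff, solZ_iff]
  refine exists_congr fun x => and_congr_right fun _ => ?_
  have hd' : (d : ℚ_[(p : ℕ)]) ≠ 0 := by exact_mod_cast hd
  have : ∑ i, ((d * a i : ℤ) : ℚ_[(p : ℕ)]) * x i ^ 3 = d * ∑ i, (a i : ℚ_[(p : ℕ)]) * x i ^ 3 := by
    rw [Finset.mul_sum]
    refine Finset.sum_congr rfl fun i _ => ?_
    push_cast
    ring
  rw [this, mul_eq_zero]
  simp [hd']

lemma els_neg (a : Fin 4 → ℤ) : Els (-a) ↔ Els a := by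
  have h := els_mul (-1) a (by norm_num)
  have e : (fun i => (-1 : ℤ) * a i) = -a := by funext i; simp
  rwa [e] at h

lemma height_set (B : ℝ) :
    {P : Projectivization ℚ (Fin 4 → ℚ) | heightLE P B} = ptSet (fun _ => True) B := by
  ext P
  simp [heightLE, ptSet]

lemma els_set (B : ℝ) :
    {P : Projectivization ℚ (Fin 4 → ℚ) | heightLE P B ∧ everywhereLocSol P} = ptSet Els B := by
  ext P
  simp only [heightLE, everywhereLocSol, ptSet, Set.mem_ofPred_eq]
  constructor
  · rintro ⟨⟨a, h1, h2, h3, h4⟩, b, g1, ⟨g2, g3⟩, _, g4⟩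
    have hb : Els b := fun p => (solZ_iff p b).2 (g4 p)
    refine ⟨a, h1, h2, ?_, h3, h4⟩
    rcases prim_eq_or_neg a b h1 g1 h3 g2 (h4.trans g3.symm) with rfl | rfl
    · exact hb
    · exact (els_neg b).2 hb
  · rintro ⟨a, h1, h2, h3, h4, h5⟩
    exact ⟨⟨a, h1, h2, h4, h5⟩, a, h1, ⟨h4, h5⟩, real_sol a, fun p => (solZ_iff p a).1 (h3 p)⟩

lemma limit_main (L : ℝ) (h : Tendsto (dens Els) atTop (𝓝 L)) :
    Tendsto (fun B : ℝ =>
        (Nat.card {P : Projectivization ℚ (Fin 4 → ℚ) | heightLE P B ∧ everywhereLocSol P} : ℝ)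
          / (Nat.card {P : Projectivization ℚ (Fin 4 → ℚ) | heightLE P B} : ℝ))
      atTop (𝓝 L) := by
  have h1 := (tendsto_quot Els (fun d a hd => els_mul d a (by exact_mod_cast hd)) L h).comp
    (tendsto_nat_floor_atTop (α := ℝ))
  refine h1.congr' ?_
  filter_upwards [eventually_ge_atTop 0] with B hB
  rw [els_set, height_set]
  simp only [Function.comp]
  rw [← card_ptSet Els els_neg B hB, ← card_ptSet (fun _ => True) (fun _ => Iff.rfl) B hB]
  push_cast
  rw [mul_div_mul_right _ _ (by norm_num : (2 : ℝ) ≠ 0)]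

lemma tprod_split (f : Nat.Primes → ℝ) (h1 : ∀ p, f p ≤ 1)
    (h2 : ∀ p, 1 - f p ≤ 16 * (1 / ((p : ℕ) : ℝ) ^ 2)) (h3 : ∀ p : Nat.Primes, (p : ℕ) % 3 = 2 → f p = 1) :
    (∏' p, f p) = f ⟨3, by norm_num⟩ * ∏' q : {p : Nat.Primes // (p : ℕ) % 3 = 1}, f q.1 := by
  classical
  set t : Nat.Primes := ⟨3, by norm_num⟩ with ht
  have hm : Multipliable (Function.update f t 1) := by
    apply multipliable_of_bound
    · intro p
      by_cases h : p = t
      · subst h; simp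
      · rw [Function.update_of_ne h]; exact h1 p
    · intro p
      by_cases h : p = t
      · subst h
        rw [Function.update_self, sub_self]; positivity
      · rw [Function.update_of_ne h]; exact h2 p
  rw [hm.tprod_eq_mul_tprod_ite' t]
  congr 1
  have e := tprod_subtype {p : Nat.Primes | (p : ℕ) % 3 = 1} f
  refine Eq.trans ?_ e.symm
  congr 1
  funext p
  by_cases hp : (p : ℕ) % 3 = 1
  · have hne : p ≠ t := by
      rintro rfl
      simp [ht] at hp
    rw [if_neg hne, Set.mulIndicator_of_mem (by exact hp)]
  · rw [Set.mulIndicator_of_notMem (by exact hp)]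
    by_cases h : p = t
    · rw [if_pos h]
    · rw [if_neg h]
      apply h3
      have : ¬ 3 ∣ (p : ℕ) := by
        intro hd
        rw [Nat.prime_dvd_prime_iff_eq Nat.prime_three p.2] at hd
        exact h (Subtype.ext hd.symm)
      omega

/-- The proportion of diagonal cubic surfaces over `ℚ` that are everywhere locally
soluble: the limit `σ` exists and equals the convergent product `∏_p σ_p` of the local
densities `σ_p = μ_p({a ∈ ℤ_p⁴ : S_a(ℚ_p) ≠ ∅})`; moreover `σ_p = 1` for every prime
`p ≡ 2 (mod 3)`, so that `σ = σ₃ · ∏_{p ≡ 1 (mod 3)} σ_p`.  Here, for each prime `p`,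
`μp p` is the Haar measure on `ℤ_p⁴` normalized by total mass `1`. -/
theorem proportion_diagonal_cubic_everywhere_locally_soluble
    (μp : ∀ p : Nat.Primes, Measure (Fin 4 → ℤ_[(p : ℕ)]))
    (hHaar : ∀ p, (μp p).IsAddHaarMeasure) (hmass : ∀ p, μp p Set.univ = 1)
    (σ' : Nat.Primes → ℝ)
    (hσ' : ∀ p, σ' p = (μp p {a : Fin 4 → ℤ_[(p : ℕ)] |
      ∃ x : Fin 4 → ℚ_[(p : ℕ)], x ≠ 0 ∧ ∑ i, (a i : ℚ_[(p : ℕ)]) * x i ^ 3 = 0}).toReal) :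
    Multipliable σ' ∧
    Tendsto (fun B : ℝ =>
        (Nat.card {P : Projectivization ℚ (Fin 4 → ℚ) | heightLE P B ∧ everywhereLocSol P} : ℝ)
          / (Nat.card {P : Projectivization ℚ (Fin 4 → ℚ) | heightLE P B} : ℝ))
      atTop (𝓝 (∏' p, σ' p)) ∧
    (∀ p : Nat.Primes, (p : ℕ) % 3 = 2 → σ' p = 1) ∧
    (∏' p, σ' p) = σ' ⟨3, by norm_num⟩ *
      ∏' q : {p : Nat.Primes // (p : ℕ) % 3 = 1}, σ' q.1 := by
  have i1 : ∀ p, (μp p).IsAddLeftInvariant := fun p => (hHaar p).toIsAddLeftInvariant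
  have i2 : ∀ p, IsProbabilityMeasure (μp p) := fun p => ⟨hmass p⟩
  have hσ : σ' = fun p : Nat.Primes => (μp p).real {a | Sol (p : ℕ) a} := funext hσ'
  have h3 : ∀ p : Nat.Primes, (p : ℕ) % 3 = 2 → σ' p = 1 := by
    intro p hp
    have : {a | Sol (p : ℕ) a} = Set.univ := Set.eq_univ_of_forall fun a => sol_two_mod_three hp a
    rw [hσ]
    simp only
    rw [this]
    exact probReal_univ
  refine ⟨?_, ?_, h3, ?_⟩
  · rw [hσ]; exact multipliable_sigma μp
  · rw [hσ]; exact limit_main _ (dens_all μp)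
  · refine tprod_split σ' ?_ ?_ h3
    · intro p; rw [hσ]; exact measureReal_le_one
    · intro p; rw [hσ]; exact one_sub_le (μp p)
end

section
/- Let p be a prime with p ≡ 1 (mod 3). Then μ_p({a ∈ ℤ_p⁴ : S_a(ℚ_p) ≠ ∅}) = [(1 − 1/p)³/(1 − 1/p³)³] · (1 − 1/p + 1/p²) · (1 + 1/p + 1/(3p²)) · (1 + 3/p + 3/p²). -/
open MeasureTheory

/-- `g` represents a generator of the group of nonzero residues modulo cubes. -/
structure CubeGen (p : ℕ) (g : ZMod p) : Prop where
  ne : g ≠ 0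
  ex : ∀ x : ZMod p, x ≠ 0 → ∃ c < 3, ∃ w : ZMod p, w ≠ 0 ∧ x = g ^ c * w ^ 3
  uniq : ∀ c c' : ℕ, c < 3 → c' < 3 → ∀ w w' : ZMod p, w ≠ 0 → w' ≠ 0 →
    g ^ c * w ^ 3 = g ^ c' * w' ^ 3 → c = c'

theorem exists_cubeGen (p : ℕ) [Fact p.Prime] (hp : p % 3 = 1) : ∃ g : ZMod p, CubeGen p g := by
  obtain ⟨g, hg⟩ := IsCyclic.exists_generator (α := (ZMod p)ˣ)
  have hgen : ∀ x : ZMod p, x ≠ 0 → ∃ n : ℕ, x = (g : ZMod p) ^ n := by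
    intro x hx
    have := hg (Units.mk0 x hx)
    rw [← mem_powers_iff_mem_zpowers] at this
    obtain ⟨n, hn⟩ := this
    refine ⟨n, ?_⟩
    have h2 := congrArg Units.val hn
    simpa using h2.symm
  refine ⟨g, g.ne_zero, ?_, ?_⟩
  · intro x hx
    obtain ⟨n, rfl⟩ := hgen x hx
    refine ⟨n % 3, Nat.mod_lt _ (by norm_num), (g : ZMod p) ^ (n / 3),
      pow_ne_zero _ g.ne_zero, ?_⟩
    rw [← pow_mul, ← pow_add]
    congr 1
    omega
  · intro c c' hc hc' w w' hw hw' h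
    obtain ⟨m, rfl⟩ := hgen w hw
    obtain ⟨m', rfl⟩ := hgen w' hw'
    rw [← pow_mul, ← pow_add, ← pow_mul, ← pow_add] at h
    have h' : g ^ (c + m * 3) = g ^ (c' + m' * 3) := by
      ext; simpa using h
    rw [pow_eq_pow_iff_modEq, orderOf_eq_card_of_forall_mem_zpowers hg, Nat.card_eq_fintype_card,
      ZMod.card_units] at h'
    have h3 : 3 ∣ p - 1 := by omega
    have := h'.of_dvd h3
    unfold Nat.ModEq at this
    omega

/-- The three cube classes contain elements summing to zero. -/
theorem CubeGen.exists_sum {p : ℕ} [Fact p.Prime] {g : ZMod p} (hg : CubeGen p g) :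
    ∃ x y z : ZMod p, x ≠ 0 ∧ x ^ 3 + g * y ^ 3 + g ^ 2 * z ^ 3 = 0 := by
  classical
  have g0 := hg.ne
  by_contra! H
  let C : ℕ → Finset (ZMod p) := fun i =>
    Finset.univ.filter fun x => ∃ w : ZMod p, w ≠ 0 ∧ x = g ^ i * w ^ 3
  have memC : ∀ i x, x ∈ C i ↔ ∃ w : ZMod p, w ≠ 0 ∧ x = g ^ i * w ^ 3 := by
    intro i x; simp [C]
  have hcard : (C 1).card = (C 0).card := by
    symm
    apply Finset.card_bij (fun x _ => g * x)
    · intro x hx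
      obtain ⟨w, hw, rfl⟩ := (memC _ _).1 hx
      exact (memC _ _).2 ⟨w, hw, by ring⟩
    · intro x _ y _ h
      exact mul_left_cancel₀ g0 h
    · intro x hx
      obtain ⟨w, hw, rfl⟩ := (memC _ _).1 hx
      exact ⟨w ^ 3, (memC _ _).2 ⟨w, hw, by ring⟩, by ring⟩
  have hdis : ∀ i j x, i < 3 → j < 3 → x ∈ C i → x ∈ C j → i = j := by
    intro i j x hi hj h1 h2
    obtain ⟨w, hw, h⟩ := (memC _ _).1 h1
    obtain ⟨w', hw', h'⟩ := (memC _ _).1 h2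
    exact hg.uniq i j hi hj w w' hw hw' (h.symm.trans h')
  have hz : ∀ i x, x ∈ C i → x ≠ 0 := by
    intro i x h
    obtain ⟨w, hw, rfl⟩ := (memC _ _).1 h
    exact mul_ne_zero (pow_ne_zero _ g0) (pow_ne_zero _ hw)
  have hneg : ∀ i x, x ∈ C i → -x ∈ C i := by
    intro i x h
    obtain ⟨w, hw, rfl⟩ := (memC _ _).1 h
    exact (memC _ _).2 ⟨-w, neg_ne_zero.2 hw, by ring⟩
  have hone : (-1 : ZMod p) ∈ C 0 := (memC _ _).2 ⟨-1, by simp, by ring⟩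
  have key : ∀ y ∈ C 1, 1 + y ∈ C 0 ∨ 1 + y ∈ C 1 := by
    intro y hy
    have hne : 1 + y ≠ 0 := by
      intro h
      have : y = -1 := by linear_combination h
      rw [this] at hy
      have := hdis _ _ _ (by norm_num) (by norm_num) hy hone
      omega
    obtain ⟨c, hc, w, hw, h⟩ := hg.ex _ hne
    have hmem := (memC c (1 + y)).2 ⟨w, hw, h⟩
    interval_cases c
    · exact Or.inl hmem
    · exact Or.inr hmem
    · exfalso
      obtain ⟨v, hv, rfl⟩ := (memC _ _).1 hy
      exact H 1 v (-w) one_ne_zero (by linear_combination h)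
  let φ : ZMod p → ZMod p := fun y => if 1 + y ∈ C 0 then -(1 + y) else -(1 + y) * y⁻¹
  have e1 : ∀ y, 1 + y ∈ C 0 → φ y = -(1 + y) := fun y h => if_pos h
  have e2 : ∀ y, 1 + y ∉ C 0 → φ y = -(1 + y) * y⁻¹ := fun y h => if_neg h
  have s1 : ∀ y ∈ C 1, 1 + y ∈ C 0 → 1 + φ y ∈ C 1 := by
    intro y hy h
    rw [e1 y h]
    convert hneg _ _ hy using 1
    ring
  have s2 : ∀ y ∈ C 1, 1 + y ∉ C 0 → 1 + φ y = - y⁻¹ := by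
    intro y hy h
    have := hz _ _ hy
    rw [e2 y h]
    field_simp
    ring
  have s3 : ∀ y ∈ C 1, 1 + y ∉ C 0 → 1 + φ y ∈ C 2 := by
    intro y hy h
    rw [s2 y hy h]
    apply hneg
    obtain ⟨w, hw, rfl⟩ := (memC _ _).1 hy
    refine (memC _ _).2 ⟨(g * w)⁻¹, inv_ne_zero (mul_ne_zero g0 hw), ?_⟩
    field_simp
  have hmaps : ∀ y ∈ C 1, φ y ∈ (C 0).erase (-1) := by
    intro y hy
    rw [Finset.mem_erase]
    by_cases h : 1 + y ∈ C 0
    · refine ⟨fun h' => ?_, ?_⟩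
      · have := hz _ _ (s1 y hy h)
        apply this
        rw [h']; ring
      · rw [e1 y h]; exact hneg _ _ h
    · refine ⟨fun h' => ?_, ?_⟩
      · have := hz _ _ (s3 y hy h)
        apply this
        rw [h']; ring
      · rw [e2 y h]
        have h1 := (key y hy).resolve_left h
        obtain ⟨v, hv, hv'⟩ := (memC _ _).1 h1
        obtain ⟨w, hw, rfl⟩ := (memC _ _).1 hy
        rw [hv']
        refine (memC _ _).2 ⟨- v / w, div_ne_zero (neg_ne_zero.2 hv) hw, ?_⟩
        field_simp
        try ring
  have hinj : Set.InjOn φ (C 1 : Set (ZMod p)) := by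
    intro y hy y' hy' h
    have hy := Finset.mem_coe.1 hy
    have hy' := Finset.mem_coe.1 hy'
    by_cases h1 : 1 + y ∈ C 0 <;> by_cases h2 : 1 + y' ∈ C 0
    · rw [e1 y h1, e1 y' h2] at h
      linear_combination -h
    · have := hdis 1 2 _ (by norm_num) (by norm_num) (s1 y hy h1) (h ▸ s3 y' hy' h2)
      omega
    · have := hdis 1 2 _ (by norm_num) (by norm_num) (s1 y' hy' h2) (h ▸ s3 y hy h1)
      omega
    · have a := s2 y hy h1
      have b := s2 y' hy' h2
      rw [h, b] at a
      exact inv_injective (neg_injective a.symm)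
  have hle := Finset.card_le_card_of_injOn φ hmaps hinj
  rw [Finset.card_erase_of_mem hone, hcard] at hle
  have : 0 < (C 0).card := Finset.card_pos.2 ⟨_, hone⟩
  omega

theorem padicInt_cube {p : ℕ} [Fact p.Prime] (hp : p % 3 = 1) (w : ℤ_[p]) (x : ZMod p)
    (hx : x ≠ 0) (h : PadicInt.toZMod w = x ^ 3) : ∃ y : ℤ_[p], w = y ^ 3 := by
  obtain ⟨a, rfl⟩ := ZMod.ringHom_surjective (PadicInt.toZMod (p := p)) x
  have nz : ∀ z : ℤ_[p], PadicInt.toZMod z = 0 ↔ ‖z‖ < 1 := by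
    intro z
    rw [← RingHom.mem_ker, PadicInt.ker_toZMod, IsLocalRing.mem_maximalIdeal, PadicInt.mem_nonunits]
  have h3 : (PadicInt.toZMod (3 : ℤ_[p])) ≠ 0 := by
    have : (PadicInt.toZMod (3 : ℤ_[p])) = ((3 : ℕ) : ZMod p) := by
      rw [map_ofNat]; norm_num
    rw [this, Ne, ZMod.natCast_eq_zero_iff]
    intro hd
    have := (Nat.prime_dvd_prime_iff_eq Fact.out Nat.prime_three).1 hd
    omega
  have n1 : ‖(3 : ℤ_[p]) * a ^ 2‖ = 1 := by
    apply le_antisymm (PadicInt.norm_le_one _)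
    rw [← not_lt, ← nz, map_mul, map_pow]
    exact mul_ne_zero h3 (pow_ne_zero _ hx)
  have n2 : ‖a ^ 3 - w‖ < 1 := by
    rw [← nz]; simp [h]
  obtain ⟨z, hz, -⟩ := hensels_lemma (p := p) (R := ℤ_[p])
    (F := Polynomial.X ^ 3 - Polynomial.C w) (a := a) (by
      simp
      simp at n1
      rw [show (2 + 1 : ℤ_[p]) = 3 by norm_num, n1]
      simpa using n2)
  refine ⟨z, ?_⟩
  simp at hz
  linear_combination -hz
def goodB (a b c d : ℕ) : Bool :=
  (a.beq b || a.beq c || a.beq d || b.beq c || b.beq d || c.beq d) ||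
  (((a/3).beq (b/3) && ((a/3).beq (c/3) || (a/3).beq (d/3))) ||
   ((c/3).beq (d/3) && ((a/3).beq (c/3) || (b/3).beq (c/3))))

def sumN (f : ℕ → ℕ) : ℕ → ℕ
  | 0 => 0
  | n + 1 => Nat.add (sumN f n) (f n)

theorem sumN_eq (f : ℕ → ℕ) (n : ℕ) : sumN f n = ∑ i ∈ Finset.range n, f i := by
  induction n with
  | zero => rfl
  | succ n ih => rw [Finset.sum_range_succ, ← ih]; rfl

def cntN (s : ℕ) : ℕ :=
  sumN (fun a => sumN (fun b => sumN (fun c => sumN (fun d =>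
    cond (goodB a b c d) (cond (Nat.beq (a/3+b/3+c/3+d/3) s) 1 0) 0) 9) 9) 9) 9

theorem cntN_eq : cntN 0 = 81 ∧ cntN 1 = 324 ∧ cntN 2 = 594 ∧ cntN 3 = 648 ∧ cntN 4 = 675 ∧
   cntN 5 = 648 ∧ cntN 6 = 594 ∧ cntN 7 = 324 ∧ cntN 8 = 81 := by
  decide +kernel

theorem toZMod_zero_iff_s12 {p : ℕ} [Fact p.Prime] (z : ℤ_[p]) :
    PadicInt.toZMod z = 0 ↔ ‖z‖ < 1 := by
  rw [← RingHom.mem_ker, PadicInt.ker_toZMod, IsLocalRing.mem_maximalIdeal, PadicInt.mem_nonunits]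

/-- Representative of the `n`-th class of nonzero elements modulo cubes, `n < 9`. -/
noncomputable def rep {p : ℕ} [Fact p.Prime] (u : ℤ_[p]) (n : ℕ) : ℤ_[p] :=
  (p : ℤ_[p]) ^ (n / 3) * u ^ (n % 3)

/-- The nonzero integers in the `n`-th class modulo cubes. -/
def clsSet {p : ℕ} [Fact p.Prime] (u : ℤ_[p]) (n : ℕ) : Set ℤ_[p] :=
  {a | a ≠ 0 ∧ ∃ y : ℤ_[p], a = rep u n * y ^ 3}

section
variable {p : ℕ} [Fact p.Prime] {u : ℤ_[p]} 

theorem norm_u (hu : CubeGen p (PadicInt.toZMod u)) : ‖u‖ = 1 := by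
  apply le_antisymm (PadicInt.norm_le_one _)
  rw [← not_lt, ← toZMod_zero_iff_s12]
  exact hu.ne

theorem rep_ne_zero (hu : CubeGen p (PadicInt.toZMod u)) (n : ℕ) : rep u n ≠ 0 := by
  have : u ≠ 0 := by
    intro h; have := norm_u hu; simp [h] at this
  have hp : (p : ℤ_[p]) ≠ 0 := by exact_mod_cast (Fact.out : p.Prime).ne_zero
  exact mul_ne_zero (pow_ne_zero _ hp) (pow_ne_zero _ this)

theorem exists_cls (hp : p % 3 = 1) (hu : CubeGen p (PadicInt.toZMod u)) (a : ℤ_[p]) (ha : a ≠ 0) :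
    ∃ n < 9, a ∈ clsSet u n := by
  have hs := PadicInt.unitCoeff_spec ha
  set w := PadicInt.unitCoeff ha
  set v := a.valuation
  have hw : PadicInt.toZMod (w : ℤ_[p]) ≠ 0 := by
    rw [Ne, toZMod_zero_iff_s12]; simp
  obtain ⟨c, hc, r, hr, h⟩ := hu.ex _ hw
  have hU : IsUnit u := PadicInt.isUnit_iff.2 (norm_u hu)
  obtain ⟨U, rfl⟩ := hU
  have : PadicInt.toZMod ((w : ℤ_[p]) * ((U⁻¹ : ℤ_[p]ˣ) : ℤ_[p]) ^ c) = r ^ 3 := by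
    have hinv : PadicInt.toZMod (U : ℤ_[p]) * PadicInt.toZMod ((U⁻¹ : ℤ_[p]ˣ) : ℤ_[p]) = 1 := by
      rw [← map_mul]; simp
    rw [map_mul, map_pow, h]
    calc _ = (PadicInt.toZMod (U : ℤ_[p]) * PadicInt.toZMod ((U⁻¹ : ℤ_[p]ˣ) : ℤ_[p])) ^ c * r ^ 3 := by
          ring
      _ = _ := by rw [hinv]; ring
  obtain ⟨y, hy⟩ := padicInt_cube hp _ r hr this
  have hw2 : (w : ℤ_[p]) = (U : ℤ_[p]) ^ c * y ^ 3 := by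
    rw [← hy]
    have : (U : ℤ_[p]) ^ c * ((U⁻¹ : ℤ_[p]ˣ) : ℤ_[p]) ^ c = 1 := by
      rw [← mul_pow]; simp
    linear_combination (-(w : ℤ_[p])) * this
  refine ⟨3 * (v % 3) + c, by omega, ha, (p : ℤ_[p]) ^ (v / 3) * y, ?_⟩
  have h1 : (3 * (v % 3) + c) / 3 = v % 3 := by omega
  have h2 : (3 * (v % 3) + c) % 3 = c := by omega
  have h3 : (p : ℤ_[p]) ^ v = (p : ℤ_[p]) ^ (v % 3) * ((p : ℤ_[p]) ^ (v / 3)) ^ 3 := by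
    rw [← pow_mul, ← pow_add]; congr 1; omega
  rw [rep, h1, h2, hs, hw2, h3]
  ring

theorem norm_rep_mul (hu : CubeGen p (PadicInt.toZMod u)) (n : ℕ) (X : ℚ_[p]) (hX : X ≠ 0) :
    ‖(rep u n : ℚ_[p]) * X ^ 3‖ = (p : ℝ) ^ (-((n / 3 : ℕ) : ℤ) - 3 * X.valuation) := by
  have hp0 : (p : ℝ) ≠ 0 := by exact_mod_cast (Fact.out : p.Prime).ne_zero
  have hu1 : ‖(u : ℚ_[p])‖ = 1 := by simpa using norm_u hu
  rw [rep]
  generalize n / 3 = k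
  push_cast
  rw [norm_mul, norm_mul, norm_pow, norm_pow, norm_pow, hu1, Padic.norm_eq_zpow_neg_valuation hX,
    Padic.norm_p, one_pow, mul_one, sub_eq_add_neg, zpow_add₀ hp0]
  congr 1
  · rw [zpow_neg, inv_pow, zpow_natCast]
  · rw [← zpow_natCast, ← zpow_mul]; congr 1; push_cast; ring

theorem cls_div (hu : CubeGen p (PadicInt.toZMod u)) {n m : ℕ} (hn : n < 9) (hm : m < 9)
    {X Y : ℚ_[p]} (hX : X ≠ 0) (hY : Y ≠ 0)
    (h : ‖(rep u n : ℚ_[p]) * X ^ 3‖ = ‖(rep u m : ℚ_[p]) * Y ^ 3‖) :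
    n / 3 = m / 3 ∧ X.valuation = Y.valuation := by
  rw [norm_rep_mul hu n X hX, norm_rep_mul hu m Y hY] at h
  have hp1 : 1 < (p : ℝ) := by exact_mod_cast (Fact.out : p.Prime).one_lt
  have := zpow_right_injective₀ (by linarith) hp1.ne' h
  omega

theorem cls_eq (hu : CubeGen p (PadicInt.toZMod u)) {n m : ℕ} (hn : n < 9) (hm : m < 9)
    {X Y : ℚ_[p]} (hX : X ≠ 0) (hY : Y ≠ 0)
    (h : ‖(rep u n : ℚ_[p]) * X ^ 3‖ = ‖(rep u m : ℚ_[p]) * Y ^ 3‖)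
    (h2 : ‖(rep u n : ℚ_[p]) * X ^ 3 + (rep u m : ℚ_[p]) * Y ^ 3‖
      < ‖(rep u m : ℚ_[p]) * Y ^ 3‖) : n = m := by
  obtain ⟨hd, hv⟩ := cls_div hu hn hm hX hY h
  have hu1 : ‖(u : ℚ_[p])‖ = 1 := by simpa using norm_u hu
  have hr : ‖X / Y‖ = 1 := by
    rw [norm_div, Padic.norm_eq_zpow_neg_valuation hX, Padic.norm_eq_zpow_neg_valuation hY, hv]
    apply div_self
    apply zpow_ne_zero
    exact_mod_cast (Fact.out : p.Prime).ne_zero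
  let r : ℤ_[p] := ⟨X / Y, hr.le⟩
  have hr1 : ‖r‖ = 1 := hr
  have hXr : X = (r : ℚ_[p]) * Y := by
    simp only [r]; field_simp
  have hp0 : (p : ℚ_[p]) ≠ 0 := by exact_mod_cast (Fact.out : p.Prime).ne_zero
  have hlt : ‖u ^ (n % 3) * r ^ 3 + u ^ (m % 3)‖ < 1 := by
    have e1 : (rep u n : ℚ_[p]) * X ^ 3 + (rep u m : ℚ_[p]) * Y ^ 3 =
        ((u ^ (n % 3) * r ^ 3 + u ^ (m % 3) : ℤ_[p]) : ℚ_[p]) * ((p : ℚ_[p]) ^ (m / 3) * Y ^ 3) := by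
      rw [rep, rep, hd, hXr]; push_cast; ring
    have e2 : ‖(rep u m : ℚ_[p]) * Y ^ 3‖ = ‖(p : ℚ_[p]) ^ (m / 3) * Y ^ 3‖ := by
      rw [rep]; push_cast; simp only [norm_mul, norm_pow, hu1, one_pow, mul_one]
    rw [e1, e2, norm_mul] at h2
    have pos : 0 < ‖(p : ℚ_[p]) ^ (m / 3) * Y ^ 3‖ :=
      norm_pos_iff.2 (mul_ne_zero (pow_ne_zero _ hp0) (pow_ne_zero _ hY))
    have := (mul_lt_iff_lt_one_left pos).1 h2
    rwa [PadicInt.norm_def]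
  rw [← toZMod_zero_iff_s12] at hlt
  simp only [map_add, map_mul, map_pow] at hlt
  have hrz : PadicInt.toZMod r ≠ 0 := by
    rw [Ne, toZMod_zero_iff_s12, hr1]; simp
  have := hu.uniq (n % 3) (m % 3) (Nat.mod_lt _ (by norm_num)) (Nat.mod_lt _ (by norm_num))
    (PadicInt.toZMod r) (-1) hrz (by simp) (by linear_combination hlt)
  omega

theorem cls_disj (hu : CubeGen p (PadicInt.toZMod u)) {n m : ℕ} (hn : n < 9) (hm : m < 9)
    {a : ℤ_[p]} (h1 : a ∈ clsSet u n) (h2 : a ∈ clsSet u m) : n = m := by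
  obtain ⟨ha, y, hy⟩ := h1
  obtain ⟨-, z, hz⟩ := h2
  have hy0 : y ≠ 0 := by rintro rfl; simp at hy; exact ha hy
  have hz0 : z ≠ 0 := by rintro rfl; simp at hz; exact ha hz
  have e1 : (rep u n : ℚ_[p]) * (y : ℚ_[p]) ^ 3 = a := by rw [hy]; push_cast; rfl
  have e2 : (rep u m : ℚ_[p]) * (-(z : ℚ_[p])) ^ 3 = -a := by rw [hz]; push_cast; ring
  apply cls_eq hu hn hm (X := (y : ℚ_[p])) (Y := -(z : ℚ_[p]))
  · simpa using hy0
  · simpa using hz0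
  · rw [e1, e2, norm_neg]
  · rw [e1, e2]; simpa using ha
end

/-- Combinatorial criterion on classes for solvability. -/
def GoodT (T : Fin 4 → ℕ) : Prop :=
  (∃ i k, i ≠ k ∧ T i = T k) ∨
    (∃ i k l, i ≠ k ∧ i ≠ l ∧ k ≠ l ∧ T i / 3 = T k / 3 ∧ T i / 3 = T l / 3)

theorem goodB_iff (a b c d : ℕ) : goodB a b c d = true ↔ GoodT ![a, b, c, d] := by
  have hb : ∀ x y : ℕ, x.beq y = true ↔ x = y := fun x y => Nat.beq_eq ▸ Iff.rfl
  simp only [goodB, GoodT, Bool.or_eq_true, Bool.and_eq_true, hb]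
  constructor
  · rintro ((((((h | h) | h) | h) | h) | h) | (⟨h, h' | h'⟩ | ⟨h, h' | h'⟩))
    · exact Or.inl ⟨0, 1, by decide, h⟩
    · exact Or.inl ⟨0, 2, by decide, h⟩
    · exact Or.inl ⟨0, 3, by decide, h⟩
    · exact Or.inl ⟨1, 2, by decide, h⟩
    · exact Or.inl ⟨1, 3, by decide, h⟩
    · exact Or.inl ⟨2, 3, by decide, h⟩
    · exact Or.inr ⟨0, 1, 2, by decide, by decide, by decide, h, h'⟩
    · exact Or.inr ⟨0, 1, 3, by decide, by decide, by decide, h, h'⟩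
    · exact Or.inr ⟨0, 2, 3, by decide, by decide, by decide, h', h'.trans h⟩
    · exact Or.inr ⟨1, 2, 3, by decide, by decide, by decide, h', h'.trans h⟩
  · rintro (⟨i, k, h1, h⟩ | ⟨i, k, l, h1, h2, h3, h, h'⟩)
    · left
      fin_cases i <;> fin_cases k <;> simp at h h1 <;> omega
    · right
      fin_cases i <;> fin_cases k <;> first | (exfalso; exact h1 rfl) | skip
      all_goals fin_cases l <;> first | (exfalso; exact h2 rfl) | (exfalso; exact h3 rfl) | skip
      all_goals simp at h h'
      all_goals omega

section
variable {p : ℕ} [Fact p.Prime] {u : ℤ_[p]}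

theorem norm_sum_lt_of {ι : Type*} (s : Finset ι) (b : ι → ℚ_[p]) {M : ℝ} (hM : 0 < M)
    (h : ∀ i ∈ s, ‖b i‖ < M) : ‖∑ i ∈ s, b i‖ < M := by
  apply Finset.sum_induction b (fun z => ‖z‖ < M)
  · intro x y hx hy
    exact (IsUltrametricDist.norm_add_le_max x y).trans_lt (max_lt hx hy)
  · simpa using hM
  · exact h

theorem good_of_solv (hu : CubeGen p (PadicInt.toZMod u)) (T : Fin 4 → ℕ) (hT : ∀ i, T i < 9)
    (a : Fin 4 → ℤ_[p]) (ha : ∀ i, a i ∈ clsSet u (T i)) (x : Fin 4 → ℚ_[p]) (hx : x ≠ 0)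
    (h : ∑ i, (a i : ℚ_[p]) * x i ^ 3 = 0) : GoodT T := by
  by_contra hbad
  simp only [GoodT, not_or] at hbad
  obtain ⟨hA, hB⟩ := hbad
  choose ha0 y hy using ha
  have hy0 : ∀ i, y i ≠ 0 := by
    intro i h0
    have := hy i
    rw [h0] at this
    exact ha0 i (by simpa using this)
  set b : Fin 4 → ℚ_[p] := fun i => (a i : ℚ_[p]) * x i ^ 3 with hb
  have hbX : ∀ i, b i = (rep u (T i) : ℚ_[p]) * ((y i : ℚ_[p]) * x i) ^ 3 := by
    intro i
    have : (a i : ℚ_[p]) = (rep u (T i) : ℚ_[p]) * (y i : ℚ_[p]) ^ 3 := by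
      rw [hy i]; push_cast; rfl
    simp only [hb, this]; ring
  obtain ⟨i, -, hi⟩ := Finset.exists_max_image Finset.univ (fun i => ‖b i‖) Finset.univ_nonempty
  have hM : 0 < ‖b i‖ := by
    obtain ⟨k, hk⟩ := Function.ne_iff.1 hx
    have : b k ≠ 0 := mul_ne_zero (by simpa using ha0 k) (pow_ne_zero _ hk)
    exact (norm_pos_iff.2 this).trans_le (hi k (Finset.mem_univ _))
  have hX : ∀ k, ‖b k‖ = ‖b i‖ → (y k : ℚ_[p]) * x k ≠ 0 := by
    intro k hk h0
    rw [← hk, hbX, h0] at hM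
    simp at hM
  have hdiv : ∀ k, ‖b k‖ = ‖b i‖ → T k / 3 = T i / 3 := by
    intro k hk
    have h2 := hk
    rw [hbX, hbX] at h2
    exact (cls_div hu (hT k) (hT i) (hX k hk) (hX i rfl) h2).1
  have hlt : ∀ k, ‖b k‖ ≠ ‖b i‖ → ‖b k‖ < ‖b i‖ := fun k hk =>
    lt_of_le_of_ne (hi k (Finset.mem_univ _)) hk
  by_cases hk : ∃ k, k ≠ i ∧ ‖b k‖ = ‖b i‖
  · obtain ⟨k, hki, hk⟩ := hk
    have hs : b k + b i + ∑ l ∈ (Finset.univ.erase i).erase k, b l = 0 := by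
      rw [← h, ← Finset.add_sum_erase Finset.univ b (Finset.mem_univ i),
        ← Finset.add_sum_erase (Finset.univ.erase i) b
          (Finset.mem_erase.2 ⟨hki, Finset.mem_univ k⟩)]
      ring
    have hsm : ‖∑ l ∈ (Finset.univ.erase i).erase k, b l‖ < ‖b i‖ := by
      apply norm_sum_lt_of _ _ hM
      intro l hl
      simp only [Finset.mem_erase, Finset.mem_univ, and_true] at hl
      apply hlt
      intro hl'
      exact hB ⟨i, k, l, hki.symm, fun e => hl.2 e.symm, fun e => hl.1 e.symm,
        (hdiv k hk).symm, (hdiv l hl').symm⟩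
    have h3 : ‖b k + b i‖ < ‖b i‖ := by
      rw [eq_neg_of_add_eq_zero_left hs, norm_neg]; exact hsm
    have h4 := hk
    rw [hbX, hbX] at h3 h4
    exact hA ⟨k, i, hki, cls_eq hu (hT k) (hT i) (hX k hk) (hX i rfl) h4 h3⟩
  · push Not at hk
    have hs : b i + ∑ l ∈ Finset.univ.erase i, b l = 0 := by
      rw [← h, ← Finset.add_sum_erase Finset.univ b (Finset.mem_univ i)]
    have hsm : ‖∑ l ∈ Finset.univ.erase i, b l‖ < ‖b i‖ := by
      apply norm_sum_lt_of _ _ hM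
      intro l hl
      exact hlt l (hk l (Finset.mem_erase.1 hl).1)
    rw [eq_neg_of_add_eq_zero_right hs, norm_neg] at hsm
    exact lt_irrefl _ hsm

theorem exists_three (hp : p % 3 = 1) (hu : CubeGen p (PadicInt.toZMod u)) :
    ∃ X : ℕ → ℤ_[p], X 0 ≠ 0 ∧ X 0 ^ 3 + u * X 1 ^ 3 + u ^ 2 * X 2 ^ 3 = 0 := by
  obtain ⟨x, y, z, hx, h⟩ := hu.exists_sum
  obtain ⟨Y, rfl⟩ := ZMod.ringHom_surjective (PadicInt.toZMod (p := p)) y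
  obtain ⟨Z, rfl⟩ := ZMod.ringHom_surjective (PadicInt.toZMod (p := p)) z
  have e : PadicInt.toZMod (-(u * Y ^ 3 + u ^ 2 * Z ^ 3)) = x ^ 3 := by
    simp only [map_neg, map_add, map_mul, map_pow]
    linear_combination -h
  obtain ⟨X, hX⟩ := padicInt_cube hp _ x hx e
  refine ⟨fun n => if n = 0 then X else if n = 1 then Y else Z, ?_, ?_⟩
  · simp only [if_true]
    rintro rfl
    rw [hX] at e
    simp only [map_pow, map_zero] at e
    apply hx
    exact (pow_eq_zero_iff (n := 3) (by norm_num)).1 (by rw [← e]; ring)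
  · norm_num
    linear_combination -hX

theorem solv_two (a : Fin 4 → ℤ_[p]) (r y z : ℤ_[p]) (i k : Fin 4) (hik : i ≠ k)
    (ha : a i ≠ 0) (hi : a i = r * y ^ 3) (hk : a k = r * z ^ 3) :
    ∃ x : Fin 4 → ℚ_[p], x ≠ 0 ∧ ∑ i, (a i : ℚ_[p]) * x i ^ 3 = 0 := by
  have hy : y ≠ 0 := by rintro rfl; apply ha; rw [hi]; ring
  refine ⟨fun l => if l = k then -(y : ℚ_[p]) else if l = i then (z : ℚ_[p]) else 0, ?_, ?_⟩
  · rw [Function.ne_iff]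
    exact ⟨k, by simpa using hy⟩
  · rw [Finset.sum_eq_add i k hik]
    · simp only [if_neg hik, if_true, hi, hk]; push_cast; ring
    · intro l _ hl
      simp [hl.1, hl.2]
    · simp
    · simp

theorem solv_of_good (hp : p % 3 = 1) (hu : CubeGen p (PadicInt.toZMod u)) (T : Fin 4 → ℕ)
    (a : Fin 4 → ℤ_[p]) (ha : ∀ i, a i ∈ clsSet u (T i)) (hg : GoodT T) :
    ∃ x : Fin 4 → ℚ_[p], x ≠ 0 ∧ ∑ i, (a i : ℚ_[p]) * x i ^ 3 = 0 := by
  choose ha0 y hy using ha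
  have hy0 : ∀ i, y i ≠ 0 := by
    intro i h0
    have := hy i
    rw [h0] at this
    exact ha0 i (by simpa using this)
  have two : ∀ i k, i ≠ k → T i = T k →
      ∃ x : Fin 4 → ℚ_[p], x ≠ 0 ∧ ∑ i, (a i : ℚ_[p]) * x i ^ 3 = 0 := by
    intro i k hik hT
    exact solv_two a (rep u (T i)) (y i) (y k) i k hik (ha0 i) (hy i) (by rw [hT]; exact hy k)
  rcases hg with ⟨i, k, hik, hT⟩ | ⟨i, k, l, hik, hil, hkl, h1, h2⟩
  · exact two i k hik hT
  · by_cases hA : T i = T k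
    · exact two i k hik hA
    by_cases hB : T i = T l
    · exact two i l hil hB
    by_cases hC : T k = T l
    · exact two k l hkl hC
    obtain ⟨X, hX0, hX⟩ := exists_three hp hu
    have hXq : (X 0 : ℚ_[p]) ^ 3 + (u : ℚ_[p]) * (X 1 : ℚ_[p]) ^ 3
        + (u : ℚ_[p]) ^ 2 * (X 2 : ℚ_[p]) ^ 3 = 0 := by
      exact_mod_cast congrArg (fun z : ℤ_[p] => (z : ℚ_[p])) hX
    refine ⟨fun m => if m = i ∨ m = k ∨ m = l then (X (T m % 3) : ℚ_[p]) / (y m : ℚ_[p]) else 0,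
      ?_, ?_⟩
    · rw [Function.ne_iff]
      have hmod : T i % 3 = 0 ∨ T k % 3 = 0 ∨ T l % 3 = 0 := by omega
      have : ∃ m, (m = i ∨ m = k ∨ m = l) ∧ T m % 3 = 0 := by
        rcases hmod with h | h | h
        · exact ⟨i, by simp, h⟩
        · exact ⟨k, by simp, h⟩
        · exact ⟨l, by simp, h⟩
      obtain ⟨m, hm, hm0⟩ := this
      refine ⟨m, ?_⟩
      simp only [if_pos hm, hm0]
      exact div_ne_zero (by simpa using hX0) (by simpa using hy0 m)
    · have hterm : ∀ m, T m / 3 = T i / 3 → (a m : ℚ_[p]) * ((X (T m % 3) : ℚ_[p]) / (y m : ℚ_[p])) ^ 3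
          = (p : ℚ_[p]) ^ (T i / 3) * ((u : ℚ_[p]) ^ (T m % 3) * (X (T m % 3) : ℚ_[p]) ^ 3) := by
        intro m hm
        have hym : (y m : ℚ_[p]) ≠ 0 := by simpa using hy0 m
        rw [show (a m : ℚ_[p]) = (rep u (T m) : ℚ_[p]) * (y m : ℚ_[p]) ^ 3 by
          rw [hy m]; push_cast; rfl, rep, hm]
        push_cast
        field_simp
      have hsub : ∑ m ∈ ({i, k, l} : Finset (Fin 4)), (a m : ℚ_[p]) *
          (if m = i ∨ m = k ∨ m = l then (X (T m % 3) : ℚ_[p]) / (y m : ℚ_[p]) else 0) ^ 3 =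
          ∑ m, (a m : ℚ_[p]) *
          (if m = i ∨ m = k ∨ m = l then (X (T m % 3) : ℚ_[p]) / (y m : ℚ_[p]) else 0) ^ 3 := by
        apply Finset.sum_subset (Finset.subset_univ _)
        intro m _ hm
        rw [if_neg (by simpa using hm)]
        simp
      rw [← hsub, Finset.sum_insert (by simp [hik, hil]), Finset.sum_insert (by simp [hkl]),
        Finset.sum_singleton, if_pos (by simp), if_pos (by simp), if_pos (by simp),
        hterm i rfl, hterm k h1.symm, hterm l h2.symm, ← mul_add, ← mul_add]
      apply mul_eq_zero_of_right
      have q1 : T i % 3 ≠ T k % 3 := by omega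
      have q2 : T i % 3 ≠ T l % 3 := by omega
      have q3 : T k % 3 ≠ T l % 3 := by omega
      have r1 : T i % 3 < 3 := Nat.mod_lt _ (by norm_num)
      have r2 : T k % 3 < 3 := Nat.mod_lt _ (by norm_num)
      have r3 : T l % 3 < 3 := Nat.mod_lt _ (by norm_num)
      generalize T i % 3 = α at *
      generalize T k % 3 = β at *
      generalize T l % 3 = γ at *
      clear hterm hsub two
      interval_cases α <;> interval_cases β <;> first | (exfalso; exact q1 rfl) | skip
      all_goals interval_cases γ <;>
        first | (exfalso; exact q2 rfl) | (exfalso; exact q3 rfl) | linear_combination hXq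
end

section
variable {p : ℕ} [Fact p.Prime] {u : ℤ_[p]}

theorem scale_embedding (e : ℤ_[p]) (he : e ≠ 0) :
    Topology.IsClosedEmbedding (fun x : ℤ_[p] => e * x) :=
  (continuous_const.mul continuous_id).isClosedEmbedding (mul_right_injective₀ he)

/-- Multiplication by `e` scales the Haar measure by the measure of the image. -/
theorem scale_measure (ν : Measure ℤ_[p]) [ν.IsAddHaarMeasure] [IsProbabilityMeasure ν]
    (e : ℤ_[p]) (he : e ≠ 0) (s : Set ℤ_[p]) :
    ν ((fun x => e * x) '' s) = ν (Set.range fun x => e * x) * ν s := by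
  have hemb := (scale_embedding e he).measurableEmbedding
  have hinv : (ν.comap (fun x => e * x)).IsAddLeftInvariant :=
    Measure.IsAddLeftInvariant.comap ν (f := AddMonoidHom.mulLeft e) hemb
  have hfin : IsFiniteMeasure (ν.comap (fun x => e * x)) := by
    constructor
    rw [hemb.comap_apply]
    exact measure_lt_top _ _
  have h := Measure.isAddInvariant_eq_smul_of_compactSpace (ν.comap (fun x => e * x)) ν
  have h1 := congrArg (fun m : Measure ℤ_[p] => m s) h
  have h2 := congrArg (fun m : Measure ℤ_[p] => m Set.univ) h
  simp only [hemb.comap_apply, Measure.smul_apply, measure_univ, Set.image_univ] at h1 h2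
  rw [h1, h2]
  simp [ENNReal.smul_def]

theorem scale_unit (ν : Measure ℤ_[p]) [ν.IsAddHaarMeasure] [IsProbabilityMeasure ν]
    (e : ℤ_[p]) (he : IsUnit e) (s : Set ℤ_[p]) :
    ν ((fun x => e * x) '' s) = ν s := by
  rw [scale_measure ν e he.ne_zero]
  have : (Set.range fun x => e * x) = Set.univ := by
    rw [Set.range_eq_univ]
    intro y
    obtain ⟨U, rfl⟩ := he
    exact ⟨(U⁻¹ : ℤ_[p]ˣ) * y, by simp⟩
  rw [this, measure_univ, one_mul]

theorem measure_range_p (ν : Measure ℤ_[p]) [ν.IsAddHaarMeasure] [IsProbabilityMeasure ν] :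
    ν.real (Set.range fun x : ℤ_[p] => (p : ℤ_[p]) * x) = (p : ℝ)⁻¹ := by
  have hp0 : (p : ℤ_[p]) ≠ 0 := by exact_mod_cast (Fact.out : p.Prime).ne_zero
  let H : AddSubgroup ℤ_[p] := (PadicInt.toZMod (p := p)).toAddMonoidHom.ker
  have hH : (H : Set ℤ_[p]) = Set.range fun x : ℤ_[p] => (p : ℤ_[p]) * x := by
    ext z
    have : z ∈ H ↔ z ∈ RingHom.ker (PadicInt.toZMod (p := p)) := Iff.rfl
    rw [SetLike.mem_coe, this, PadicInt.ker_toZMod, PadicInt.maximalIdeal_eq_span_p,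
      Ideal.mem_span_singleton]
    constructor
    · rintro ⟨y, rfl⟩; exact ⟨y, rfl⟩
    · rintro ⟨y, rfl⟩; exact ⟨y, rfl⟩
  have hi : H.index = p := by
    have h1 : H.index = _ := AddSubgroup.index_ker (PadicInt.toZMod (p := p)).toAddMonoidHom
    have h2 : (PadicInt.toZMod (p := p)).toAddMonoidHom.range = ⊤ := by
      rw [AddMonoidHom.range_eq_top]
      exact ZMod.ringHom_surjective (PadicInt.toZMod (p := p))
    rw [h1, h2]
    simp
  have hfi : H.FiniteIndex := ⟨by rw [hi]; exact (Fact.out : p.Prime).ne_zero⟩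
  have hm : MeasurableSet (H : Set ℤ_[p]) := by
    rw [hH]; exact (scale_embedding _ hp0).isClosed_range.measurableSet
  have := AddSubgroup.index_mul_measure H hm ν
  rw [hi, hH, measure_univ] at this
  have h2 := congrArg ENNReal.toReal this
  simp only [ENNReal.toReal_mul, ENNReal.toReal_natCast, ENNReal.toReal_one] at h2
  exact eq_inv_of_mul_eq_one_right h2

theorem scale_p (ν : Measure ℤ_[p]) [ν.IsAddHaarMeasure] [IsProbabilityMeasure ν]
    (s : Set ℤ_[p]) :
    ν.real ((fun x => (p : ℤ_[p]) * x) '' s) = (p : ℝ)⁻¹ * ν.real s := by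
  have hp0 : (p : ℤ_[p]) ≠ 0 := by exact_mod_cast (Fact.out : p.Prime).ne_zero
  rw [← measure_range_p ν, measureReal_def, scale_measure ν _ hp0, ENNReal.toReal_mul]
  rfl

theorem scale_p_pow (ν : Measure ℤ_[p]) [ν.IsAddHaarMeasure] [IsProbabilityMeasure ν]
    (j : ℕ) (s : Set ℤ_[p]) :
    ν.real ((fun x => (p : ℤ_[p]) ^ j * x) '' s) = (p : ℝ)⁻¹ ^ j * ν.real s := by
  induction j with
  | zero => simp
  | succ j ih =>
    rw [pow_succ' _ j, pow_succ' _ j, mul_assoc, ← ih, ← scale_p, Set.image_image]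
    simp only [mul_assoc]

theorem clsSet_eq (hu : CubeGen p (PadicInt.toZMod u)) (n : ℕ) :
    clsSet u n = (fun x => (p : ℤ_[p]) ^ (n / 3) * x) '' ((fun x => u ^ (n % 3) * x) ''
      clsSet u 0) := by
  have hr := rep_ne_zero hu n
  rw [Set.image_image]
  ext a
  constructor
  · rintro ⟨ha, y, hy⟩
    refine ⟨y ^ 3, ⟨?_, y, by simp [rep]⟩, ?_⟩
    · intro h; apply ha; rw [hy, h, mul_zero]
    · rw [hy, rep]; ring
  · rintro ⟨b, ⟨hb, y, hy⟩, rfl⟩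
    have e : (p : ℤ_[p]) ^ (n / 3) * (u ^ (n % 3) * b) = rep u n * b := by rw [rep]; ring
    refine ⟨?_, y, ?_⟩
    · simp only [e]; exact mul_ne_zero hr hb
    · simp only [e]; rw [hy]; simp [rep]

theorem clsSet_measurable (n : ℕ) : MeasurableSet (clsSet u n) := by
  have h : clsSet u n = (Set.range fun y : ℤ_[p] => rep u n * y ^ 3) \ {0} := by
    ext a
    constructor
    · rintro ⟨ha, y, hy⟩; exact ⟨⟨y, hy.symm⟩, ha⟩
    · rintro ⟨⟨y, hy⟩, ha⟩; exact ⟨ha, y, hy.symm⟩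
  rw [h]
  have hc : Continuous fun y : ℤ_[p] => rep u n * y ^ 3 := by fun_prop
  exact (isCompact_range hc).isClosed.measurableSet.diff (measurableSet_singleton 0)

theorem measure_cls_aux (ν : Measure ℤ_[p]) [ν.IsAddHaarMeasure] [IsProbabilityMeasure ν]
    (hu : CubeGen p (PadicInt.toZMod u)) (n : ℕ) :
    ν.real (clsSet u n) = (p : ℝ)⁻¹ ^ (n / 3) * ν.real (clsSet u 0) := by
  have hU : IsUnit u := PadicInt.isUnit_iff.2 (norm_u hu)
  rw [clsSet_eq hu n, scale_p_pow, measureReal_def, scale_unit ν _ (hU.pow _)]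
  rfl

theorem measure_zero (ν : Measure ℤ_[p]) [ν.IsAddHaarMeasure] [IsProbabilityMeasure ν] :
    ν.real {0} = 0 := by
  have h := scale_p ν {0}
  simp only [Set.image_singleton, mul_zero] at h
  have hp : (1 : ℝ) < p := by exact_mod_cast (Fact.out : p.Prime).one_lt
  have : (p : ℝ)⁻¹ < 1 := inv_lt_one_of_one_lt₀ hp
  by_contra h0
  have h1 : (p : ℝ)⁻¹ = 1 := by
    apply mul_right_cancel₀ h0
    rw [one_mul]; exact h.symm
  linarith

theorem measure_cls (ν : Measure ℤ_[p]) [ν.IsAddHaarMeasure] [IsProbabilityMeasure ν]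
    (hp : p % 3 = 1) (hu : CubeGen p (PadicInt.toZMod u)) (n : ℕ) :
    ν.real (clsSet u n) = (p : ℝ)⁻¹ ^ (n / 3) * (3 * (1 + (p : ℝ)⁻¹ + (p : ℝ)⁻¹ ^ 2))⁻¹ := by
  rw [measure_cls_aux ν hu n]
  congr 1
  have huniv : ({0} ∪ ⋃ n ∈ Finset.range 9, clsSet u n : Set ℤ_[p]) = Set.univ := by
    rw [Set.eq_univ_iff_forall]
    intro a
    by_cases ha : a = 0
    · left; exact ha
    · right
      obtain ⟨n, hn, h⟩ := exists_cls hp hu a ha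
      exact Set.mem_biUnion (Finset.mem_coe.2 (Finset.mem_range.2 hn)) h
  have h1 : ν.real (⋃ n ∈ Finset.range 9, clsSet u n) = 1 := by
    apply le_antisymm measureReal_le_one
    have := measureReal_union_le (μ := ν) {0} (⋃ n ∈ Finset.range 9, clsSet u n)
    rw [huniv, measure_zero, zero_add, probReal_univ] at this
    exact this
  rw [measureReal_biUnion_finset _ (fun n _ => clsSet_measurable n)] at h1
  · simp only [Finset.sum_range_succ, Finset.sum_range_zero, measure_cls_aux ν hu 1,
      measure_cls_aux ν hu 2, measure_cls_aux ν hu 3, measure_cls_aux ν hu 4,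
      measure_cls_aux ν hu 5, measure_cls_aux ν hu 6, measure_cls_aux ν hu 7,
      measure_cls_aux ν hu 8] at h1
    norm_num at h1
    apply eq_inv_of_mul_eq_one_right
    linear_combination h1
  · intro n hn m hm hnm
    rw [Function.onFun, Set.disjoint_left]
    intro a h1 h2
    exact hnm (cls_disj hu (Finset.mem_range.1 hn) (Finset.mem_range.1 hm) h1 h2)

end

theorem cond_one (b : Bool) : cond b (1 : ℕ) 0 = if b = true then 1 else 0 := by cases b <;> rfl

/-- The weighted count of good class quadruples. -/
theorem sum_good (t : ℝ) :
    ∑ a ∈ Finset.range 9, ∑ b ∈ Finset.range 9, ∑ c ∈ Finset.range 9, ∑ d ∈ Finset.range 9,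
      (if goodB a b c d = true then t ^ (a / 3) * t ^ (b / 3) * t ^ (c / 3) * t ^ (d / 3) else 0)
    = 81 + 324 * t + 594 * t ^ 2 + 648 * t ^ 3 + 675 * t ^ 4 + 648 * t ^ 5 + 594 * t ^ 6
      + 324 * t ^ 7 + 81 * t ^ 8 := by
  have key : ∑ a ∈ Finset.range 9, ∑ b ∈ Finset.range 9, ∑ c ∈ Finset.range 9,
      ∑ d ∈ Finset.range 9,
      (if goodB a b c d = true then t ^ (a / 3) * t ^ (b / 3) * t ^ (c / 3) * t ^ (d / 3) else 0)
      = ∑ s ∈ Finset.range 9, (cntN s : ℝ) * t ^ s := by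
    simp only [cntN, sumN_eq, Nat.cast_sum, Finset.sum_mul]
    rw [Finset.sum_comm]
    conv_rhs => rw [Finset.sum_comm]
    rw [Finset.sum_comm]
    refine Finset.sum_congr rfl fun a ha => ?_
    conv_rhs => rw [Finset.sum_comm]
    refine Finset.sum_congr rfl fun b hb => ?_
    conv_rhs => rw [Finset.sum_comm]
    refine Finset.sum_congr rfl fun c hc => ?_
    conv_rhs => rw [Finset.sum_comm]
    refine Finset.sum_congr rfl fun d hd => ?_
    rw [Finset.mem_range] at ha hb hc hd
    cases goodB a b c d
    · simp
    · rw [Finset.sum_eq_single (a / 3 + b / 3 + c / 3 + d / 3)]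
      · simp [pow_add]
      · intro s _ hs
        have : Nat.beq (a / 3 + b / 3 + c / 3 + d / 3) s = false := by
          rw [Bool.eq_false_iff]
          intro h
          exact hs (Nat.eq_of_beq_eq_true h).symm
        simp [this]
      · intro h
        exfalso
        apply h
        rw [Finset.mem_range]
        omega
  rw [key]
  obtain ⟨h0, h1, h2, h3, h4, h5, h6, h7, h8⟩ := cntN_eq
  simp only [Finset.sum_range_succ, Finset.sum_range_zero, h0, h1, h2, h3, h4, h5, h6, h7, h8]
  push_cast
  ring

/-- For a prime `p ≡ 1 (mod 3)`, the density of coefficient vectors `a ∈ ℤ_p⁴` for which the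
diagonal cubic surface `S_a : a₀x₀³ + a₁x₁³ + a₂x₂³ + a₃x₃³ = 0` has a `ℚ_p`-point is
`[(1 − 1/p)³/(1 − 1/p³)³] · (1 − 1/p + 1/p²) · (1 + 1/p + 1/(3p²)) · (1 + 3/p + 3/p²)`,
where `μ` is the Haar measure on `ℤ_p⁴` normalized so that `μ(ℤ_p⁴) = 1`. -/
theorem density_diagonal_cubic_solvable_one_mod_three (p : ℕ) [Fact p.Prime] (hp : p % 3 = 1)
    (μ : Measure (Fin 4 → ℤ_[p])) [μ.IsAddHaarMeasure] (hμ : μ Set.univ = 1) :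
    (μ {a : Fin 4 → ℤ_[p] | ∃ x : Fin 4 → ℚ_[p], x ≠ 0 ∧
        (a 0 : ℚ_[p]) * x 0 ^ 3 + (a 1 : ℚ_[p]) * x 1 ^ 3 + (a 2 : ℚ_[p]) * x 2 ^ 3
          + (a 3 : ℚ_[p]) * x 3 ^ 3 = 0}).toReal
      = ((1 - 1 / (p : ℝ)) ^ 3 / (1 - 1 / (p : ℝ) ^ 3) ^ 3)
        * (1 - 1 / (p : ℝ) + 1 / (p : ℝ) ^ 2)
        * (1 + 1 / (p : ℝ) + 1 / (3 * (p : ℝ) ^ 2))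
        * (1 + 3 / (p : ℝ) + 3 / (p : ℝ) ^ 2) := by
  classical
  have hprob : IsProbabilityMeasure μ := ⟨hμ⟩
  obtain ⟨g, hg⟩ := exists_cubeGen p hp
  obtain ⟨u, rfl⟩ := ZMod.ringHom_surjective (PadicInt.toZMod (p := p)) g
  let K : TopologicalSpace.PositiveCompacts ℤ_[p] := ⟨⟨Set.univ, isCompact_univ⟩, by simp⟩
  let ν : Measure ℤ_[p] := Measure.addHaarMeasure K
  have hν : IsProbabilityMeasure ν := ⟨Measure.addHaarMeasure_self (K₀ := K)⟩
  have hμν : μ = Measure.pi (fun _ : Fin 4 => ν) :=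
    Measure.isAddHaarMeasure_eq_of_isProbabilityMeasure _ _
  set S := {a : Fin 4 → ℤ_[p] | ∃ x : Fin 4 → ℚ_[p], x ≠ 0 ∧
        (a 0 : ℚ_[p]) * x 0 ^ 3 + (a 1 : ℚ_[p]) * x 1 ^ 3 + (a 2 : ℚ_[p]) * x 2 ^ 3
          + (a 3 : ℚ_[p]) * x 3 ^ 3 = 0} with hS
  have memS : ∀ a, a ∈ S ↔ ∃ x : Fin 4 → ℚ_[p], x ≠ 0 ∧ ∑ i, (a i : ℚ_[p]) * x i ^ 3 = 0 := by
    intro a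
    simp only [hS, Set.mem_ofPred_eq, Fin.sum_univ_four]
  let box : (ℕ × ℕ × ℕ × ℕ) → Set (Fin 4 → ℤ_[p]) := fun q =>
    Set.univ.pi fun i => clsSet u (![q.1, q.2.1, q.2.2.1, q.2.2.2] i)
  let R : Finset (ℕ × ℕ × ℕ × ℕ) :=
    Finset.range 9 ×ˢ Finset.range 9 ×ˢ Finset.range 9 ×ˢ Finset.range 9
  let G := R.filter fun q => goodB q.1 q.2.1 q.2.2.1 q.2.2.2 = true
  have hRlt : ∀ q ∈ R, ∀ i, ![q.1, q.2.1, q.2.2.1, q.2.2.2] i < 9 := by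
    intro q hq i
    simp only [R, Finset.mem_product, Finset.mem_range] at hq
    obtain ⟨h0, h1, h2, h3⟩ := hq
    fin_cases i <;> assumption
  have hnull : ∀ i : Fin 4, μ {a | a i = 0} = 0 := by
    intro i
    have h0 : ν {0} = 0 := by
      have := measure_zero ν
      rwa [measureReal_def, ENNReal.toReal_eq_zero_iff, or_iff_left (measure_ne_top _ _)] at this
    have hpre : {a : Fin 4 → ℤ_[p] | a i = 0} = Function.eval i ⁻¹' {0} := rfl
    rw [hpre, hμν]
    exact (Measure.quasiMeasurePreserving_eval (fun _ : Fin 4 => ν) i).preimage_null h0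
  have hae : S =ᵐ[μ] ⋃ q ∈ G, box q := by
    have hnz : ∀ᵐ a ∂μ, ∀ i, a i ≠ 0 := by
      rw [ae_all_iff]
      intro i
      rw [ae_iff]
      simpa using hnull i
    filter_upwards [hnz] with a ha
    apply propext
    change a ∈ S ↔ a ∈ ⋃ q ∈ G, box q
    rw [memS, Set.mem_iUnion₂]
    constructor
    · rintro ⟨x, hx, h⟩
      choose T hT hTa using fun i => exists_cls hp hg (a i) (ha i)
      have hTe : ![T 0, T 1, T 2, T 3] = T := by
        ext i; fin_cases i <;> rfl
      refine ⟨(T 0, T 1, T 2, T 3), ?_, ?_⟩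
      · rw [Finset.mem_filter]
        refine ⟨by simp [R, hT], ?_⟩
        rw [goodB_iff]
        simp only [hTe]
        exact good_of_solv hg T hT a hTa x hx h
      · rw [Set.mem_univ_pi]
        simp only [hTe]
        exact hTa
    · rintro ⟨q, hq, hb⟩
      rw [Finset.mem_filter, goodB_iff] at hq
      rw [Set.mem_univ_pi] at hb
      exact solv_of_good hp hg _ a hb hq.2
  rw [measure_congr hae]
  change μ.real _ = _
  have hdis : Set.PairwiseDisjoint (G : Set (ℕ × ℕ × ℕ × ℕ)) box := by
    intro q hq q' hq' hne
    rw [Function.onFun, Set.disjoint_left]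
    intro a h1 h2
    apply hne
    rw [Set.mem_univ_pi] at h1 h2
    have hq := (Finset.mem_filter.1 (Finset.mem_coe.1 hq)).1
    have hq' := (Finset.mem_filter.1 (Finset.mem_coe.1 hq')).1
    have e := fun i => cls_disj hg (hRlt q hq i) (hRlt q' hq' i) (h1 i) (h2 i)
    have e0 := e 0
    have e1 := e 1
    have e2 := e 2
    have e3 := e 3
    simp at e0 e1 e2 e3
    ext <;> assumption
  rw [measureReal_biUnion_finset hdis
    (fun q _ => MeasurableSet.univ_pi fun i => clsSet_measurable _)]
  set t : ℝ := (p : ℝ)⁻¹ with ht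
  have hbox : ∀ q, μ.real (box q) = (t ^ (q.1 / 3) * t ^ (q.2.1 / 3) * t ^ (q.2.2.1 / 3)
      * t ^ (q.2.2.2 / 3)) * ((3 * (1 + t + t ^ 2))⁻¹) ^ 4 := by
    intro q
    rw [hμν, measureReal_def, Measure.pi_pi, ENNReal.toReal_prod, Fin.prod_univ_four]
    simp only [← measureReal_def, measure_cls ν hp hg]
    simp
    ring
  simp only [hbox]
  rw [← Finset.sum_mul, Finset.sum_filter, Finset.sum_product]
  simp only [Finset.sum_product]
  rw [sum_good t]
  have hp1 : (1 : ℝ) < p := by exact_mod_cast (Fact.out : p.Prime).one_lt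
  have ht0 : 0 < t := by positivity
  have ht1 : t < 1 := inv_lt_one_of_one_lt₀ hp1
  have hd : 1 + t + t ^ 2 ≠ 0 := by positivity
  have hd2 : (1 : ℝ) - t ≠ 0 := by linarith
  have e3 : 1 - t ^ 3 = (1 - t) * (1 + t + t ^ 2) := by ring
  have c1 : 1 / (p : ℝ) = t := by rw [ht, one_div]
  have c2 : 1 / (p : ℝ) ^ 2 = t ^ 2 := by rw [ht, one_div, inv_pow]
  have c3 : 1 / (p : ℝ) ^ 3 = t ^ 3 := by rw [ht, one_div, inv_pow]
  have c4 : 1 / (3 * (p : ℝ) ^ 2) = t ^ 2 / 3 := by rw [ht]; field_simp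
  have c5 : 3 / (p : ℝ) = 3 * t := by rw [ht]; field_simp
  have c6 : 3 / (p : ℝ) ^ 2 = 3 * t ^ 2 := by rw [ht]; field_simp
  rw [c1, c2, c3, c4, c5, c6, e3, mul_pow, div_mul_eq_div_div, div_self (pow_ne_zero 3 hd2)]
  clear_value t
  field_simp
  ring
end
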